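/- Let T be a finite bicentroidal tree with centroidal edge ab and centroidal components G and H with a ∈ V(G) and b ∈ V(H). If both a and b have degree 2 in T and neither G nor H is a pseudopath, then ern(T) = 2. -/

import Mathlib

open SimpleGraph

namespace ErnPaper

/-- The weight of a vertex `v` in a graph `G`: the number of vertices in a largest
connected component of `G - v`. -/
noncomputable def wt {V : Type} [Fintype V] (G : SimpleGraph V) (v : V) : ℕ :=
  sSup {n | ∃ c : (G.induce ({v}ᶜ : Set V)).ConnectedComponent, n = Nat.card c.supp}

/-- The centroid of a graph: the set of vertices of minimum weight. -/
def centroid {V : Type} [Fintype V] (G : SimpleGraph V) : Set V :=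
  {v | ∀ u, wt G v ≤ wt G u}

/-- The edge-reconstruction number of a finite graph `G`: the least `k` for which there exist
`k` distinct edges `e₁, …, e_k` of `G` such that any finite graph `H` having `k` distinct
edges `f₁, …, f_k` with `H - fᵢ ≅ G - eᵢ` for all `i` must be isomorphic to `G`. -/
noncomputable def ern {V : Type} [Fintype V] (G : SimpleGraph V) : ℕ :=
  sInf {k | ∃ s : Finset (Sym2 V), s.card = k ∧ (↑s : Set (Sym2 V)) ⊆ G.edgeSet ∧
    ∀ (W : Type) (_ : Fintype W) (H : SimpleGraph W) (t : Finset (Sym2 W)),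
      (↑t : Set (Sym2 W)) ⊆ H.edgeSet →
      (∃ φ : {e // e ∈ s} ≃ {f // f ∈ t},
        ∀ e : {e // e ∈ s},
          Nonempty (H.deleteEdges {(φ e).1} ≃g G.deleteEdges {e.1})) →
      Nonempty (H ≃g G)}

/-- The spider tree `S_{p,q,r}`: three paths with `p`, `q`, `r` edges respectively,
emanating from a common central vertex. -/
def spider (p q r : ℕ) : SimpleGraph (Unit ⊕ (Fin p ⊕ Fin q ⊕ Fin r)) :=
  SimpleGraph.fromRel fun x y =>
    match x, y with
    | Sum.inl _, Sum.inr (Sum.inl j) => (j : ℕ) = 0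
    | Sum.inl _, Sum.inr (Sum.inr (Sum.inl j)) => (j : ℕ) = 0
    | Sum.inl _, Sum.inr (Sum.inr (Sum.inr j)) => (j : ℕ) = 0
    | Sum.inr (Sum.inl i), Sum.inr (Sum.inl j) => (j : ℕ) = (i : ℕ) + 1
    | Sum.inr (Sum.inr (Sum.inl i)), Sum.inr (Sum.inr (Sum.inl j)) => (j : ℕ) = (i : ℕ) + 1
    | Sum.inr (Sum.inr (Sum.inr i)), Sum.inr (Sum.inr (Sum.inr j)) => (j : ℕ) = (i : ℕ) + 1
    | _, _ => False

/-- A pseudopath: a tree isomorphic to a path `P_k`, to `S_{1,1,2}`, or to `S_{1,2,3}`. -/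
def IsPseudopath {V : Type} (T : SimpleGraph V) : Prop :=
  (∃ k, Nonempty (T ≃g pathGraph k)) ∨
    Nonempty (T ≃g spider 1 1 2) ∨ Nonempty (T ≃g spider 1 2 3)

/-- `T - xv + yv`: delete the end-edge `xv` and add the new edge `yv`. -/
def replaceEdge {V : Type} (T : SimpleGraph V) (x v y : V) : SimpleGraph V :=
  SimpleGraph.fromEdgeSet ((T.edgeSet \ {s(x, v)}) ∪ {s(y, v)})

/-- The disjoint union of two simple graphs. -/
def disjUnion {α β : Type} (G : SimpleGraph α) (H : SimpleGraph β) :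
    SimpleGraph (α ⊕ β) :=
  SimpleGraph.fromRel fun x y =>
    match x, y with
    | Sum.inl a, Sum.inl b => G.Adj a b
    | Sum.inr a, Sum.inr b => H.Adj a b
    | _, _ => False

/-- The caterpillar `C(2,0,…,0,2)` with spine on `m` vertices: spine path `v₀ … v_{m-1}`,
with two extra endvertices adjacent to `v₀` and two to `v_{m-1}`. -/
def doubleBroom (m : ℕ) : SimpleGraph (Fin m ⊕ Fin 4) :=
  SimpleGraph.fromRel fun x y =>
    match x, y with
    | Sum.inl i, Sum.inl j => (j : ℕ) = (i : ℕ) + 1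
    | Sum.inl i, Sum.inr l =>
        ((i : ℕ) = 0 ∧ (l : ℕ) < 2) ∨ ((i : ℕ) = m - 1 ∧ 2 ≤ (l : ℕ))
    | _, _ => False


section

/-- Tree metrics, axiomatically. -/
structure TM {V : Type} (d : V → V → ℕ) : Prop where
  self : ∀ x, d x x = 0
  eq : ∀ x y, d x y = 0 → x = y
  symm : ∀ x y, d x y = d y x
  four : ∀ x y z q, d x y + d z q ≤ max (d x z + d y q) (d x q + d y z)
  par : ∀ x y z, (d x y + d y z + d x z) % 2 = 0
  geo : ∀ x y, x ≠ y → ∃ z, d x z = 1 ∧ d z y + 1 = d x y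

/-- `v` is a leaf with neighbour `p`. -/
def Leaf {V : Type} (d : V → V → ℕ) (v p : V) : Prop :=
  v ≠ p ∧ ∀ x, x ≠ v → d v x = d p x + 1

open Classical in
/-- move the leaf `v` to `w` -/
noncomputable def mvd {V : Type} (d : V → V → ℕ) (v w : V) : V → V → ℕ := fun x y =>
  if x = y then 0 else if x = v then d w y + 1 else if y = v then d x w + 1 else d x y

/-- isometric -/
def Isom {V W : Type} (d : V → V → ℕ) (d' : W → W → ℕ) : Prop :=
  ∃ σ : V ≃ W, ∀ x y, d' (σ x) (σ y) = d x y

theorem Isom.symm {V W : Type} {d : V → V → ℕ} {d' : W → W → ℕ} (h : Isom d d') : Isom d' d := by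
  obtain ⟨σ, h⟩ := h
  exact ⟨σ.symm, fun x y => by rw [← h]; simp⟩

theorem Isom.trans {V W X : Type} {d : V → V → ℕ} {d' : W → W → ℕ} {d'' : X → X → ℕ}
    (h : Isom d d') (h' : Isom d' d'') : Isom d d'' := by
  obtain ⟨σ, h⟩ := h
  obtain ⟨τ, h'⟩ := h'
  exact ⟨σ.trans τ, fun x y => by simp [h, h']⟩

theorem Isom.refl {V : Type} (d : V → V → ℕ) : Isom d d := ⟨Equiv.refl _, fun _ _ => rfl⟩

namespace TM
variable {V : Type} {d : V → V → ℕ}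

theorem tri (h : TM d) (x y z : V) : d x z ≤ d x y + d y z := by
  have := h.four x z y y
  have h1 := h.self y
  have h2 := h.symm z y
  omega

theorem pos (h : TM d) {x y : V} (hxy : x ≠ y) : 0 < d x y := by
  rcases Nat.eq_zero_or_pos (d x y) with h0 | h0
  · exact absurd (h.eq _ _ h0) hxy
  · exact h0

/-- Extending by a leaf. -/
theorem addleaf (v p : V) (hvp : v ≠ p) (hs : ∀ x, d x x = 0)
    (h0 : ∀ x y, x ≠ v → y ≠ v → d x y = 0 → x = y)
    (hsy : ∀ x y, d x y = d y x)
    (h4 : ∀ x y z q, x ≠ v → y ≠ v → z ≠ v → q ≠ v →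
      d x y + d z q ≤ max (d x z + d y q) (d x q + d y z))
    (hp : ∀ x y z, x ≠ v → y ≠ v → z ≠ v → (d x y + d y z + d x z) % 2 = 0)
    (hg : ∀ x y, x ≠ v → y ≠ v → x ≠ y → ∃ z, z ≠ v ∧ d x z = 1 ∧ d z y + 1 = d x y)
    (hl : ∀ x, x ≠ v → d v x = d p x + 1) : TM d := by
  have hl' : ∀ x, x ≠ v → d x v = d p x + 1 := fun x hx => by rw [hsy, hl x hx]
  have tri : ∀ x y z, x ≠ v → y ≠ v → z ≠ v → d x z ≤ d x y + d y z := by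
    intro x y z hx hy hz
    have := h4 x z y y hx hz hy hy
    have h1 := hs y
    have h2 := hsy z y
    omega
  refine ⟨hs, ?_, hsy, ?_, ?_, ?_⟩
  · intro x y hxy
    by_cases hx : x = v
    · by_cases hy : y = v
      · rw [hx, hy]
      · rw [hx, hl y hy] at hxy; omega
    · by_cases hy : y = v
      · rw [hy, hl' x hx] at hxy; omega
      · exact h0 x y hx hy hxy
  · intro x y z q
    have hp' := hvp.symm
    by_cases hx : x = v <;> by_cases hy : y = v <;> by_cases hz : z = v <;> by_cases hq : q = v <;>
      subst_vars
    all_goals first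
      | (exact h4 x y z q hx hy hz hq)
      | skip
    all_goals
      try rw [hl x hx]
      try rw [hl y hy]
      try rw [hl z hz]
      try rw [hl q hq]
      try rw [hl' x hx]
      try rw [hl' y hy]
      try rw [hl' z hz]
      try rw [hl' q hq]
      try rw [hs]
    · omega
    · omega
    · omega
    · have := tri z p q hz hp' hq
      have := hsy z p
      omega
    · omega
    · omega
    · omega
    · have := h4 p y z q hp' hy hz hq
      omega
    · omega
    · omega
    · omega
    · have := h4 x p z q hx hp' hz hq
      have := hsy x p
      omega
    · have := tri x p y hx hp' hy
      have := hsy x p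
      omega
    · have := h4 x y p q hx hy hp' hq
      have := hsy x p
      have := hsy y p
      omega
    · have := h4 x y z p hx hy hz hp'
      have := hsy x p
      have := hsy y p
      have := hsy z p
      omega
  · intro x y z
    by_cases hx : x = v <;> by_cases hy : y = v <;> by_cases hz : z = v <;> subst_vars
    · have := hs z; omega
    · have := hl z hz
      have := hs y
      omega
    · have := hl y hy
      have := hl' y hy
      have := hs z
      omega
    · have := hp p y z hvp.symm hy hz
      have := hl y hy
      have := hl z hz
      omega
    · have := hl' x hx
      have := hs z
      omega
    · have := hp x p z hx hvp.symm hz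
      have := hl' x hx
      have := hl z hz
      have := hsy x p
      omega
    · have := hp x y p hx hy hvp.symm
      have := hl' x hx
      have := hl' y hy
      have := hsy x p
      have := hsy y p
      omega
    · exact hp x y z hx hy hz
  · intro x y hxy
    by_cases hx : x = v
    · subst hx
      refine ⟨p, ?_, ?_⟩
      · rw [hl p hvp.symm, hs]
      · rw [hl y hxy.symm]
    · by_cases hy : y = v
      · subst hy
        by_cases hxp : x = p
        · subst hxp
          refine ⟨y, ?_, ?_⟩
          · rw [hl' x hx, hs]
          · rw [hl' x hx, hs, hs]
        · obtain ⟨z, hz, h1, h2⟩ := hg x p hx hvp.symm hxp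
          refine ⟨z, h1, ?_⟩
          rw [hl' z hz, hl' x hx, hsy p z, hsy p x]
          omega
      · obtain ⟨z, hz, h1, h2⟩ := hg x y hx hy hxy
        exact ⟨z, h1, h2⟩

theorem geo_ne (h : TM d) {v p : V} (hl : Leaf d v p) (x y : V) (hx : x ≠ v) (hy : y ≠ v)
    (hxy : x ≠ y) : ∃ z, z ≠ v ∧ d x z = 1 ∧ d z y + 1 = d x y := by
  obtain ⟨z, h1, h2⟩ := h.geo x y hxy
  refine ⟨z, ?_, h1, h2⟩
  rintro rfl
  have a1 := hl.2 x hx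
  have a2 := hl.2 y hy
  have a3 := h.symm x z
  have a4 := h.eq p x (by omega)
  subst a4
  omega

end TM

section mv
variable {V : Type} {d : V → V → ℕ}

theorem mvd_ne {v w x y : V} (h : TM d) (hx : x ≠ v) (hy : y ≠ v) : mvd d v w x y = d x y := by
  unfold mvd
  by_cases hxy : x = y
  · subst hxy; simp [h.self]
  · simp [hxy, hx, hy]

theorem mvd_left {v w x : V} (hx : x ≠ v) : mvd d v w v x = d w x + 1 := by
  unfold mvd
  simp [hx.symm]

theorem mvd_right {v w x : V} (hx : x ≠ v) : mvd d v w x v = d x w + 1 := by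
  unfold mvd
  simp [hx]

theorem mvd_self {v w x : V} : mvd d v w x x = 0 := by simp [mvd]

theorem mvd_leaf {v w : V} (h : TM d) (hw : w ≠ v) : Leaf (mvd d v w) v w := by
  refine ⟨hw.symm, fun x hx => ?_⟩
  rw [mvd_left hx, mvd_ne h hw hx]

theorem mvd_TM {v p w : V} (h : TM d) (hl : Leaf d v p) (hw : w ≠ v) : TM (mvd d v w) := by
  have e : ∀ x y, x ≠ v → y ≠ v → mvd d v w x y = d x y := fun x y => mvd_ne h
  refine TM.addleaf v w hw.symm (fun x => mvd_self) ?_ ?_ ?_ ?_ ?_ (mvd_leaf h hw).2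
  · intro x y hx hy; rw [e x y hx hy]; exact h.eq x y
  · intro x y
    unfold mvd
    by_cases hxy : x = y
    · simp [hxy]
    · have : y ≠ x := fun h => hxy h.symm
      by_cases hx : x = v
      · subst hx
        simp [hxy, this, h.symm]
      · by_cases hy : y = v
        · subst hy
          simp [hxy, this, h.symm]
        · simp [hxy, this, hx, hy, h.symm]
  · intro x y z q hx hy hz hq
    simp only [e, *, ne_eq, not_false_eq_true]
    exact h.four x y z q
  · intro x y z hx hy hz
    simp only [e, *, ne_eq, not_false_eq_true]
    exact h.par x y z
  · intro x y hx hy hxy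
    obtain ⟨z, hz, h1, h2⟩ := h.geo_ne hl x y hx hy hxy
    exact ⟨z, hz, by rw [e x z hx hz, h1], by rw [e z y hz hy, e x y hx hy, h2]⟩

theorem mvd_id {v p : V} (h : TM d) (hl : Leaf d v p) : mvd d v p = d := by
  funext x y
  by_cases hx : x = v
  · subst hx
    by_cases hy : y = x
    · subst hy; rw [mvd_self, h.self]
    · rw [mvd_left hy, hl.2 y hy]
  · by_cases hy : y = v
    · subst hy; rw [mvd_right hx, h.symm x y, hl.2 x hx, h.symm]
    · exact mvd_ne h hx hy

end mv

theorem TM.le_of_adj {V W : Type} {d : V → V → ℕ} {d' : W → W → ℕ} (h : TM d) (h' : TM d')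
    (σ : V → W) (hs : ∀ x y, d x y = 1 → d' (σ x) (σ y) = 1) :
    ∀ n x y, d x y = n → d' (σ x) (σ y) ≤ n := by
  intro n
  induction n with
  | zero => intro x y hxy; rw [h.eq x y hxy, h'.self]
  | succ n ih =>
    intro x y hxy
    have : x ≠ y := by rintro rfl; rw [h.self] at hxy; omega
    obtain ⟨z, h1, h2⟩ := h.geo x y this
    have a := ih z y (by omega)
    have b := hs x z h1
    have c := h'.tri (σ x) (σ z) (σ y)
    omega

theorem TM.isom_of_adj {V W : Type} {d : V → V → ℕ} {d' : W → W → ℕ} (h : TM d) (h' : TM d')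
    (σ : V ≃ W) (hs : ∀ x y, d' (σ x) (σ y) = 1 ↔ d x y = 1) (x y : V) :
    d' (σ x) (σ y) = d x y := by
  apply le_antisymm
  · exact TM.le_of_adj h h' σ (fun x y => (hs x y).2) _ x y rfl
  · have := TM.le_of_adj h' h σ.symm (fun x y hxy => by
      rw [← hs]; simpa using hxy) _ (σ x) (σ y) rfl
    simpa using this

/-- `d` is the metric of the tree `G`. -/
structure MT {V : Type} (G : SimpleGraph V) (d : V → V → ℕ) : Prop where
  tm : TM d
  adj : ∀ x y, G.Adj x y ↔ d x y = 1

theorem exists_MT : ∀ (n : ℕ) (V : Type) [Fintype V] (G : SimpleGraph V), G.IsTree →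
    Fintype.card V = n → ∃ d, MT G d := by
  classical
  intro n
  induction n with
  | zero =>
    intro V _ G hG hn
    have := hG.connected.nonempty
    have := Fintype.card_pos (α := V)
    omega
  | succ n ih =>
    intro V _ G hG hn
    by_cases hnt : Nontrivial V
    · obtain ⟨v, hv⟩ := hG.exists_vert_degree_one_of_nontrivial
      have hc := hG.connected.induce_compl_singleton_of_degree_eq_one hv
      obtain ⟨p, hp, hp'⟩ := degree_eq_one_iff_existsUnique_adj.mp hv
      have ht : (G.induce {v}ᶜ).IsTree := ⟨hc, hG.isAcyclic.induce _⟩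
      obtain ⟨d0, h0⟩ := ih ({v}ᶜ : Set V) (G.induce {v}ᶜ) ht (by
        rw [Fintype.card_compl_set]; simp [hn])
      have hpv : p ≠ v := hp.ne.symm
      let f : V → ({v}ᶜ : Set V) := fun x => if h : x = v then ⟨p, hpv⟩ else ⟨x, h⟩
      have hf : ∀ x, (h : x ≠ v) → f x = ⟨x, h⟩ := fun x h => by simp [f, h]
      let d : V → V → ℕ := fun x y => if x = y then 0 else if x = v ∨ y = v then d0 (f x) (f y) + 1
        else d0 (f x) (f y)
      have hd : ∀ x y (hx : x ≠ v) (hy : y ≠ v), d x y = d0 ⟨x, hx⟩ ⟨y, hy⟩ := by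
        intro x y hx hy
        simp only [d, hx, hy, or_self, if_false, hf _ hx, hf _ hy]
        split_ifs with h
        · subst h; rw [h0.tm.self]
        · rfl
      have hsym : ∀ x y, d x y = d y x := by
        intro x y
        simp only [d, h0.tm.symm (f x) (f y), eq_comm (a := x) (b := y), or_comm (a := x = v)]
      have hl : ∀ x, x ≠ v → d v x = d p x + 1 := by
        intro x hx
        rw [hd p x hpv hx]
        simp [d, hx.symm, f, hx]
      have htm : TM d := by
        refine TM.addleaf v p hpv.symm (fun x => by simp [d]) ?_ hsym ?_ ?_ ?_ hl
        · intro x y hx hy; rw [hd x y hx hy]; intro h; exact congrArg Subtype.val (h0.tm.eq _ _ h)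
        · intro x y z q hx hy hz hq
          simp only [hd _ _ hx, hd _ _ hy, hd _ _ hz, hd _ _ hq, hy, hz, hq, ne_eq,
            not_false_eq_true]
          exact h0.tm.four _ _ _ _
        · intro x y z hx hy hz
          rw [hd x y hx hy, hd y z hy hz, hd x z hx hz]
          exact h0.tm.par _ _ _
        · intro x y hx hy hxy
          obtain ⟨⟨z, hz⟩, h1, h2⟩ := h0.tm.geo ⟨x, hx⟩ ⟨y, hy⟩ (fun h => hxy (congrArg Subtype.val h))
          refine ⟨z, hz, ?_, ?_⟩
          · rw [hd x z hx hz]; exact h1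
          · rw [hd z y hz hy, hd x y hx hy]; exact h2
      refine ⟨d, htm, ?_⟩
      have hadjv : ∀ y, G.Adj v y ↔ d v y = 1 := by
        intro y
        constructor
        · intro h
          have : y = p := hp' y h
          subst this
          rw [hl y hpv, htm.self]
        · intro h
          have hy : y ≠ v := by rintro rfl; rw [htm.self] at h; omega
          rw [hl y hy] at h
          have := htm.eq p y (by omega)
          rw [← this]; exact hp
      intro x y
      by_cases hx : x = v
      · rw [hx]; exact hadjv y
      · by_cases hy : y = v
        · rw [hy, G.adj_comm, htm.symm]; exact hadjv x
        · rw [hd x y hx hy, ← h0.adj]; rfl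
    · have hs : Subsingleton V := not_nontrivial_iff_subsingleton.mp hnt
      refine ⟨fun _ _ => 0, ⟨fun _ => rfl, fun x y _ => Subsingleton.elim _ _, fun _ _ => rfl,
        by simp, by simp, fun x y h => absurd (Subsingleton.elim x y) h⟩, fun x y => ?_⟩
      simp [Subsingleton.elim x y]

/-- graph-level move of a leaf -/
def mvg {V : Type} (G : SimpleGraph V) (v w : V) : SimpleGraph V where
  Adj x y := (x ≠ v ∧ y ≠ v ∧ G.Adj x y) ∨ (x = v ∧ y = w ∧ v ≠ w) ∨ (y = v ∧ x = w ∧ v ≠ w)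
  symm := ⟨fun x y h => by
    rcases h with h | h | h
    · exact Or.inl ⟨h.2.1, h.1, h.2.2.symm⟩
    · exact Or.inr (Or.inr h)
    · exact Or.inr (Or.inl h)⟩
  loopless := ⟨fun x h => by
    rcases h with h | ⟨h1, h2, h3⟩ | ⟨h1, h2, h3⟩
    · exact h.2.2.ne rfl
    · exact h3 (h1.symm.trans h2)
    · exact h3 (h1.symm.trans h2)⟩

theorem MT.mv {V : Type} {G : SimpleGraph V} {d : V → V → ℕ} (h : MT G d) {v p w : V}
    (hl : Leaf d v p) (hw : w ≠ v) : MT (mvg G v w) (mvd d v w) := by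
  refine ⟨mvd_TM h.tm hl hw, fun x y => ?_⟩
  by_cases hx : x = v
  · by_cases hy : y = v
    · rw [hx, hy, mvd_self]; simp
    · rw [hx, mvd_left hy]
      simp only [mvg, ne_eq, not_true_eq_false, false_and, true_and, hy, or_false, false_or]
      constructor
      · rintro ⟨rfl, h2⟩; rw [h.tm.self]
      · intro h2; exact ⟨(h.tm.eq _ _ (by omega)).symm, hw.symm⟩
  · by_cases hy : y = v
    · rw [hy, mvd_right hx]
      simp only [mvg, ne_eq, not_true_eq_false, false_and, true_and, hx, or_false, false_or, and_false]
      constructor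
      · rintro ⟨rfl, h2⟩; rw [h.tm.self]
      · intro h2; exact ⟨(h.tm.eq _ _ (by omega)), hw.symm⟩
    · rw [mvd_ne h.tm hx hy, ← h.adj]
      simp [mvg, hx, hy]

theorem MT.isom_iff {V W : Type} {G : SimpleGraph V} {G' : SimpleGraph W} {d : V → V → ℕ}
    {d' : W → W → ℕ} (h : MT G d) (h' : MT G' d') : Isom d d' ↔ Nonempty (G ≃g G') := by
  constructor
  · rintro ⟨σ, hs⟩
    exact ⟨⟨σ, fun {x y} => by rw [h.adj, h'.adj, hs]⟩⟩
  · rintro ⟨σ⟩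
    exact ⟨σ.toEquiv, h.tm.isom_of_adj h'.tm σ.toEquiv (fun x y => by
      rw [← h.adj, ← h'.adj]; exact σ.map_adj_iff)⟩

end

section

/-- eccentricity -/
def ecc {V : Type} [Fintype V] (d : V → V → ℕ) (x : V) : ℕ := Finset.univ.sup (d x)
/-- diameter -/
def dia {V : Type} [Fintype V] (d : V → V → ℕ) : ℕ := Finset.univ.sup (ecc d)
/-- Gromov-type product relative to the centre -/
def tau {V : Type} [Fintype V] (d : V → V → ℕ) (x y : V) : ℕ := ecc d x + ecc d y - d x y
/-- leaf -/
def IsLeaf {V : Type} (d : V → V → ℕ) (v : V) : Prop := ∃ p, Leaf d v p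
/-- `v` avoids some diametral pair -/
def NC {V : Type} [Fintype V] (d : V → V → ℕ) (v : V) : Prop :=
  ∃ x y, x ≠ v ∧ y ≠ v ∧ d x y = dia d

section
variable {V : Type} [Fintype V] {d : V → V → ℕ}

theorem le_ecc (x y : V) : d x y ≤ ecc d x := Finset.le_sup (f := d x) (Finset.mem_univ y)
theorem ecc_le_dia (x : V) : ecc d x ≤ dia d := Finset.le_sup (f := ecc d) (Finset.mem_univ x)
theorem le_dia (x y : V) : d x y ≤ dia d := (le_ecc x y).trans (ecc_le_dia x)
theorem exists_ecc (x : V) : ∃ y, d x y = ecc d x := by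
  obtain ⟨y, _, hy⟩ := Finset.exists_mem_eq_sup Finset.univ ⟨x, Finset.mem_univ x⟩ (d x)
  exact ⟨y, hy.symm⟩
theorem exists_dia [Nonempty V] : ∃ x y, d x y = dia d := by
  obtain ⟨x, _, hx⟩ := Finset.exists_mem_eq_sup (Finset.univ : Finset V)
    Finset.univ_nonempty (ecc d)
  obtain ⟨y, hy⟩ := exists_ecc (d := d) x
  exact ⟨x, y, hy.trans hx.symm⟩
theorem ecc_eq_of {x : V} {n : ℕ} (h1 : ∀ y, d x y ≤ n) (h2 : ∃ y, d x y = n) : ecc d x = n := by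
  apply le_antisymm
  · obtain ⟨y, hy⟩ := exists_ecc (d := d) x
    rw [← hy]; exact h1 y
  · obtain ⟨y, hy⟩ := h2
    rw [← hy]; exact le_ecc x y

namespace TM

theorem ecc_dia (h : TM d) {x y : V} (hxy : d x y = dia d) (u : V) :
    ecc d u = max (d u x) (d u y) := by
  obtain ⟨q, hq⟩ := exists_ecc (d := d) u
  have h1 := h.four u q x y
  have h2 := le_dia (d := d) q y
  have h3 := le_dia (d := d) q x
  have h4 := le_ecc (d := d) u x
  have h5 := le_ecc (d := d) u y
  omega

theorem tau_add (_h : TM d) (x y : V) : tau d x y + d x y = ecc d x + ecc d y := by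
  have := le_ecc (d := d) x y
  unfold tau
  omega

theorem tau_symm (h : TM d) (x y : V) : tau d x y = tau d y x := by
  unfold tau; rw [h.symm x y]; omega

theorem tau_self (h : TM d) (x : V) : tau d x x = 2 * ecc d x := by
  unfold tau; rw [h.self]; omega

theorem ecc_lip (h : TM d) (x y : V) : ecc d x ≤ ecc d y + d x y := by
  obtain ⟨q, hq⟩ := exists_ecc (d := d) x
  have h1 := h.tri x y q
  have h2 := le_ecc (d := d) y q
  omega

theorem tau_le (h : TM d) (x y : V) : tau d x y ≤ 2 * ecc d x := by
  have := h.ecc_lip y x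
  have := h.tau_add x y
  have := h.symm x y
  omega

theorem tau_ultra (h : TM d) (x y z : V) : min (tau d x y) (tau d y z) ≤ tau d x z := by
  obtain ⟨q, hq⟩ := exists_ecc (d := d) y
  have h1 := h.four x z y q
  have h2 := le_ecc (d := d) x q
  have h3 := le_ecc (d := d) z q
  have h4 := h.tau_add x y
  have h5 := h.tau_add y z
  have h6 := h.tau_add x z
  have h7 := h.symm z y
  omega

theorem dia_le_tau (h : TM d) (x y : V) : dia d ≤ tau d x y := by
  haveI : Nonempty V := ⟨x⟩
  obtain ⟨q, q', hq⟩ := exists_dia (d := d)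
  have h1 := h.four x y q q'
  have h2 := le_ecc (d := d) x q
  have h3 := le_ecc (d := d) x q'
  have h4 := le_ecc (d := d) y q
  have h5 := le_ecc (d := d) y q'
  have h6 := h.tau_add x y
  omega

/-- unique neighbour gives a leaf -/
theorem leaf_of_nbr (h : TM d) {v p : V} (h1 : d v p = 1) (h2 : ∀ q, d v q = 1 → q = p) :
    Leaf d v p := by
  refine ⟨?_, ?_⟩
  · rintro rfl; rw [h.self] at h1; omega
  · intro x hx
    obtain ⟨z, h3, h4⟩ := h.geo v x hx.symm
    rw [← h2 z h3]; omega

theorem leaf_nbr (h : TM d) {v p : V} (hl : Leaf d v p) : d v p = 1 := by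
  rw [hl.2 p hl.1.symm, h.self]

theorem leaf_nbr_unique (h : TM d) {v p q : V} (hl : Leaf d v p) (hq : d v q = 1) : q = p := by
  have : q ≠ v := by rintro rfl; rw [h.self] at hq; omega
  have := hl.2 q this
  exact (h.eq p q (by omega)).symm

theorem leaf_ecc (h : TM d) {v p : V} (hl : Leaf d v p) (h3 : ∃ x, x ≠ v ∧ x ≠ p) :
    ecc d v = ecc d p + 1 := by
  obtain ⟨x, hx, hxp⟩ := h3
  apply le_antisymm
  · have := h.ecc_lip v p
    have := h.leaf_nbr hl
    omega
  · obtain ⟨q, hq⟩ := exists_ecc (d := d) p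
    have h1 := h.pos hxp
    have h2 := hl.2 x hx
    have h3 := le_ecc (d := d) v x
    have h4 := h.symm x p
    by_cases hqv : q = v
    · subst hqv
      have := h.leaf_nbr hl
      have := h.symm p q
      omega
    · have := hl.2 q hqv
      have := le_ecc (d := d) v q
      omega

theorem leaf_tau (h : TM d) {v p : V} (hl : Leaf d v p) (h3 : ∃ x, x ≠ v ∧ x ≠ p) {u : V}
    (hu : u ≠ v) : tau d p u = tau d v u := by
  have h1 := h.tau_add p u
  have h2 := h.tau_add v u
  have h4 := h.leaf_ecc hl h3
  have h5 := hl.2 u hu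
  omega

/-- leaf has no descendants -/
theorem leaf_tau_le (h : TM d) {v p : V} (hl : Leaf d v p) (h3 : ∃ x, x ≠ v ∧ x ≠ p) {u : V}
    (hu : u ≠ v) : tau d v u + 2 ≤ 2 * ecc d v := by
  have h1 := h.leaf_tau hl h3 hu
  have h2 := h.tau_le p u
  have h4 := h.leaf_ecc hl h3
  omega

theorem nbr_pm (h : TM d) {x y : V} (hxy : d x y = 1) (q : V) :
    d x q = d y q + 1 ∨ d y q = d x q + 1 := by
  have h1 := h.tri x y q
  have h2 := h.tri y x q
  have h3 := h.par x y q
  have h4 := h.symm x y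
  omega

theorem deep_leaf (h : TM d) {u y : V} (hy : d u y = dia d) (huy : u ≠ y) : IsLeaf d u := by
  obtain ⟨p, h1, h2⟩ := h.geo u y huy
  refine ⟨p, ?_, ?_⟩
  · rintro rfl; rw [h.self] at h1; omega
  · intro x hx
    rcases h.nbr_pm h1 x with h3 | h3
    · exact h3
    · exfalso
      have h4 := h.four u y p x
      have h5 := le_dia (d := d) y x
      have h6 := h.symm y p
      have h7 := h.pos hx
      have h8 := h.symm x u
      omega

/-- at most one neighbour with ecc not larger -/
theorem up_unique (h : TM d) {x y z : V} (hy : d x y = 1) (hz : d x z = 1)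
    (ey : ecc d y ≤ ecc d x) (ez : ecc d z ≤ ecc d x) : y = z := by
  by_contra hne
  -- d y z = 2
  obtain ⟨q, hq⟩ := exists_ecc (d := d) x
  have h1 := h.tri y x z
  have h2 := h.pos hne
  have h3 := h.par x y z
  have h4 := h.symm x y
  have h5 := h.symm x z
  have h0 := h.tau_ultra y x z
  have a1 := h.tau_add y x
  have a2 := h.tau_add x z
  have a3 := h.tau_add y z
  -- far vertex from x; one of y, z is away from it
  have h6 := h.four x q y z
  have h7 := le_ecc (d := d) y q
  have h8 := le_ecc (d := d) z q
  have h9 := h.symm q z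
  have h10 := h.symm q y
  have h11 := h.nbr_pm hy q
  have h12 := h.nbr_pm hz q
  omega

/-- neighbours of larger ecc -/
theorem exists_down (h : TM d) (u : V) (hnl : ¬ IsLeaf d u) (hex : ∃ x, x ≠ u) :
    ∃ u', d u u' = 1 ∧ ecc d u' = ecc d u + 1 := by
  by_contra hcon
  push Not at hcon
  obtain ⟨x, hx⟩ := hex
  obtain ⟨p, hp, _⟩ := h.geo u x hx.symm
  apply hnl
  refine ⟨p, h.leaf_of_nbr hp ?_⟩
  have key : ∀ q, d u q = 1 → ecc d q ≤ ecc d u := by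
    intro q hq
    have h1 := hcon q hq
    have h2 := h.ecc_lip q u
    have h3 := h.symm q u
    omega
  intro q hq
  exact h.up_unique hq hp (key q hq) (key p hp)

theorem exists_leaf_tau (h : TM d) (w : V) (hex : ∃ x y : V, x ≠ y) :
    ∃ y, IsLeaf d y ∧ tau d y w = 2 * ecc d w := by
  classical
  let S : Finset V := Finset.univ.filter (fun u => tau d u w = 2 * ecc d w)
  have hS : S.Nonempty := ⟨w, by simp [S, h.tau_self]⟩
  obtain ⟨u, hu, hmax⟩ := S.exists_max_image (ecc d) hS
  have hu' : tau d u w = 2 * ecc d w := by simpa [S] using hu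
  refine ⟨u, ?_, hu'⟩
  by_contra hnl
  have : ∃ x, x ≠ u := by
    obtain ⟨x, y, hxy⟩ := hex
    by_cases hxu : x = u
    · exact ⟨y, fun hy => hxy (hxu.trans hy.symm)⟩
    · exact ⟨x, hxu⟩
  obtain ⟨u', h1, h2⟩ := h.exists_down u hnl this
  have h3 := h.tau_ultra u' u w
  have h4 := h.tau_add u' u
  have h5 := h.symm u u'
  have h6 := h.tau_le u w
  have h7 := h.tau_le w u'
  have h8 := h.tau_symm w u'
  have h9 := hmax u' (by simp only [S, Finset.mem_filter, Finset.mem_univ, true_and]; omega)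
  omega

/-- extend a geodesic to a leaf -/
theorem ext_leaf (h : TM d) {x u : V} (hxu : x ≠ u) :
    ∃ L, IsLeaf d L ∧ d x L = d x u + d u L := by
  classical
  let S : Finset V := Finset.univ.filter (fun L => d x L = d x u + d u L)
  have hS : S.Nonempty := ⟨u, by simp [S, h.self]⟩
  obtain ⟨L, hL, hmax⟩ := S.exists_max_image (d x) hS
  have hL' : d x L = d x u + d u L := by simpa [S] using hL
  refine ⟨L, ?_, hL'⟩
  have hpos := h.pos hxu
  have hLx : L ≠ x := by rintro rfl; rw [h.self] at hL'; omega
  obtain ⟨p, h1, h2⟩ := h.geo L x hLx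
  refine ⟨p, h.leaf_of_nbr h1 ?_⟩
  intro q hq
  by_contra hqp
  have h3 : d L x = d q x + 1 ∨ d q x = d L x + 1 := h.nbr_pm hq x
  have s1 := h.symm L x
  have s2 := h.symm q x
  have s3 := h.symm p x
  have s4 := h.symm L q
  have s5 := h.symm L p
  have hpq := h.pos hqp
  have h5 := h.tri q L p
  have h6 := h.par q L p
  rcases h3 with h3 | h3
  · have h4 := h.four L x q p
    have s6 := h.symm x p
    have s7 := h.symm x q
    omega
  · have h7 := h.tri u L q
    have h8 := h.tri x u q
    have h9 := hmax q (by simp only [S, Finset.mem_filter, Finset.mem_univ, true_and]; omega)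
    omega

end TM

/-! ### transport -/
variable {W : Type} [Fintype W] {d' : W → W → ℕ}

theorem ecc_isom (σ : V ≃ W) (hs : ∀ x y, d' (σ x) (σ y) = d x y) (x : V) :
    ecc d' (σ x) = ecc d x := by
  apply ecc_eq_of
  · intro y
    have := hs x (σ.symm y)
    simp only [Equiv.apply_symm_apply] at this
    rw [this]; exact le_ecc _ _
  · obtain ⟨y, hy⟩ := exists_ecc (d := d) x
    exact ⟨σ y, by rw [hs, hy]⟩

theorem dia_isom (σ : V ≃ W) (hs : ∀ x y, d' (σ x) (σ y) = d x y) : dia d' = dia d := by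
  apply le_antisymm
  · apply Finset.sup_le
    intro y _
    have := ecc_isom σ hs (σ.symm y)
    simp only [Equiv.apply_symm_apply] at this
    rw [this]; exact ecc_le_dia _
  · apply Finset.sup_le
    intro x _
    rw [← ecc_isom σ hs x]; exact ecc_le_dia _

theorem tau_isom (σ : V ≃ W) (hs : ∀ x y, d' (σ x) (σ y) = d x y) (x y : V) :
    tau d' (σ x) (σ y) = tau d x y := by
  unfold tau; rw [ecc_isom σ hs, ecc_isom σ hs, hs]

theorem leaf_isom {V W : Type} {d : V → V → ℕ} {d' : W → W → ℕ} (σ : V ≃ W)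
    (hs : ∀ x y, d' (σ x) (σ y) = d x y) {v p : V} (hl : Leaf d v p) :
    Leaf d' (σ v) (σ p) := by
  refine ⟨fun h => hl.1 (σ.injective h), fun x hx => ?_⟩
  have h1 := hl.2 (σ.symm x) (fun h => hx (by rw [← h]; simp))
  rw [← hs, ← hs] at h1
  simpa using h1

theorem isLeaf_isom {V W : Type} {d : V → V → ℕ} {d' : W → W → ℕ} (σ : V ≃ W)
    (hs : ∀ x y, d' (σ x) (σ y) = d x y) (v : V) :
    IsLeaf d' (σ v) ↔ IsLeaf d v := by
  constructor
  · rintro ⟨p, hp⟩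
    have := leaf_isom (d' := d) σ.symm (fun x y => by rw [← hs]; simp) hp
    exact ⟨_, by simpa using this⟩
  · rintro ⟨p, hp⟩; exact ⟨_, leaf_isom σ hs hp⟩

theorem mvd_isom {V W : Type} {d : V → V → ℕ} {d' : W → W → ℕ} (σ : V ≃ W)
    (hs : ∀ x y, d' (σ x) (σ y) = d x y) (v w x y : V) :
    mvd d' (σ v) (σ w) (σ x) (σ y) = mvd d v w x y := by
  unfold mvd
  have e : ∀ a b : V, σ a = σ b ↔ a = b := fun a b => σ.injective.eq_iff
  have e' := e
  rw [hs, hs, hs]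
  split_ifs with g1 g2 g3 g4 g5 g6 g7 <;> first | rfl | (simp only [e] at *; first | contradiction | (exfalso; tauto))

/-! ### leaves of a move -/
theorem leaf_mv_classify (h : TM d) {v p w g : V} (hl : Leaf d v p) (hw : w ≠ v)
    (hg : IsLeaf (mvd d v w) g) (hgv : g ≠ v) (hgp : g ≠ p) : IsLeaf d g ∧ g ≠ w ∨ (∀ x, x = v ∨ x = w) := by
  have h' := mvd_TM h hl hw
  obtain ⟨q, hq⟩ := hg
  by_cases hgw : g = w
  · right
    subst hgw
    have h1 : mvd d v g g v = 1 := by rw [mvd_right hgv, h.self]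
    have h2 : v = q := h'.leaf_nbr_unique hq h1
    subst h2
    intro x
    by_contra hx
    push Not at hx
    have := hq.2 x hx.2
    rw [mvd_ne h hgv hx.1, mvd_left hx.1] at this
    omega
  · left
    refine ⟨⟨q, ?_⟩, hgw⟩
    have hqv : q ≠ v := by
      rintro rfl
      have := h'.leaf_nbr hq
      rw [mvd_right hgv] at this
      exact hgw (h.eq g w (by omega))
    apply h.leaf_of_nbr
    · have := h'.leaf_nbr hq
      rwa [mvd_ne h hgv hqv] at this
    · intro r hr
      have hrv : r ≠ v := by
        rintro rfl
        exact hgp (h.leaf_nbr_unique hl (by rw [h.symm]; exact hr))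
      apply h'.leaf_nbr_unique hq
      rw [mvd_ne h hgv hrv]; exact hr

theorem leaf_mv_old (h : TM d) {v w g : V} (hw : w ≠ v)
    (hg : IsLeaf d g) (hgv : g ≠ v) (hgw : g ≠ w) (hgp : d v g ≠ 1) : IsLeaf (mvd d v w) g := by
  obtain ⟨q, hq⟩ := hg
  have hqv : q ≠ v := by
    rintro rfl
    exact hgp (by rw [h.symm]; exact h.leaf_nbr hq)
  refine ⟨q, hq.1, fun x hx => ?_⟩
  by_cases hxv : x = v
  · subst hxv
    rw [mvd_right hgv, mvd_right hqv, hq.2 w hgw.symm]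
  · rw [mvd_ne h hgv hxv, mvd_ne h hqv hxv]; exact hq.2 x hx

/-- the number of leaves -/
noncomputable def lam {V : Type} [Fintype V] (d : V → V → ℕ) : ℕ := by
  classical exact (Finset.univ.filter (fun v => IsLeaf d v)).card

theorem lam_isom (σ : V ≃ W) (hs : ∀ x y, d' (σ x) (σ y) = d x y) : lam d' = lam d := by
  classical
  unfold lam
  symm
  apply Finset.card_bij (fun x _ => σ x)
  · intro x hx
    simp only [Finset.mem_filter, Finset.mem_univ, true_and] at hx ⊢
    exact (isLeaf_isom σ hs x).2 hx
  · intro x _ y _ hxy; exact σ.injective hxy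
  · intro y hy
    refine ⟨σ.symm y, ?_, by simp⟩
    simp only [Finset.mem_filter, Finset.mem_univ, true_and] at hy ⊢
    rw [← isLeaf_isom σ hs]; simpa using hy

end
end

section
section
variable {V : Type} [Fintype V] {d : V → V → ℕ}

theorem lam_three (hlam : 3 ≤ lam d) (v p : V) : ∃ x, IsLeaf d x ∧ x ≠ v ∧ x ≠ p := by
  classical
  unfold lam at hlam
  by_contra hcon
  push Not at hcon
  have : (Finset.univ.filter (fun v => IsLeaf d v)) ⊆ {v, p} := by
    intro x hx
    simp only [Finset.mem_filter, Finset.mem_univ, true_and] at hx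
    simp only [Finset.mem_insert, Finset.mem_singleton]
    by_contra hx2
    push Not at hx2
    exact hx2.2 (hcon x hx hx2.1)
  have h1 := Finset.card_le_card this
  have h2 : ({v, p} : Finset V).card ≤ 2 := Finset.card_le_two
  omega

theorem lam_four (hlam : 4 ≤ lam d) (v p q : V) : ∃ x, IsLeaf d x ∧ x ≠ v ∧ x ≠ p ∧ x ≠ q := by
  classical
  unfold lam at hlam
  by_contra hcon
  push Not at hcon
  have : (Finset.univ.filter (fun v => IsLeaf d v)) ⊆ {v, p, q} := by
    intro x hx
    simp only [Finset.mem_filter, Finset.mem_univ, true_and] at hx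
    simp only [Finset.mem_insert, Finset.mem_singleton]
    by_contra hx2
    push Not at hx2
    exact hx2.2.2 (hcon x hx hx2.1 hx2.2.1)
  have h1 := Finset.card_le_card this
  have h2 : ({v, p, q} : Finset V).card ≤ 3 := Finset.card_le_three
  omega

theorem lam_ex (hlam : 3 ≤ lam d) (v p : V) : ∃ x, x ≠ v ∧ x ≠ p := by
  obtain ⟨x, _, h⟩ := lam_three hlam v p
  exact ⟨x, h⟩

theorem nbr_not_leaf (h : TM d) (hlam : 3 ≤ lam d) {v p : V} (hl : Leaf d v p) : ¬ IsLeaf d p := by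
  rintro ⟨q, hq⟩
  have h1 : d p v = 1 := by rw [h.symm]; exact h.leaf_nbr hl
  have := h.leaf_nbr_unique hq h1
  subst this
  obtain ⟨x, hx, hxp⟩ := lam_ex hlam v p
  have := hl.2 x hx
  have := hq.2 x hxp
  omega

theorem lam_mv_le (h : TM d) (hlam : 3 ≤ lam d) {v p w : V} (hl : Leaf d v p) (hw : w ≠ v)
    (hwl : IsLeaf d w) : lam (mvd d v w) ≤ lam d ∧
      (lam (mvd d v w) = lam d → IsLeaf (mvd d v w) p) := by
  classical
  have hwp : w ≠ p := by rintro rfl; exact nbr_not_leaf h hlam hl hwl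
  have hcl : ∀ g, IsLeaf (mvd d v w) g → g ≠ p → IsLeaf d g ∧ g ≠ w := by
    intro g hg hgp
    by_cases hgv : g = v
    · subst hgv; exact ⟨⟨p, hl⟩, hw.symm⟩
    · rcases leaf_mv_classify h hl hw hg hgv hgp with h1 | h1
      · exact h1
      · rcases h1 p with h2 | h2
        · exact absurd h2.symm hl.1
        · exact absurd h2.symm hwp
  have hc : ((Finset.univ.filter (fun v => IsLeaf d v)).erase w).card + 1 = lam d := by
    rw [Finset.card_erase_add_one]
    · rfl
    · simpa using hwl
  constructor
  · have : Finset.univ.filter (fun g => IsLeaf (mvd d v w) g) ⊆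
        insert p ((Finset.univ.filter (fun v => IsLeaf d v)).erase w) := by
      intro g hg
      simp only [Finset.mem_filter, Finset.mem_univ, true_and] at hg
      simp only [Finset.mem_insert, Finset.mem_erase, Finset.mem_filter, Finset.mem_univ, true_and]
      by_cases hgp : g = p
      · left; exact hgp
      · right; exact (hcl g hg hgp).symm
    have h1 := Finset.card_le_card this
    have h2 := Finset.card_insert_le p ((Finset.univ.filter (fun v => IsLeaf d v)).erase w)
    have h3 : lam (mvd d v w) = (Finset.univ.filter (fun g => IsLeaf (mvd d v w) g)).card := rfl
    omega
  · intro heq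
    by_contra hnp
    have : Finset.univ.filter (fun g => IsLeaf (mvd d v w) g) ⊆
        ((Finset.univ.filter (fun v => IsLeaf d v)).erase w) := by
      intro g hg
      simp only [Finset.mem_filter, Finset.mem_univ, true_and] at hg
      simp only [Finset.mem_erase, Finset.mem_filter, Finset.mem_univ, true_and]
      exact (hcl g hg (by rintro rfl; exact hnp hg)).symm
    have h1 := Finset.card_le_card this
    have h3 : lam (mvd d v w) = (Finset.univ.filter (fun g => IsLeaf (mvd d v w) g)).card := rfl
    omega

theorem lam_mv_nonleaf (h : TM d) (hlam : 3 ≤ lam d) {v p w : V} (hl : Leaf d v p) (hw : w ≠ v)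
    (hwl : ¬ IsLeaf d w) (heq : lam (mvd d v w) = lam d) : ¬ IsLeaf (mvd d v w) p := by
  classical
  intro hp
  have hpn := nbr_not_leaf h hlam hl
  have : insert p (Finset.univ.filter (fun v => IsLeaf d v)) ⊆
      Finset.univ.filter (fun g => IsLeaf (mvd d v w) g) := by
    intro g hg
    simp only [Finset.mem_insert, Finset.mem_filter, Finset.mem_univ, true_and] at hg
    simp only [Finset.mem_filter, Finset.mem_univ, true_and]
    rcases hg with hg | hg
    · rw [hg]; exact hp
    · by_cases hgv : g = v
      · rw [hgv]; exact ⟨w, mvd_leaf h hw⟩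
      · apply leaf_mv_old h hw hg hgv
        · rintro rfl; exact hwl hg
        · intro h1
          have := h.leaf_nbr_unique hl h1
          subst this
          exact hpn hg
  have h1 := Finset.card_le_card this
  rw [Finset.card_insert_of_notMem (by simpa using hpn)] at h1
  have h3 : lam (mvd d v w) = (Finset.univ.filter (fun g => IsLeaf (mvd d v w) g)).card := rfl
  have h4 : lam d = (Finset.univ.filter (fun g => IsLeaf d g)).card := rfl
  omega

/-- how eccentricities change under a move -/
theorem ecc_move (h : TM d) {v p w : V} (hl : Leaf d v p) (hw : w ≠ v)
    (hd : dia (mvd d v w) = dia d) (hc : NC d v ∨ ecc d w + 1 ≤ dia d) :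
    (∀ u, u ≠ v → ecc (mvd d v w) u = ecc d u) ∧ ecc (mvd d v w) v = ecc d w + 1 ∧
      ecc d w + 1 ≤ dia d := by
  have h' := mvd_TM h hl hw
  by_cases hnc : NC d v
  · obtain ⟨x, y, hx, hy, hxy⟩ := hnc
    have hxy' : mvd d v w x y = dia (mvd d v w) := by rw [mvd_ne h hx hy, hd, hxy]
    have e : ecc (mvd d v w) v = ecc d w + 1 := by
      rw [h'.ecc_dia hxy', mvd_left hx, mvd_left hy, h.ecc_dia hxy w]
      omega
    refine ⟨?_, e, ?_⟩
    · intro u hu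
      rw [h'.ecc_dia hxy', mvd_ne h hu hx, mvd_ne h hu hy, h.ecc_dia hxy u]
    · rw [← e, ← hd]; exact ecc_le_dia v
  · have hc' : ecc d w + 1 ≤ dia d := by tauto
    have hcr : ∀ x y, d x y = dia d → x = v ∨ y = v := by
      intro x y hxy
      by_contra hcon
      push Not at hcon
      exact hnc ⟨x, y, hcon.1, hcon.2, hxy⟩
    haveI : Nonempty V := ⟨v⟩
    have hpos : 0 < dia d := by omega
    -- far vertex from v
    obtain ⟨q, hq⟩ : ∃ q, d v q = dia d := by
      obtain ⟨x, y, hxy⟩ := exists_dia (d := d)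
      rcases hcr x y hxy with rfl | rfl
      · exact ⟨y, hxy⟩
      · exact ⟨x, by rw [h.symm]; exact hxy⟩
    obtain ⟨y, hyv, hy⟩ : ∃ y, y ≠ v ∧ d w y + 1 = dia d := by
      obtain ⟨x, y, hxy⟩ := exists_dia (d := mvd d v w)
      rw [hd] at hxy
      have hne : x ≠ y := by rintro rfl; rw [mvd_self] at hxy; omega
      by_cases hx : x = v
      · subst hx
        rw [mvd_left hne.symm] at hxy
        exact ⟨y, hne.symm, hxy⟩
      · by_cases hyv : y = v
        · subst hyv
          rw [mvd_right hx, h.symm] at hxy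
          exact ⟨x, hx, hxy⟩
        · rw [mvd_ne h hx hyv] at hxy
          rcases hcr x y hxy with h1 | h1
          · exact absurd h1 hx
          · exact absurd h1 hyv
    have hqv : q ≠ v := by rintro rfl; rw [h.self] at hq; omega
    have hwv := le_ecc (d := d) w v
    have hwq := le_ecc (d := d) w q
    have hqy : d q y < dia d := by
      have h1 := le_dia (d := d) q y
      by_contra hcon
      rcases hcr q y (by omega) with h2 | h2
      · exact hqv h2
      · exact hyv h2
    have hvy : d v y = dia d := by
      have h1 := h.four v q w y
      have h2 := le_dia (d := d) v y
      have h3 := h.symm v w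
      have h4 := h.symm q w
      omega
    have hvy' : mvd d v w v y = dia (mvd d v w) := by rw [mvd_left hyv, hd, hy]
    refine ⟨?_, ?_, hc'⟩
    · intro u hu
      rw [h'.ecc_dia hvy', mvd_right hu, mvd_ne h hu hyv, h.ecc_dia hvy u]
      have h1 := h.four u v w y
      have h2 := h.four u w v y
      have h3 := h.symm v w
      omega
    · rw [h'.ecc_dia hvy', mvd_self, mvd_left hyv]
      have := le_ecc (d := d) w y
      omega

/-- all conclusions about tau after a move -/
theorem tau_move (h : TM d) {v p w : V} (hl : Leaf d v p) (hw : w ≠ v)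
    (hd : dia (mvd d v w) = dia d) (hc : NC d v ∨ ecc d w + 1 ≤ dia d) :
    (∀ u u', u ≠ v → u' ≠ v → tau (mvd d v w) u u' = tau d u u') ∧
      (∀ u, u ≠ v → tau (mvd d v w) v u = tau d w u) := by
  obtain ⟨h1, h2, h3⟩ := ecc_move h hl hw hd hc
  constructor
  · intro u u' hu hu'
    unfold tau
    rw [h1 u hu, h1 u' hu', mvd_ne h hu hu']
  · intro u hu
    unfold tau
    rw [h2, h1 u hu, mvd_left hu]
    omega

/-- number of vertices of eccentricity `j` -/
noncomputable def Nj {V : Type} [Fintype V] (d : V → V → ℕ) (j : ℕ) : ℕ :=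
  ∑ u, if ecc d u = j then 1 else 0

theorem Nj_isom {W : Type} [Fintype W] {d' : W → W → ℕ} (σ : V ≃ W)
    (hs : ∀ x y, d' (σ x) (σ y) = d x y) (j : ℕ) : Nj d' j = Nj d j := by
  unfold Nj
  rw [← Equiv.sum_comp σ]
  simp only [ecc_isom σ hs]

theorem Nj_move (h : TM d) {v p w : V} (hl : Leaf d v p) (hw : w ≠ v)
    (hd : dia (mvd d v w) = dia d) (hc : NC d v ∨ ecc d w + 1 ≤ dia d) (j : ℕ) :
    Nj (mvd d v w) j + (if ecc d v = j then 1 else 0) =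
      Nj d j + (if ecc d w + 1 = j then 1 else 0) := by
  classical
  obtain ⟨h1, h2, h3⟩ := ecc_move h hl hw hd hc
  unfold Nj
  rw [← Finset.add_sum_erase _ _ (Finset.mem_univ v), ← Finset.add_sum_erase Finset.univ (fun u => if ecc d u = j then 1 else 0) (Finset.mem_univ v), h2]
  have : ∑ x ∈ Finset.univ.erase v, (if ecc (mvd d v w) x = j then 1 else 0) =
      ∑ x ∈ Finset.univ.erase v, (if ecc d x = j then 1 else 0) := by
    apply Finset.sum_congr rfl
    intro x hx
    rw [h1 x (Finset.ne_of_mem_erase hx)]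
  rw [this]
  omega

/-- a move with target of ecc below is isometric: same ecc of leaf -/
theorem ecc_of_self_move (h : TM d) {v p w : V} (hl : Leaf d v p) (hw : w ≠ v)
    (hiso : Isom d (mvd d v w)) (hc : NC d v) : ecc d w + 1 = ecc d v := by
  obtain ⟨σ, hs⟩ := hiso
  have h1 := Nj_isom σ hs (ecc d v)
  have h2 := Nj_move h hl hw (dia_isom σ hs) (Or.inl hc) (ecc d v)
  simp only [if_true] at h2
  by_contra hne
  rw [if_neg hne] at h2
  omega

end
end

section

section
variable {V : Type} [Fintype V] {d : V → V → ℕ}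

/-- weights: deep vertices are heavy -/
noncomputable def om {V : Type} [Fintype V] (d : V → V → ℕ) (u : V) : ℕ :=
  if ecc d u = dia d then Fintype.card V + 1 else 1

/-- weight of the class of `x` at level `j` -/
noncomputable def sj {V : Type} [Fintype V] (d : V → V → ℕ) (j : ℕ) (x : V) : ℕ :=
  ∑ u, if j ≤ tau d x u then om d u else 0

/-- quadratic invariant -/
noncomputable def Qj {V : Type} [Fintype V] (d : V → V → ℕ) (j : ℕ) : ℕ :=
  ∑ x, ∑ u, if j ≤ tau d x u then om d x * om d u else 0

/-- lexicographic comparison -/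
def LexLt {V W : Type} [Fintype V] [Fintype W] (d : V → V → ℕ) (d' : W → W → ℕ) : Prop :=
  ∃ t, (∀ i, i < t → Qj d i = Qj d' i) ∧ Qj d t < Qj d' t

theorem om_isom {W : Type} [Fintype W] {d' : W → W → ℕ} (σ : V ≃ W)
    (hs : ∀ x y, d' (σ x) (σ y) = d x y) (x : V) : om d' (σ x) = om d x := by
  unfold om
  rw [ecc_isom σ hs, dia_isom σ hs, Fintype.card_congr σ]

theorem Qj_isom {W : Type} [Fintype W] {d' : W → W → ℕ} (σ : V ≃ W)
    (hs : ∀ x y, d' (σ x) (σ y) = d x y) (j : ℕ) : Qj d' j = Qj d j := by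
  unfold Qj
  rw [← Equiv.sum_comp σ]
  refine Finset.sum_congr rfl fun x _ => ?_
  rw [← Equiv.sum_comp σ]
  simp only [om_isom σ hs, tau_isom σ hs]

theorem LexLt.asymm {W : Type} [Fintype W] {d' : W → W → ℕ} (h1 : LexLt d d') (h2 : LexLt d' d) :
    False := by
  obtain ⟨t, ht, ht'⟩ := h1
  obtain ⟨s, hs, hs'⟩ := h2
  rcases lt_trichotomy t s with hlt | rfl | hlt
  · have := hs t hlt; omega
  · omega
  · have := ht s hlt; omega

theorem LexLt.isom_right {W X : Type} [Fintype W] [Fintype X] {d' : W → W → ℕ} {d'' : X → X → ℕ}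
    (h1 : LexLt d d') (h2 : Isom d'' d') : LexLt d d'' := by
  obtain ⟨σ, hs⟩ := h2
  obtain ⟨t, ht, ht'⟩ := h1
  exact ⟨t, fun i hi => by rw [ht i hi, Qj_isom σ hs], by rw [Qj_isom σ hs] at ht'; exact ht'⟩

open Classical in
theorem Qj_split (h : TM d) (v : V) (j : ℕ) : Qj d j =
    (∑ x ∈ Finset.univ.erase v, ∑ u ∈ Finset.univ.erase v,
      if j ≤ tau d x u then om d x * om d u else 0) +
    2 * (om d v * ∑ u ∈ Finset.univ.erase v, if j ≤ tau d v u then om d u else 0) +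
    (if j ≤ 2 * ecc d v then om d v * om d v else 0) := by
  unfold Qj
  rw [← Finset.sum_erase_add _ _ (Finset.mem_univ v), ← Finset.sum_erase_add Finset.univ
    (fun u => if j ≤ tau d v u then om d v * om d u else 0) (Finset.mem_univ v), h.tau_self]
  have e1 : ∑ x ∈ Finset.univ.erase v, ∑ u, (if j ≤ tau d x u then om d x * om d u else 0) =
      ∑ x ∈ Finset.univ.erase v, ((∑ u ∈ Finset.univ.erase v,
        if j ≤ tau d x u then om d x * om d u else 0) +
        if j ≤ tau d v x then om d v * om d x else 0) := by
    refine Finset.sum_congr rfl fun x _ => ?_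
    rw [← Finset.sum_erase_add _ _ (Finset.mem_univ v), h.tau_symm x v, mul_comm (om d x) (om d v)]
  have e2 : om d v * ∑ u ∈ Finset.univ.erase v, (if j ≤ tau d v u then om d u else 0) =
      ∑ u ∈ Finset.univ.erase v, if j ≤ tau d v u then om d v * om d u else 0 := by
    rw [Finset.mul_sum]
    exact Finset.sum_congr rfl fun x _ => by rw [mul_ite, mul_zero]
  rw [e1, Finset.sum_add_distrib, e2]
  ring

theorem om_pos (u : V) : 0 < om d u := by unfold om; split <;> omega

theorem key_lex (h : TM d) (hlam : 3 ≤ lam d) {v p w : V} (hl : Leaf d v p) (hw : w ≠ v)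
    (hd : dia (mvd d v w) = dia d) (hc : NC d v ∨ ecc d w + 1 ≤ dia d)
    (hna : tau d v w < 2 * ecc d w) (hom : ecc d v = dia d → ecc d w + 1 = dia d)
    (hs : sj d (tau d v w + 1) v < sj d (tau d v w + 1) w + om d v) :
    LexLt d (mvd d v w) := by
  classical
  have h' := mvd_TM h hl hw
  obtain ⟨h1, h2, h3⟩ := ecc_move h hl hw hd hc
  obtain ⟨t1, t2⟩ := tau_move h hl hw hd hc
  have omn : ∀ u, u ≠ v → om (mvd d v w) u = om d u := fun u hu => by
    unfold om; rw [h1 u hu, hd]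
  have hR : ∀ j, (∑ x ∈ Finset.univ.erase v, ∑ u ∈ Finset.univ.erase v,
      if j ≤ tau (mvd d v w) x u then om (mvd d v w) x * om (mvd d v w) u else 0) =
      ∑ x ∈ Finset.univ.erase v, ∑ u ∈ Finset.univ.erase v,
      if j ≤ tau d x u then om d x * om d u else 0 := by
    intro j
    refine Finset.sum_congr rfl fun x hx => Finset.sum_congr rfl fun u hu => ?_
    rw [t1 x u (Finset.ne_of_mem_erase hx) (Finset.ne_of_mem_erase hu),
      omn x (Finset.ne_of_mem_erase hx), omn u (Finset.ne_of_mem_erase hu)]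
  have hB : ∀ j, (∑ u ∈ Finset.univ.erase v,
      if j ≤ tau (mvd d v w) v u then om (mvd d v w) u else 0) =
      ∑ u ∈ Finset.univ.erase v, if j ≤ tau d w u then om d u else 0 := by
    intro j
    refine Finset.sum_congr rfl fun u hu => ?_
    rw [t2 u (Finset.ne_of_mem_erase hu), omn u (Finset.ne_of_mem_erase hu)]
  have hAB : ∀ j, j ≤ tau d v w → (∑ u ∈ Finset.univ.erase v, if j ≤ tau d w u then om d u else 0)
      = ∑ u ∈ Finset.univ.erase v, if j ≤ tau d v u then om d u else 0 := by
    intro j hj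
    refine Finset.sum_congr rfl fun u hu => ?_
    have u1 := h.tau_ultra v w u
    have u2 := h.tau_ultra w v u
    rw [h.tau_symm w v] at u2
    by_cases hq : j ≤ tau d w u
    · rw [if_pos hq, if_pos (by omega)]
    · rw [if_neg hq, if_neg (by omega)]
  have hle := h.leaf_tau_le hl (lam_ex hlam v p) hw
  have homle : om d v ≤ om (mvd d v w) v := by
    unfold om
    rw [h2, hd]
    by_cases hq : ecc d v = dia d
    · rw [if_pos hq, if_pos (hom hq)]
    · rw [if_neg hq]; split <;> omega
  have Q' := fun j => Qj_split h' v j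
  have Q := fun j => Qj_split h v j
  simp only [hR, hB, h2] at Q'
  rcases homle.lt_or_eq with hlt | heq
  · refine ⟨0, by intro i hi; omega, ?_⟩
    rw [Q', Q, hAB 0 (by omega), if_pos (by omega), if_pos (by omega)]
    have := Nat.mul_lt_mul_of_lt_of_le hlt hlt.le (by omega)
    have h5 := Nat.mul_le_mul_right (∑ u ∈ Finset.univ.erase v, if 0 ≤ tau d v u then om d u else 0) hlt.le
    omega
  · refine ⟨tau d v w + 1, ?_, ?_⟩
    · intro i hi
      rw [Q', Q, hAB i (by omega), if_pos (by omega), if_pos (by omega), ← heq]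
    · rw [Q', Q, if_pos (by omega), if_pos (by omega), ← heq]
      have eA : sj d (tau d v w + 1) v = (∑ u ∈ Finset.univ.erase v,
          if tau d v w + 1 ≤ tau d v u then om d u else 0) + om d v := by
        unfold sj
        rw [← Finset.sum_erase_add _ _ (Finset.mem_univ v), h.tau_self, if_pos (by omega)]
      have eB : sj d (tau d v w + 1) w = (∑ u ∈ Finset.univ.erase v,
          if tau d v w + 1 ≤ tau d w u then om d u else 0) := by
        unfold sj
        rw [← Finset.sum_erase_add _ _ (Finset.mem_univ v), h.tau_symm w v, if_neg (by omega), add_zero]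
      have : (∑ u ∈ Finset.univ.erase v, if tau d v w + 1 ≤ tau d v u then om d u else 0) <
        (∑ u ∈ Finset.univ.erase v, if tau d v w + 1 ≤ tau d w u then om d u else 0) := by omega
      have := Nat.mul_lt_mul_of_pos_left this (om_pos (d := d) v)
      omega

/-- lexicographically least noncritical leaf -/
def LL {V : Type} [Fintype V] (d : V → V → ℕ) (v : V) : Prop :=
  IsLeaf d v ∧ NC d v ∧ ∀ y, IsLeaf d y → NC d y →
    sj d (tau d v y + 1) v ≤ sj d (tau d v y + 1) y

theorem sj_congr (h : TM d) {j : ℕ} {x y : V} (hxy : j ≤ tau d x y) : sj d j x = sj d j y := by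
  unfold sj
  refine Finset.sum_congr rfl fun u _ => ?_
  have u1 := h.tau_ultra x y u
  have u2 := h.tau_ultra y x u
  rw [h.tau_symm y x] at u2
  by_cases hq : j ≤ tau d x u
  · rw [if_pos hq, if_pos (by omega)]
  · rw [if_neg hq, if_neg (by omega)]

/-- a leaf exists that is noncritical -/
theorem exists_NC (_h : TM d) (hlam : 3 ≤ lam d) : ∃ v, IsLeaf d v ∧ NC d v := by
  have : Nonempty V := by
    by_contra hn
    rw [not_nonempty_iff] at hn
    have : lam d = 0 := by unfold lam; simp
    omega
  obtain ⟨x, y, hxy⟩ := exists_dia (d := d)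
  obtain ⟨v, hv, h1, h2⟩ := lam_three hlam x y
  exact ⟨v, hv, x, y, h1.symm, h2.symm, hxy⟩

theorem exists_LL (h : TM d) (hlam : 3 ≤ lam d) : ∃ v, LL d v := by
  classical
  let N := 2 * dia d + 2
  let f : V → Lex (Fin N → ℕ) := fun v => toLex fun i => sj d i.1 v
  obtain ⟨v0, hv0⟩ := exists_NC h hlam
  obtain ⟨v, hv, hmin⟩ := Finset.exists_min_image (Finset.univ.filter fun v => IsLeaf d v ∧ NC d v) f
    ⟨v0, by simpa using hv0⟩
  simp only [Finset.mem_filter, Finset.mem_univ, true_and] at hv hmin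
  refine ⟨v, hv.1, hv.2, fun y hy hyn => ?_⟩
  by_contra hlt
  push Not at hlt
  have hm := hmin y ⟨hy, hyn⟩
  refine absurd hm (not_le.mpr ?_)
  have ht := h.tau_le v y
  have he := ecc_le_dia (d := d) v
  refine ⟨⟨tau d v y + 1, by omega⟩, ?_, hlt⟩
  intro j hj
  have hj' : j.1 < tau d v y + 1 := hj
  exact (sj_congr h (by omega : j.1 ≤ tau d v y)).symm

theorem LL_class (h : TM d) {v w y : V} (hv : LL d v) (hy : IsLeaf d y) (hyn : NC d y)
    (hyw : tau d v w + 1 ≤ tau d w y) : sj d (tau d v w + 1) v ≤ sj d (tau d v w + 1) w := by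
  have e : tau d v y = tau d v w := by
    have u1 := h.tau_ultra v w y
    have u2 := h.tau_ultra v y w
    rw [h.tau_symm y w] at u2
    omega
  have := hv.2.2 y hy hyn
  rw [e] at this
  rwa [sj_congr h hyw]

end
end

section

section
variable {V : Type} [Fintype V] {d : V → V → ℕ}

theorem crit_pair {y : V} (hy : ¬ NC d y) {x z : V} (hxz : d x z = dia d) : x = y ∨ z = y := by
  by_contra hc
  push Not at hc
  exact hy ⟨x, z, hc.1, hc.2, hxz⟩

theorem crit_deep (h : TM d) {y : V} (hy : ¬ NC d y) : ecc d y = dia d := by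
  have : Nonempty V := ⟨y⟩
  obtain ⟨x, z, hxz⟩ := exists_dia (d := d)
  have h1 := le_ecc (d := d) x z
  have h2 := le_ecc (d := d) z x
  have h3 := ecc_le_dia (d := d) y
  rw [h.symm z x] at h2
  rcases crit_pair hy hxz with rfl | rfl <;> omega

theorem crit_dist (_h : TM d) {y u : V} (hy : ¬ NC d y) (hu : ecc d u = dia d) (huy : u ≠ y) :
    d u y = dia d := by
  obtain ⟨z, hz⟩ := exists_ecc (d := d) u
  rw [hu] at hz
  rcases crit_pair hy hz with rfl | rfl
  · exact absurd rfl huy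
  · exact hz

theorem sj_deep {j : ℕ} {x : V} (hs : Fintype.card V < sj d j x) :
    ∃ u, j ≤ tau d x u ∧ ecc d u = dia d := by
  by_contra hc
  push Not at hc
  have : sj d j x ≤ ∑ _u : V, 1 := by
    unfold sj
    refine Finset.sum_le_sum fun u _ => ?_
    split_ifs with hq
    · unfold om; rw [if_neg (hc u hq)]
    · omega
  simp at this
  omega

theorem sj_ge {j : ℕ} {x u : V} (hu : j ≤ tau d x u) : om d u ≤ sj d j x := by
  unfold sj
  have := Finset.single_le_sum (s := Finset.univ)
    (f := fun u => if j ≤ tau d x u then om d u else 0) (fun i _ => Nat.zero_le _) (Finset.mem_univ u)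
  simp only [if_pos hu] at this
  exact this

/-- exceptional configuration -/
def Exc {V : Type} [Fintype V] (d : V → V → ℕ) (v w y : V) : Prop :=
  IsLeaf d y ∧ ¬ NC d y ∧ tau d w y = 2 * ecc d w ∧ tau d v w = dia d ∧ dia d < 2 * ecc d w ∧
    (∀ z, IsLeaf d z → z ≠ y → dia d + 1 ≤ tau d v z) ∧ v ≠ y

theorem exc_of (h : TM d) (hlam : 3 ≤ lam d) {v w : V} (hv : LL d v)
    (hna : tau d v w < 2 * ecc d w)
    (hno : ¬ ∃ y, IsLeaf d y ∧ NC d y ∧ tau d v w + 1 ≤ tau d w y)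
    (hs : sj d (tau d v w + 1) w + om d v ≤ sj d (tau d v w + 1) v) : ∃ y, Exc d v w y := by
  push Not at hno
  have hex : ∃ x y : V, x ≠ y := by
    obtain ⟨x, hx, _⟩ := lam_ex hlam v v
    exact ⟨x, v, hx⟩
  obtain ⟨y, hy, hyw⟩ := h.exists_leaf_tau w hex
  rw [h.tau_symm] at hyw
  have hyc : ¬ NC d y := fun hn => by have := hno y hy hn; omega
  have hyd := crit_deep h hyc
  have hDt := h.dia_le_tau v w
  have hvy : v ≠ y := by rintro rfl; exact hyc hv.2.1
  have hty : tau d v y = tau d v w := by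
    have u1 := h.tau_ultra v w y
    have u2 := h.tau_ultra v y w
    rw [h.tau_symm y w] at u2
    omega
  have huniq : ∀ y', IsLeaf d y' → tau d v w + 1 ≤ tau d w y' → y' = y := by
    intro y' hy' ht
    by_contra hne
    have hc' : ¬ NC d y' := fun hn => by have := hno y' hy' hn; omega
    have hd := crit_dist h hyc (crit_deep h hc') hne
    have h1 := h.tau_add y' y
    have h2 := crit_deep h hc'
    have h3 := h.tau_ultra y' w y
    rw [h.tau_symm y' w] at h3
    omega
  have hsy : om d y ≤ sj d (tau d v w + 1) w := sj_ge (by omega)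
  have homy : om d y = Fintype.card V + 1 := by unfold om; rw [if_pos hyd]
  obtain ⟨u, hu, hud⟩ := sj_deep (d := d) (j := tau d v w + 1) (x := v) (by omega)
  have huy : u ≠ y := by rintro rfl; omega
  have hduy := crit_dist h hyc hud huy
  have htuy : tau d u y = dia d := by have := h.tau_add u y; omega
  have ht : tau d v w = dia d := by
    have u1 := h.tau_ultra u v y
    rw [h.tau_symm u v] at u1
    omega
  refine ⟨y, hy, hyc, hyw, ht, by omega, ?_, hvy⟩
  intro z hz hzy
  by_contra hlt
  have hzt : tau d v z = dia d := by have := h.dia_le_tau v z; omega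
  by_cases hzn : NC d z
  · have h1 := hv.2.2 z hz hzn
    rw [hzt, ← ht] at h1
    obtain ⟨z1, hz1, hz1d⟩ := sj_deep (d := d) (j := tau d v w + 1) (x := z) (by omega)
    have hz1y : z1 ≠ y := by
      rintro rfl
      refine hzy (huniq z hz ?_)
      have u1 := h.tau_ultra w z1 z
      rw [h.tau_symm z1 z] at u1
      omega
    have h2 : tau d z1 u = dia d := by
      have h3 := h.dia_le_tau z1 u
      have u1 := h.tau_ultra z z1 u
      have u2 := h.tau_ultra z u v
      rw [h.tau_symm u v, h.tau_symm z v] at u2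
      omega
    have h4 := h.tau_add z1 u
    rcases crit_pair hyc (x := z1) (z := u) (by omega) with h5 | h5
    · exact hz1y h5
    · exact huy h5
  · rcases crit_pair hzn hduy with rfl | rfl
    · omega
    · exact hzy rfl

theorem LL_lex (h : TM d) (hlam : 3 ≤ lam d) {v p w : V} (hv : LL d v) (hl : Leaf d v p)
    (hw : w ≠ v) (hd : dia (mvd d v w) = dia d) (hna : tau d v w < 2 * ecc d w)
    (hom : ecc d v = dia d → ecc d w + 1 = dia d) : LexLt d (mvd d v w) ∨ ∃ y, Exc d v w y := by
  by_cases hs : sj d (tau d v w + 1) v < sj d (tau d v w + 1) w + om d v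
  · left
    exact key_lex h hlam hl hw hd (Or.inl hv.2.1) hna hom hs
  · right
    apply exc_of h hlam hv hna _ (by omega)
    rintro ⟨y, hy, hyn, hyt⟩
    have := LL_class h hv hy hyn hyt
    have := om_pos (d := d) v
    omega

/-- a lonely leaf -/
def Lonely {V : Type} [Fintype V] (d : V → V → ℕ) (y : V) : Prop :=
  IsLeaf d y ∧ ∀ z, IsLeaf d z → z ≠ y → tau d y z = dia d

theorem Lonely_isom {W : Type} [Fintype W] {d' : W → W → ℕ} (σ : V ≃ W)
    (hs : ∀ x y, d' (σ x) (σ y) = d x y) {y : V} (hy : Lonely d y) : Lonely d' (σ y) := by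
  refine ⟨(isLeaf_isom σ hs y).2 hy.1, fun z hz hne => ?_⟩
  obtain ⟨z, rfl⟩ := σ.surjective z
  rw [tau_isom σ hs, dia_isom σ hs]
  exact hy.2 z ((isLeaf_isom σ hs z).1 hz) (fun e => hne (by rw [e]))

theorem Exc.lonely (h : TM d) {v w y : V} (he : Exc d v w y) : Lonely d y := by
  obtain ⟨hy, hyc, hyw, ht, hlt, hz, hvy⟩ := he
  refine ⟨hy, fun z hzl hzy => ?_⟩
  have h1 := hz z hzl hzy
  have h2 := h.dia_le_tau y z
  have u1 := h.tau_ultra v z y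
  have u2 := h.tau_ultra v y w
  rw [h.tau_symm y w] at u2
  rw [h.tau_symm z y] at u1
  omega

theorem nleaf_nbr (h : TM d) (hlam : 3 ≤ lam d) {v p g : V} (hl : Leaf d v p) (hg : IsLeaf d g) :
    d v g ≠ 1 := fun e => by
  have := h.leaf_nbr_unique hl e
  exact nbr_not_leaf h hlam hl (this ▸ hg)

theorem leaf_mv_cases (h : TM d) (hlam : 3 ≤ lam d) {v p w g : V} (hl : Leaf d v p) (hw : w ≠ v)
    (hg : IsLeaf (mvd d v w) g) : g = v ∨ g = p ∨ (IsLeaf d g ∧ g ≠ w ∧ g ≠ v) := by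
  by_cases hgv : g = v
  · exact Or.inl hgv
  by_cases hgp : g = p
  · exact Or.inr (Or.inl hgp)
  rcases leaf_mv_classify h hl hw hg hgv hgp with h1 | h1
  · exact Or.inr (Or.inr ⟨h1.1, h1.2, hgv⟩)
  · obtain ⟨x, hx1, hx2⟩ := lam_ex hlam v w
    rcases h1 x with h2 | h2 <;> contradiction

theorem Exc.not_lonely (h : TM d) (hlam : 4 ≤ lam d) {v p w y : V} (hl : Leaf d v p) (hnv : NC d v)
    (hw : w ≠ v) (hd : dia (mvd d v w) = dia d) (hwl : ¬ IsLeaf d w) (he : Exc d v w y) :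
    ∀ g, ¬ Lonely (mvd d v w) g := by
  intro g hg
  obtain ⟨hy, hyc, hyw, ht, hlt, hz, hvy⟩ := he
  have h3 : 3 ≤ lam d := by omega
  have h' := mvd_TM h hl hw
  obtain ⟨t1, t2⟩ := tau_move h hl hw hd (Or.inl hnv)
  have old : ∀ g, IsLeaf d g → g ≠ v → IsLeaf (mvd d v w) g := fun g hg hgv =>
    leaf_mv_old h hw hg hgv (by rintro rfl; exact hwl (by assumption)) (nleaf_nbr h h3 hl hg)
  have hlv : IsLeaf (mvd d v w) v := ⟨w, mvd_leaf h hw⟩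
  rcases leaf_mv_cases h h3 hl hw hg.1 with rfl | rfl | ⟨h1, h2, h4⟩
  · have := hg.2 y (old y hy hvy.symm) hvy.symm
    rw [t2 y hvy.symm] at this
    omega
  · obtain ⟨z, hzl, hzv, hzy⟩ := lam_three h3 v y
    have hzg : z ≠ g := by rintro rfl; exact nbr_not_leaf h h3 hl hzl
    have e := hg.2 z (old z hzl hzv) hzg
    rw [t1 g z hl.1.symm hzv, h.leaf_tau hl (lam_ex h3 v g) hzv] at e
    have := hz z hzl hzy
    omega
  · by_cases hgy : g = y
    · subst hgy
      have := hg.2 v hlv h4.symm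
      rw [h'.tau_symm, t2 g h4] at this
      omega
    · obtain ⟨z, hzl, hzv, hzy, hzg⟩ := lam_four hlam v y g
      have e := hg.2 z (old z hzl hzv) hzg
      rw [t1 g z h4 hzv] at e
      have e1 := hz z hzl hzy
      have e2 := hz g h1 hgy
      have u := h.tau_ultra g v z
      rw [h.tau_symm g v] at u
      omega

/-- only moves to the old place are isometric -/
def Irr {V : Type} (d : V → V → ℕ) (v : V) : Prop :=
  IsLeaf d v ∧ ∀ w, w ≠ v → Isom d (mvd d v w) → d v w = 1

theorem LL_irr (h : TM d) (hlam : 4 ≤ lam d) {v : V} (hv : LL d v) : Irr d v := by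
  refine ⟨hv.1, fun w hw hiso => ?_⟩
  obtain ⟨p, hl⟩ := hv.1
  have h3 : 3 ≤ lam d := by omega
  have he := ecc_of_self_move h hl hw hiso hv.2.1
  obtain ⟨σ, hs⟩ := hiso
  have hd := dia_isom σ hs
  have h1 := h.tau_le w v
  have h2 := h.tau_add v w
  rw [h.tau_symm] at h1
  rcases h1.lt_or_eq with hlt | heq
  · exfalso
    rcases LL_lex h h3 hv hl hw hd hlt (by omega) with hlex | ⟨y, hexc⟩
    · obtain ⟨t, _, ht⟩ := hlex
      rw [Qj_isom σ hs] at ht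
      omega
    · by_cases hwl : IsLeaf d w
      · have hwy : w ≠ y := by
          rintro rfl
          have := crit_deep h hexc.2.1
          have := ecc_le_dia (d := d) v
          omega
        have := hexc.2.2.2.2.2.1 w hwl hwy
        have := hexc.2.2.2.1
        omega
      · exact hexc.not_lonely h hlam hl hv.2.1 hw hd hwl _ (Lonely_isom σ hs (hexc.lonely h))
  · omega

end
end

section

section
variable {V W : Type} [Fintype V] [Fintype W] {d : V → V → ℕ} {e : W → W → ℕ}

/-- one-sided hypotheses: `e` is obtained from `d` by several moves -/
structure Half {V W : Type} (d : V → V → ℕ) (e : W → W → ℕ) (a : V) : Prop where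
  leaf : IsLeaf d a
  one : ∃ x', x' ≠ a ∧ Isom e (mvd d a x')
  four : ∃ z, IsLeaf d z ∧ z ≠ a ∧ Isom e (mvd d z a)
  five : ∀ v, v ≠ a → Irr d v → Isom e (mvd d v a)

theorem Half.dia_le (h : TM d) {a : V} (H : Half d e a) : dia d ≤ dia e := by
  by_contra hlt
  push Not at hlt
  obtain ⟨x', hx', σ, hσ⟩ := H.one
  obtain ⟨z, hz, hza, τ, hτ⟩ := H.four
  have e1 := dia_isom σ hσ
  have e2 := dia_isom τ hτ
  have : Nonempty V := ⟨a⟩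
  obtain ⟨x, y, hxy⟩ := exists_dia (d := d)
  have c1 : x = a ∨ y = a := by
    by_contra hc
    push Not at hc
    have := le_dia (d := mvd d a x') x y
    rw [mvd_ne h hc.1 hc.2] at this
    omega
  have c2 : x = z ∨ y = z := by
    by_contra hc
    push Not at hc
    have := le_dia (d := mvd d z a) x y
    rw [mvd_ne h hc.1 hc.2] at this
    omega
  have hd : d z a = dia d := by
    rcases c1 with rfl | rfl <;> rcases c2 with rfl | rfl
    · exact absurd rfl hza
    · rw [h.symm]; exact hxy
    · exact hxy
    · exact absurd rfl hza
  obtain ⟨p, hp⟩ := hz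
  have h1 := hp.2 a hza.symm
  have h2 := le_dia (d := mvd d z a) z p
  rw [mvd_left hp.1.symm, h.symm a p] at h2
  omega

theorem Half.lam_le (h : TM d) (hlam : 3 ≤ lam d) {a : V} (H : Half d e a) : lam e ≤ lam d := by
  obtain ⟨z, ⟨p, hz⟩, hza, τ, hτ⟩ := H.four
  have := lam_isom τ hτ
  have := (lam_mv_le h hlam hz hza.symm H.leaf).1
  omega

theorem half_lex_nondeep (h : TM d) (hlam : 4 ≤ lam d) {a : V} (H : Half d e a)
    (hdia : dia e = dia d) (hle : lam e = lam d) (hni : ¬ Isom e d) (hnd : ecc d a ≠ dia d) :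
    LexLt d e := by
  have h3 : 3 ≤ lam d := by omega
  have hnd' : ecc d a + 1 ≤ dia d := by have := ecc_le_dia (d := d) a; omega
  have : Nonempty V := ⟨a⟩
  have hNC : NC d a := by
    obtain ⟨x, y, hxy⟩ := exists_dia (d := d)
    have h1 := le_ecc (d := d) x y
    have h2 := le_ecc (d := d) y x
    rw [h.symm y x] at h2
    refine ⟨x, y, ?_, ?_, hxy⟩ <;> (rintro rfl; omega)
  obtain ⟨xa, hla⟩ := H.leaf
  obtain ⟨x', hx', hiso1⟩ := H.one
  obtain ⟨z, ⟨pz, hz⟩, hza, hiso4⟩ := H.four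
  have hI1 := hiso1
  have hI4 := hiso4
  obtain ⟨σ, hσ⟩ := hiso1
  obtain ⟨τ, hτ⟩ := hiso4
  have d1 : dia (mvd d a x') = dia d := by rw [dia_isom σ hσ, hdia]
  have d4 : dia (mvd d z a) = dia d := by rw [dia_isom τ hτ, hdia]
  have n1 := fun j => Nj_move h hla hx' d1 (Or.inl hNC) j
  have n4 := fun j => Nj_move h hz hza.symm d4 (Or.inr hnd') j
  simp only [Nj_isom σ hσ] at n1
  simp only [Nj_isom τ hτ] at n4
  obtain ⟨v, hv⟩ := exists_LL h h3
  by_cases hva : v = a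
  · subst hva
    have hx'x : d v x' ≠ 1 := by
      intro h1
      have := h.leaf_nbr_unique hla h1
      subst this
      rw [mvd_id h hla] at hI1
      exact hni hI1
    have hex : ecc d x' = ecc d v ∨ ecc d x' + 1 = ecc d v := by
      have q1 := n1 (ecc d x' + 1)
      have q4 := n4 (ecc d x' + 1)
      rw [if_pos rfl] at q1
      by_contra hc
      push Not at hc
      rw [if_neg (by omega)] at q1
      rw [if_neg (by omega : ¬ ecc d v + 1 = ecc d x' + 1)] at q4
      split_ifs at q4 <;> omega
    have hpos := h.pos hx'
    rw [h.symm] at hpos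
    have hta := h.tau_add v x'
    have hna : tau d v x' < 2 * ecc d x' := by omega
    rcases LL_lex h h3 hv hla hx' d1 hna (by omega) with hlex | ⟨y, hexc⟩
    · exact hlex.isom_right hI1
    · exfalso
      have hlon := hexc.lonely h
      have hyd := crit_deep h hexc.2.1
      have hvy := hexc.2.2.2.2.2.2
      by_cases hwl : IsLeaf d x'
      · have hwy : x' ≠ y := by rintro rfl; omega
        have := hexc.2.2.2.2.2.1 x' hwl hwy
        have := hexc.2.2.2.1
        omega
      · have hnl : ∀ g, ¬ Lonely e g := fun g hg =>
          hexc.not_lonely h hlam hla hNC hx' d1 hwl _ (Lonely_isom σ hσ hg)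
        obtain ⟨ρ, hρ⟩ := hI4.symm
        have hnl4 : ∀ g, ¬ Lonely (mvd d z v) g := fun g hg => hnl _ (Lonely_isom ρ hρ hg)
        have h4 := mvd_TM h hz hza.symm
        obtain ⟨t1, t2⟩ := tau_move h hz hza.symm d4 (Or.inr hnd')
        have hyl := hexc.1
        have hlp : IsLeaf (mvd d z v) pz :=
          (lam_mv_le h h3 hz hza.symm hv.1).2 (by rw [lam_isom τ hτ, hle])
        by_cases hzy : z = y
        · subst hzy
          refine hnl4 pz ⟨hlp, fun g hg hgp => ?_⟩
          rw [d4]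
          rcases leaf_mv_cases h h3 hz hza.symm hg with rfl | rfl | ⟨g1, g2, g3⟩
          · rw [h4.tau_symm, t2 pz hz.1.symm, h.tau_symm, h.leaf_tau hz (lam_ex h3 _ _) hza.symm]
            exact hlon.2 v hv.1 hza.symm
          · exact absurd rfl hgp
          · rw [t1 pz g hz.1.symm g3, h.leaf_tau hz (lam_ex h3 _ _) g3]
            exact hlon.2 g g1 g3
        · have hyz : y ≠ z := fun h => hzy h.symm
          refine hnl4 y ⟨leaf_mv_old h hza.symm hyl hyz hvy.symm
            (nleaf_nbr h h3 hz hyl), fun g hg hgp => ?_⟩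
          rw [d4]
          rcases leaf_mv_cases h h3 hz hza.symm hg with rfl | rfl | ⟨g1, g2, g3⟩
          · rw [h4.tau_symm, t2 y hyz, h.tau_symm]
            exact hlon.2 v hv.1 hvy
          · rw [t1 y g hyz hz.1.symm, h.tau_symm, h.leaf_tau hz (lam_ex h3 _ _) hyz, h.tau_symm]
            exact hlon.2 z ⟨g, hz⟩ hyz.symm
          · rw [t1 y g hyz g3]
            exact hlon.2 g g1 hgp
  · have hIv := H.five v hva (LL_irr h hlam hv)
    obtain ⟨p, hl⟩ := hv.1
    obtain ⟨ρ, hρ⟩ := hIv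
    have dv : dia (mvd d v a) = dia d := by rw [dia_isom ρ hρ, hdia]
    have hav : a ≠ v := fun h => hva h.symm
    have hna := h.leaf_tau_le hla (lam_ex h3 _ _) hva
    rw [h.tau_symm] at hna
    have hom : ecc d v = dia d → ecc d a + 1 = dia d := by
      intro hvd
      have nv := Nj_move h hl hav dv (Or.inl hv.2.1) (dia d)
      rw [Nj_isom ρ hρ, if_pos hvd] at nv
      have q1 := n1 (dia d)
      rw [if_neg hnd] at q1
      by_contra hc
      rw [if_neg hc] at nv
      omega
    rcases LL_lex h h3 hv hl hav dv (by omega) hom with hlex | ⟨y, hexc⟩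
    · exact hlex.isom_right ⟨ρ, hρ⟩
    · exfalso
      have hay : a ≠ y := by rintro rfl; exact hexc.2.1 hNC
      have := hexc.2.2.2.2.2.1 a ⟨xa, hla⟩ hay
      have := hexc.2.2.2.1
      omega

end
end

section

section
variable {V W : Type} [Fintype V] [Fintype W] {d : V → V → ℕ} {e : W → W → ℕ}

theorem sj_deep2 {j : ℕ} {x z : V} (hs : 2 * Fintype.card V + 2 ≤ sj d j x) :
    ∃ u, j ≤ tau d x u ∧ ecc d u = dia d ∧ u ≠ z := by
  classical
  by_contra hc
  push Not at hc
  have : sj d j x ≤ ∑ u : V, (1 + if u = z then Fintype.card V else 0) := by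
    unfold sj
    refine Finset.sum_le_sum fun u _ => ?_
    split_ifs with hq hz hz
    · unfold om; split <;> omega
    · unfold om
      rw [if_neg (fun h => hz (hc u hq h))]
    · omega
    · omega
  rw [Finset.sum_add_distrib] at this
  simp at this
  omega

theorem sj_two {j : ℕ} {x u u' : V} (hu : j ≤ tau d x u) (hu' : j ≤ tau d x u') (hne : u ≠ u') :
    om d u + om d u' ≤ sj d j x := by
  classical
  unfold sj
  have := Finset.sum_le_sum_of_subset (f := fun u => if j ≤ tau d x u then om d u else 0)
    (Finset.subset_univ {u, u'})
  rw [Finset.sum_pair hne] at this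
  simp only [if_pos hu, if_pos hu'] at this
  exact this

theorem twin_swap (h : TM d) {a q x : V} (hla : Leaf d a x) (hlq : Leaf d q x) (haq : a ≠ q) :
    ∃ σ : V ≃ V, (∀ u u', d (σ u) (σ u') = d u u') ∧ σ a = q ∧ σ q = a := by
  classical
  have key : ∀ u, u ≠ a → u ≠ q → d a u = d q u := fun u h1 h2 => by
    rw [hla.2 u h1, hlq.2 u h2]
  refine ⟨Equiv.swap a q, fun u u' => ?_, Equiv.swap_apply_left _ _, Equiv.swap_apply_right _ _⟩
  by_cases hu1 : u = a
  · subst hu1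
    rw [Equiv.swap_apply_left]
    by_cases hu' : u' = u
    · subst hu'; rw [Equiv.swap_apply_left, h.self, h.self]
    by_cases hu'' : u' = q
    · subst hu''; rw [Equiv.swap_apply_right, h.symm]
    · rw [Equiv.swap_apply_of_ne_of_ne hu' hu'', key u' hu' hu'']
  by_cases hu2 : u = q
  · subst hu2
    rw [Equiv.swap_apply_right]
    by_cases hu' : u' = u
    · subst hu'; rw [Equiv.swap_apply_right, h.self, h.self]
    by_cases hu'' : u' = a
    · subst hu''; rw [Equiv.swap_apply_left, h.symm]
    · rw [Equiv.swap_apply_of_ne_of_ne hu'' hu', key u' hu'' hu']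
  rw [Equiv.swap_apply_of_ne_of_ne hu1 hu2]
  by_cases hu' : u' = a
  · subst hu'; rw [Equiv.swap_apply_left, h.symm, h.symm u, key u hu1 hu2]
  by_cases hu'' : u' = q
  · subst hu''; rw [Equiv.swap_apply_right, h.symm, h.symm u, key u hu1 hu2]
  rw [Equiv.swap_apply_of_ne_of_ne hu' hu'']

theorem Irr_isom {d : V → V → ℕ} (σ : V ≃ V) (hs : ∀ x y, d (σ x) (σ y) = d x y) {a : V}
    (ha : Irr d a) : Irr d (σ a) := by
  refine ⟨(isLeaf_isom σ hs a).2 ha.1, fun w hw hiso => ?_⟩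
  obtain ⟨w, rfl⟩ := σ.surjective w
  rw [hs]
  refine ha.2 w (fun h => hw (by rw [h])) (hiso.trans (Isom.symm ⟨σ, fun x y => ?_⟩))
  exact mvd_isom σ hs a w x y

set_option maxHeartbeats 2000000 in
theorem half_lex_deep (h : TM d) (hlam : 4 ≤ lam d) {a : V} (H : Half d e a)
    (hdia : dia e = dia d) (hle : lam e = lam d) (hni : ¬ Isom e d) (hnd : ecc d a = dia d) :
    LexLt d e := by
  classical
  have h3 : 3 ≤ lam d := by omega
  have hne : Nonempty V := ⟨a⟩
  obtain ⟨x, hla⟩ := H.leaf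
  obtain ⟨x', hx', hI1⟩ := H.one
  obtain ⟨z, ⟨p, hz⟩, hza, hI4⟩ := H.four
  -- no other noncritical irreducible leaf
  have noirr : ∀ v, NC d v → Irr d v → v = a := by
    intro v hvn hvi
    by_contra hva
    obtain ⟨ρ, hρ⟩ := H.five v hva hvi
    obtain ⟨pv, hpv⟩ := hvi.1
    have := (ecc_move h hpv (fun h => hva h.symm) (by rw [dia_isom ρ hρ, hdia]) (Or.inl hvn)).2.2
    omega
  obtain ⟨v, hv⟩ := exists_LL h h3
  have hirr := LL_irr h hlam hv
  obtain rfl := noirr v hv.2.1 hirr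
  have hNC := hv.2.1
  obtain ⟨σ, hσ⟩ := id hI1
  obtain ⟨τ, hτ⟩ := id hI4
  have d1 : dia (mvd d v x') = dia d := by rw [dia_isom σ hσ, hdia]
  have d4 : dia (mvd d z v) = dia d := by rw [dia_isom τ hτ, hdia]
  have hzc : ¬ NC d z := fun hn => by
    have := (ecc_move h hz hza.symm d4 (Or.inl hn)).2.2
    omega
  have hzd := crit_deep h hzc
  have hvz : d v z = dia d := crit_dist h hzc hnd hza.symm
  have hDpos : 0 < dia d := by rw [← hvz]; exact h.pos hza.symm
  -- all others are noncritical
  have hnc : ∀ u, u ≠ v → u ≠ z → NC d u := fun u h1 h2 => ⟨v, z, h1.symm, h2.symm, hvz⟩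
  have hdeepleaf : ∀ u, ecc d u = dia d → IsLeaf d u := by
    intro u hu
    obtain ⟨y, hy⟩ := exists_ecc (d := d) u
    refine h.deep_leaf (y := y) (by omega) ?_
    rintro rfl
    rw [h.self] at hy; omega
  have hdz : ∀ u, ecc d u = dia d → u ≠ z → d u z = dia d := fun u hu hne => crit_dist h hzc hu hne
  have hdeepC : ∀ u, ecc d u = dia d → u ≠ z → dia d + 1 ≤ tau d v u := by
    intro u hu huz
    by_contra hc
    have := h.dia_le_tau v u
    have ht := h.tau_add v u
    rcases crit_pair hzc (x := v) (z := u) (by omega) with h1 | h1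
    · exact hza h1.symm
    · exact huz h1
  obtain ⟨q, hqv, hqz, hqd⟩ : ∃ q, q ≠ v ∧ q ≠ z ∧ ecc d q = dia d := by
    obtain ⟨x1, y1, g1, g2, g3⟩ := hNC
    have l1 := le_ecc (d := d) x1 y1
    have l2 := le_ecc (d := d) y1 x1
    have l3 := ecc_le_dia (d := d) x1
    have l4 := ecc_le_dia (d := d) y1
    rw [h.symm y1 x1] at l2
    by_cases hx1 : x1 = z
    · refine ⟨y1, g2, ?_, by omega⟩
      rintro rfl
      rw [hx1, h.self] at g3; omega
    · exact ⟨x1, g1, hx1, by omega⟩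
  have homd : ∀ u, ecc d u = dia d → om d u = Fintype.card V + 1 := fun u hu => by
    unfold om; rw [if_pos hu]
  have hsv : 2 * Fintype.card V + 2 ≤ sj d (dia d + 1) v := by
    have := sj_two (d := d) (j := dia d + 1) (x := v) (u := v) (u' := q) (hdeepC v hnd hza.symm)
      (hdeepC q hqd hqz) hqv.symm
    rw [homd v hnd, homd q hqd] at this
    omega
  have hleafC : ∀ u, IsLeaf d u → u ≠ z → dia d + 1 ≤ tau d v u := by
    intro u hu huz
    by_cases huv : u = v
    · subst huv; exact hdeepC u hnd huz
    by_contra hc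
    have ht : tau d v u = dia d := by have := h.dia_le_tau v u; omega
    have hs := hv.2.2 u hu (hnc u huv huz)
    rw [ht] at hs
    obtain ⟨u1, hu1, hu1d, hu1z⟩ := sj_deep2 (d := d) (j := dia d + 1) (x := u) (z := z) (by omega)
    have c := hdeepC u1 hu1d hu1z
    have := h.tau_ultra v u1 u
    rw [h.tau_symm u1 u] at this
    omega
  have hzt : ∀ u, IsLeaf d u → u ≠ z → tau d z u = dia d := by
    intro u hu huz
    have c := hleafC u hu huz
    have c2 := h.dia_le_tau z u
    have c3 := h.tau_add v z
    have c4 := h.tau_ultra v u z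
    rw [h.tau_symm u z] at c4
    omega
  have hpw : ∀ u u', IsLeaf d u → IsLeaf d u' → u ≠ z → u' ≠ z → dia d + 1 ≤ tau d u u' := by
    intro u u' hu hu' huz huz'
    have c1 := hleafC u hu huz
    have c2 := hleafC u' hu' huz'
    have c3 := h.tau_ultra u v u'
    rw [h.tau_symm u v] at c3
    omega
  have hx'x : x' ≠ x := by
    rintro rfl
    rw [mvd_id h hla] at hI1
    exact hni hI1
  obtain ⟨m1, m2, m3⟩ := ecc_move h hla hx' d1 (Or.inl hNC)
  have hexv := h.leaf_ecc hla (lam_ex h3 _ _)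
  -- x' is a leaf
  have hx'l : IsLeaf d x' := by
    by_contra hwl
    have hxnl := lam_mv_nonleaf h h3 hla hx' hwl (by rw [lam_isom σ hσ, hle])
    have hT1 := mvd_TM h hla hx'
    obtain ⟨q', hq'v, hq'x, hq'e⟩ : ∃ q', q' ≠ v ∧ d x q' = 1 ∧ ecc d x < ecc d q' := by
      by_contra hc
      push Not at hc
      -- a neighbour r of x other than v
      obtain ⟨s, hs1, hs2⟩ := lam_ex h3 v x
      obtain ⟨r, hr1, hr2⟩ := h.geo x s hs2.symm
      have hrv : r ≠ v := by
        rintro rfl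
        have := hla.2 s hs1
        omega
      refine hxnl ⟨r, hT1.leaf_of_nbr (by rw [mvd_ne h hla.1.symm hrv]; exact hr1) ?_⟩
      intro r' hr'
      have hr'v : r' ≠ v := by
        rintro rfl
        rw [mvd_right hla.1.symm] at hr'
        exact hx'x (h.eq x x' (by omega)).symm
      rw [mvd_ne h hla.1.symm hr'v] at hr'
      exact h.up_unique hr' hr1 (hc r' hr'v hr') (hc r hrv hr1)
    have hq'd : ecc d q' = dia d := by have := ecc_le_dia (d := d) q'; omega
    have hlq' : Leaf d q' x := by
      obtain ⟨x2, hx2⟩ := hdeepleaf q' hq'd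
      have hxx := h.leaf_nbr_unique hx2 (q := x) (by rw [h.symm]; exact hq'x)
      rw [hxx]
      exact hx2
    have hq'z : q' ≠ z := by
      rintro rfl
      have g1 := hdz q hqd hqz
      have g2 := hlq'.2 q hqz
      have g3 := hla.2 q hqv
      rw [h.symm] at g1
      rcases crit_pair hzc (x := v) (z := q) (by omega) with h1 | h1
      · exact hza h1.symm
      · exact hqz h1
    obtain ⟨ρ, hρ, hρv, _⟩ := twin_swap h hla hlq' hq'v.symm
    have := Irr_isom ρ hρ hirr
    rw [hρv] at this
    exact hq'v (noirr q' (hnc q' hq'v hq'z) this)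
  have hx'z : x' ≠ z := by rintro rfl; omega
  by_cases hex' : ecc d x' + 1 = dia d
  · obtain ⟨px, hpx⟩ := hx'l
    have hna := h.leaf_tau_le hpx (lam_ex h3 _ _) hx'.symm
    rw [h.tau_symm] at hna
    rcases LL_lex h h3 hv hla hx' d1 (by omega) (fun _ => hex') with hlex | ⟨y, hexc⟩
    · exact hlex.isom_right hI1
    · exfalso
      have hwy : x' ≠ y := by
        rintro rfl
        have := crit_deep h hexc.2.1
        omega
      have := hexc.2.2.2.2.2.1 x' ⟨px, hpx⟩ hwy
      have := hexc.2.2.2.1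
      omega
  exfalso
  have nD : Nj (mvd d v x') (dia d) + 1 = Nj d (dia d) := by
    have := Nj_move h hla hx' d1 (Or.inl hNC) (dia d)
    rw [if_pos hnd, if_neg hex'] at this
    omega
  obtain ⟨t1, t2⟩ := tau_move h hla hx' d1 (Or.inl hNC)
  have hT1 := mvd_TM h hla hx'
  have hT4 := mvd_TM h hz hza.symm
  obtain ⟨Θ, hΘ⟩ := hI1.symm.trans hI4
  have hxl1 : IsLeaf (mvd d v x') x := (lam_mv_le h h3 hla hx' hx'l).2 (by rw [lam_isom σ hσ, hle])
  have hpl4 : IsLeaf (mvd d z v) p :=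
    (lam_mv_le h h3 hz hza.symm hv.1).2 (by rw [lam_isom τ hτ, hle])
  have hzp4 : mvd d z v z p = dia d := by
    have := hz.2 v hza.symm
    rw [mvd_left hz.1.symm, h.symm v p, ← this, h.symm]; exact hvz
  have hpair1 : ∀ u u', mvd d v x' u u' = dia d → u = z ∨ u' = z := by
    intro u u' huu
    have l1 := le_ecc (d := mvd d v x') u u'
    have l2 := le_ecc (d := mvd d v x') u' u
    rw [hT1.symm u' u] at l2
    have hu : u ≠ v := by rintro rfl; omega
    have hu' : u' ≠ v := by rintro rfl; omega
    rw [mvd_ne h hu hu'] at huu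
    exact crit_pair hzc huu
  -- tau in d1
  have hxt : ∀ u, u ≠ v → tau d x u = tau d v u := fun u hu => h.leaf_tau hla (lam_ex h3 _ _) hu
  have lon1 : ∀ u, IsLeaf (mvd d v x') u → u ≠ z → tau (mvd d v x') z u = dia d := by
    intro u hu huz
    rcases leaf_mv_cases h h3 hla hx' hu with rfl | rfl | ⟨g1, g2, g3⟩
    · rw [hT1.tau_symm, t2 z hza, h.tau_symm]; exact hzt x' hx'l hx'z
    · rw [t1 z u hza hla.1.symm, h.tau_symm, hxt z hza, h.tau_symm]; exact hzt v hv.1 hza.symm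
    · rw [t1 z u hza g3]; exact hzt u g1 huz
  have hxz : x ≠ z := by rintro rfl; exact nbr_not_leaf h h3 hla ⟨p, hz⟩
  have pw1' : ∀ u, IsLeaf (mvd d v x') u → u ≠ z → u ≠ v →
      ∃ u0, IsLeaf d u0 ∧ u0 ≠ z ∧ ∀ y, y ≠ v → tau d u y = tau d u0 y := by
    intro u hu huz huv
    rcases leaf_mv_cases h h3 hla hx' hu with rfl | rfl | ⟨g1, g2, g3⟩
    · exact absurd rfl huv
    · exact ⟨v, hv.1, hza.symm, hxt⟩
    · exact ⟨u, g1, huz, fun _ _ => rfl⟩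
  have pw1 : ∀ u u', IsLeaf (mvd d v x') u → IsLeaf (mvd d v x') u' → u ≠ z → u' ≠ z → u ≠ u' →
      dia d + 1 ≤ tau (mvd d v x') u u' := by
    have main : ∀ u u', IsLeaf (mvd d v x') u → IsLeaf (mvd d v x') u' → u ≠ z → u' ≠ z → u ≠ u' →
      u' ≠ v → dia d + 1 ≤ tau (mvd d v x') u u' := by
      intro u u' hu hu' huz huz' hne hu'v
      obtain ⟨u0, k1, k2, k3⟩ := pw1' u' hu' huz' hu'v
      by_cases huv : u = v
      · subst huv
        rw [t2 u' hu'v, h.tau_symm, k3 x' hx']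
        exact hpw _ _ k1 hx'l k2 hx'z
      · rw [t1 u u' huv hu'v, h.tau_symm, k3 u huv, h.tau_symm]
        obtain ⟨u1, j1, j2, j3⟩ := pw1' u hu huz huv
        by_cases h0 : u0 = v
        · rw [h0, h.tau_symm]
          rcases leaf_mv_cases h h3 hla hx' hu with rfl | rfl | ⟨g1, g2, g3⟩
          · exact absurd rfl huv
          · rcases leaf_mv_cases h h3 hla hx' hu' with rfl | rfl | ⟨g1, g2, g3⟩
            · exact absurd rfl hu'v
            · exact absurd rfl hne
            · have := h.leaf_tau_le hla (lam_ex h3 _ _) hla.1.symm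
              rw [h.tau_symm]
              have c1 := k3 u hla.1.symm
              rw [h0, h.tau_symm, hxt u' g3] at c1
              rw [h.tau_symm u v, ← c1]
              exact hleafC u' g1 huz'
          · exact hpw _ _ hv.1 g1 hza.symm huz
        · rw [j3 u0 h0]; exact hpw _ _ j1 k1 j2 k2
    intro u u' hu hu' huz huz' hne
    by_cases hu'v : u' = v
    · rw [hT1.tau_symm]
      exact main u' u hu' hu huz' huz hne.symm (fun h => hne (h.trans hu'v.symm))
    · exact main u u' hu hu' huz huz' hne hu'v
  have hold4 : ∀ g, IsLeaf d g → g ≠ z → g ≠ v → IsLeaf (mvd d z v) g := fun g hg h1 h2 =>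
    leaf_mv_old h hza.symm hg h1 h2 (nleaf_nbr h h3 hz hg)
  have hpnl := nbr_not_leaf h h3 hz
  have hzl4 : IsLeaf (mvd d z v) z := ⟨v, mvd_leaf h hza.symm⟩
  have hep4 : ecc (mvd d z v) p = dia d := by
    have l1 := le_ecc (d := mvd d z v) p z
    have l2 := ecc_le_dia (d := mvd d z v) p
    rw [hT4.symm p z] at l1
    omega
  have hez4 : ecc (mvd d z v) z = dia d := by
    have l1 := le_ecc (d := mvd d z v) z p
    have l2 := ecc_le_dia (d := mvd d z v) z
    omega
  have hepd : ecc d p + 1 = dia d := by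
    have := h.leaf_ecc hz (lam_ex h3 _ _); omega
  have hND4 : Nj (mvd d z v) (dia d) + 1 = Nj d (dia d) := by
    have := Nj_isom Θ hΘ (dia d); omega
  have cases : Θ z = z ∨ Θ z = p := by
    have c := hΘ (Θ.symm z) (Θ.symm p)
    rw [Equiv.apply_symm_apply, Equiv.apply_symm_apply, hzp4] at c
    rcases hpair1 _ _ c.symm with h1 | h1
    · left; rw [Equiv.symm_apply_eq] at h1; exact h1.symm
    · right; rw [Equiv.symm_apply_eq] at h1; exact h1.symm
  have Nfilt : ∀ (D : V → V → ℕ), Nj D (dia d) = (Finset.univ.filter fun u => ecc D u = dia d).card := by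
    intro D; unfold Nj; rw [Finset.card_filter]
  rw [Nfilt, Nfilt] at hND4
  rcases cases with hc | hc
  · have hsub : insert p ((Finset.univ.filter fun u => ecc d u = dia d).erase v) ⊆
        Finset.univ.filter fun u => ecc (mvd d z v) u = dia d := by
      intro u hu
      simp only [Finset.mem_insert, Finset.mem_erase, Finset.mem_filter, Finset.mem_univ, true_and] at hu ⊢
      rcases hu with rfl | ⟨huv, hud⟩
      · exact hep4
      · by_cases huz : u = z
        · subst huz; exact hez4
        have hul := hdeepleaf u hud
        have hup : u ≠ p := by rintro rfl; exact hpnl hul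
        have k : dia d + 1 ≤ tau (mvd d z v) p u := by
          have hz1 : Θ.symm z = z := by rw [Equiv.symm_apply_eq]; exact hc.symm
          have := pw1 (Θ.symm p) (Θ.symm u)
            ((isLeaf_isom Θ hΘ _).1 (by rw [Equiv.apply_symm_apply]; exact hpl4))
            ((isLeaf_isom Θ hΘ _).1 (by rw [Equiv.apply_symm_apply]; exact hold4 u hul huz huv))
            (fun h => hz.1 (by rw [Equiv.symm_apply_eq, hc] at h; exact h.symm))
            (fun h => huz (by rw [Equiv.symm_apply_eq, hc] at h; exact h))
            (fun h => hup (Θ.symm.injective h).symm)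
          rw [← tau_isom Θ hΘ, Equiv.apply_symm_apply, Equiv.apply_symm_apply] at this
          exact this
        have k2 := hT4.tau_add p u
        rw [mvd_ne h hz.1.symm huz, hep4] at k2
        have k3 := hz.2 u huz
        have k4 := hdz u hud huz
        rw [h.symm] at k4
        have k5 := ecc_le_dia (d := mvd d z v) u
        omega
    have hcard := Finset.card_le_card hsub
    rw [Finset.card_insert_of_notMem (by
      simp only [Finset.mem_erase, Finset.mem_filter, Finset.mem_univ, true_and]; omega),
      Finset.card_erase_of_mem (by simp [hnd])] at hcard
    have : 0 < (Finset.univ.filter fun u => ecc d u = dia d).card :=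
      Finset.card_pos.2 ⟨v, by simp [hnd]⟩
    omega
  · have lon4 : ∀ u, IsLeaf (mvd d z v) u → u ≠ p → tau (mvd d z v) p u = dia d := by
      intro u hu hup
      have := lon1 (Θ.symm u) ((isLeaf_isom Θ hΘ _).1 (by rw [Equiv.apply_symm_apply]; exact hu))
        (fun h => hup (by rw [Equiv.symm_apply_eq, hc] at h; exact h))
      rw [← tau_isom Θ hΘ, Equiv.apply_symm_apply, hc] at this
      exact this
    have ecc4 : ∀ y, IsLeaf d y → y ≠ z → y ≠ v → ecc (mvd d z v) y + 1 = d z y := by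
      intro y hy hyz hyv
      have k1 := lon4 y (hold4 y hy hyz hyv) (by rintro rfl; exact hpnl hy)
      have k2 := hT4.tau_add p y
      rw [mvd_ne h hz.1.symm hyz, hep4] at k2
      have k3 := hz.2 y hyz
      omega
    have hdeep4 : (Finset.univ.filter fun u => ecc (mvd d z v) u = dia d) ⊆ {z, p} := by
      intro u hu
      simp only [Finset.mem_insert, Finset.mem_singleton, Finset.mem_filter, Finset.mem_univ, true_and] at hu ⊢
      obtain ⟨y, hy⟩ := exists_ecc (d := mvd d z v) u
      have hul : IsLeaf (mvd d z v) u := by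
        refine hT4.deep_leaf (y := y) (by omega) ?_
        rintro rfl
        rw [mvd_self] at hy; omega
      rcases leaf_mv_cases h h3 hz hza.symm hul with rfl | rfl | ⟨g1, g2, g3⟩
      · exact Or.inl rfl
      · exact Or.inr rfl
      · have k := ecc4 u g1 g3 g2
        have k2 := le_dia (d := d) z u
        omega
    have hc4 := Finset.card_le_card hdeep4
    rw [Finset.card_pair hz.1] at hc4
    have hdeepd : ∀ u, ecc d u = dia d → u = v ∨ u = z ∨ u = q := by
      intro u hu
      by_contra hcon
      push Not at hcon
      have : ({v, z, q, u} : Finset V) ⊆ Finset.univ.filter fun u => ecc d u = dia d := by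
        intro w hw
        simp only [Finset.mem_insert, Finset.mem_singleton] at hw
        simp only [Finset.mem_filter, Finset.mem_univ, true_and]
        rcases hw with rfl | rfl | rfl | rfl <;> assumption
      have := Finset.card_le_card this
      have e4 : ({v, z, q, u} : Finset V).card = 4 := by
        rw [Finset.card_insert_of_notMem, Finset.card_insert_of_notMem, Finset.card_pair hcon.2.2.symm]
        · simp only [Finset.mem_insert, Finset.mem_singleton]; push Not
          exact ⟨hqz.symm, fun h => hcon.2.1 h.symm⟩
        · simp only [Finset.mem_insert, Finset.mem_singleton]; push Not
          exact ⟨hza.symm, hqv.symm, fun h => hcon.1 h.symm⟩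
      omega
    have htheta : ∀ u, IsLeaf d u → u ≠ v → u ≠ z → tau d v u = tau d v q := by
      intro u hu huv huz
      have k1 := hv.2.2 u hu (hnc u huv huz)
      have k2 : om d v ≤ sj d (tau d v u + 1) v := by
        refine sj_ge ?_
        have := h.leaf_tau_le hla (lam_ex h3 _ _) huv
        rw [h.tau_self]; omega
      rw [homd v hnd] at k2
      obtain ⟨u1, hu1, hu1d⟩ := sj_deep (d := d) (j := tau d v u + 1) (x := u) (by omega)
      have k3 := h.dia_le_tau v u
      rcases hdeepd u1 hu1d with rfl | rfl | rfl
      · rw [h.tau_symm] at hu1; omega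
      · have := hzt u hu huz
        rw [h.tau_symm] at this; omega
      · have c1 := h.tau_ultra v u1 u
        have c2 := h.tau_ultra v u u1
        rw [h.tau_symm u1 u] at c1
        omega
    have hql := hdeepleaf q hqd
    have hΘq : Θ q = z := by
      have k : ecc (mvd d z v) (Θ q) = dia d := by rw [ecc_isom Θ hΘ, m1 q hqv, hqd]
      have := hdeep4 (by simp [k] : Θ q ∈ Finset.univ.filter fun u => ecc (mvd d z v) u = dia d)
      simp only [Finset.mem_insert, Finset.mem_singleton] at this
      rcases this with h1 | h1
      · exact h1
      · exact absurd (Θ.injective (h1.trans hc.symm)) hqz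
    have hxq : x ≠ q := by rintro rfl; exact nbr_not_leaf h h3 hla hql
    have hyl : IsLeaf (mvd d z v) (Θ x) := (isLeaf_isom Θ hΘ _).2 hxl1
    have hyz : Θ x ≠ z := fun h => hxq (Θ.injective (h.trans hΘq.symm))
    have hyp : Θ x ≠ p := fun h => hxz (Θ.injective (h.trans hc.symm))
    have ht4 : tau (mvd d z v) z (Θ x) = tau d v q := by
      have hk := tau_isom Θ hΘ q x
      rw [hΘq] at hk
      rw [hk, t1 q x hqv hla.1.symm, h.tau_symm, hxt q hqv]
    rcases leaf_mv_cases h h3 hz hza.symm hyl with h1 | h1 | ⟨g1, g2, g3⟩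
    · exact hyz h1
    · exact hyp h1
    · have k1 := ecc4 _ g1 g3 g2
      have k2 := hT4.tau_add z (Θ x)
      rw [mvd_left g3, hez4, ht4] at k2
      have k3 := h.tau_add v (Θ x)
      rw [htheta _ g1 g2 g3] at k3
      have k4 := hzt _ g1 g3
      have k5 := h.tau_add z (Θ x)
      omega

theorem half_lex (h : TM d) (hlam : 4 ≤ lam d) {a : V} (H : Half d e a)
    (hdia : dia e = dia d) (hle : lam e = lam d) (hni : ¬ Isom e d) : LexLt d e := by
  by_cases hd : ecc d a = dia d
  · exact half_lex_deep h hlam H hdia hle hni hd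
  · exact half_lex_nondeep h hlam H hdia hle hni hd

end
end

section
def Perm3 (i j k i' j' k' : ℕ) : Prop :=
  (i = i' ∧ j = j' ∧ k = k') ∨ (i = i' ∧ j = k' ∧ k = j') ∨ (i = j' ∧ j = i' ∧ k = k') ∨
  (i = j' ∧ j = k' ∧ k = i') ∨ (i = k' ∧ j = i' ∧ k = j') ∨ (i = k' ∧ j = j' ∧ k = i')

theorem perm3_aux {i j k i' j' k' : ℕ} (hp : Perm3 i' j' k' (i + 1) (j - 1) k) (hj : j = i + 1) :
    Perm3 i j k i' j' k' := by
  subst hj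
  unfold Perm3 at *
  simp only [Nat.add_sub_cancel] at hp
  rcases hp with ⟨rfl, rfl, rfl⟩ | ⟨rfl, rfl, rfl⟩ | ⟨rfl, rfl, rfl⟩ | ⟨rfl, rfl, rfl⟩ | ⟨rfl, rfl, rfl⟩ | ⟨rfl, rfl, rfl⟩ <;> simp

theorem Perm3.symm {i j k i' j' k' : ℕ} (hp : Perm3 i j k i' j' k') : Perm3 i' j' k' i j k := by
  unfold Perm3 at *
  rcases hp with ⟨rfl, rfl, rfl⟩ | ⟨rfl, rfl, rfl⟩ | ⟨rfl, rfl, rfl⟩ | ⟨rfl, rfl, rfl⟩ | ⟨rfl, rfl, rfl⟩ | ⟨rfl, rfl, rfl⟩ <;> simp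
theorem Perm3.swap {i j k i' j' k' : ℕ} (hp : Perm3 i j k i' j' k') : Perm3 i k j i' j' k' := by
  unfold Perm3 at *
  rcases hp with ⟨rfl, rfl, rfl⟩ | ⟨rfl, rfl, rfl⟩ | ⟨rfl, rfl, rfl⟩ | ⟨rfl, rfl, rfl⟩ | ⟨rfl, rfl, rfl⟩ | ⟨rfl, rfl, rfl⟩ <;> simp

theorem Perm3.q {i j k i' j' k' : ℕ} (hp : Perm3 i j k i' j' k') :
    i ^ 2 + j ^ 2 + k ^ 2 = i' ^ 2 + j' ^ 2 + k' ^ 2 := by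
  rcases hp with ⟨rfl, rfl, rfl⟩ | ⟨rfl, rfl, rfl⟩ | ⟨rfl, rfl, rfl⟩ | ⟨rfl, rfl, rfl⟩ | ⟨rfl, rfl, rfl⟩ | ⟨rfl, rfl, rfl⟩ <;> ring

theorem Perm3.q1 {i j k i' j' k' : ℕ} (hp : Perm3 i' j' k' (i + 1) (j - 1) k) (hj : 1 ≤ j) :
    i' ^ 2 + j' ^ 2 + k' ^ 2 + 2 * j = i ^ 2 + j ^ 2 + k ^ 2 + 2 * i + 2 := by
  have := hp.q
  obtain ⟨j, rfl⟩ : ∃ t, j = t + 1 := ⟨j - 1, by omega⟩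
  simp only [Nat.add_sub_cancel] at this
  rw [this]
  ring

set_option maxHeartbeats 4000000 in
/-- the core case -/
theorem concl_core {i j k i' j' k' : ℕ}
    (hj : 2 ≤ j) (n1 : Perm3 i' j' k' (i + 1) (j - 1) k) (hij : j ≠ i + 1)
    (n2 : (2 ≤ i ∧ Perm3 i' j' k' (j + 1) (i - 1) k) ∨ (2 ≤ i ∧ Perm3 i' j' k' (k + 1) (i - 1) j) ∨
      (i = 1 ∧ (i' = 1 ∨ j' = 1 ∨ k' = 1)))
    (hj' : 2 ≤ j') (n3 : Perm3 i j k (i' + 1) (j' - 1) k') (hij' : j' ≠ i' + 1)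
    (n4 : (2 ≤ i' ∧ Perm3 i j k (j' + 1) (i' - 1) k') ∨
      (2 ≤ i' ∧ Perm3 i j k (k' + 1) (i' - 1) j') ∨
      (i' = 1 ∧ (i = 1 ∨ j = 1 ∨ k = 1)))
    (p1 : 1 ≤ i) (p3 : 1 ≤ k) (p4 : 1 ≤ i') (p6 : 1 ≤ k') :
    (i = 2 ∧ j = 1 ∧ k = 2) ∨ (i = 2 ∧ j = 2 ∧ k = 1) ∨
      (i' = 2 ∧ j' = 1 ∧ k' = 2) ∨ (i' = 2 ∧ j' = 2 ∧ k' = 1) := by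
  have q1 := n1.q1 (by omega)
  have q3 := n3.q1 (by omega)
  have q2 : i = 1 ∨ (j + j = 2 * i ∧ Perm3 i' j' k' (j + 1) (i - 1) k) ∨
      (j + k = 2 * i ∧ Perm3 i' j' k' (k + 1) (i - 1) j) := by
    rcases n2 with ⟨g, n⟩ | ⟨g, n⟩ | n
    · have := n.q1 (by omega); exact Or.inr (Or.inl ⟨by omega, n⟩)
    · have := n.q1 (by omega); exact Or.inr (Or.inr ⟨by omega, n⟩)
    · exact Or.inl n.1
  have q4 : i' = 1 ∨ (j' + j' = 2 * i' ∧ Perm3 i j k (j' + 1) (i' - 1) k') ∨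
      (j' + k' = 2 * i' ∧ Perm3 i j k (k' + 1) (i' - 1) j') := by
    rcases n4 with ⟨g, n⟩ | ⟨g, n⟩ | n
    · have := n.q1 (by omega); exact Or.inr (Or.inl ⟨by omega, n⟩)
    · have := n.q1 (by omega); exact Or.inr (Or.inr ⟨by omega, n⟩)
    · exact Or.inl n.1
  have hs : j + j' = i + i' + 2 := by omega
  have m2 : i = 1 → (i' = 1 ∨ j' = 1 ∨ k' = 1) := by rintro rfl; omega
  have m4 : i' = 1 → (i = 1 ∨ j = 1 ∨ k = 1) := by rintro rfl; omega
  clear q1 q3 n2 n4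
  rcases q2 with q2 | ⟨q2, n2⟩ | ⟨q2, n2⟩ <;> rcases q4 with q4 | ⟨q4, n4⟩ | ⟨q4, n4⟩ <;>
  unfold Perm3 at n1 n3 <;>
  (rcases n1 with ⟨h1, h2, h3⟩ | ⟨h1, h2, h3⟩ | ⟨h1, h2, h3⟩ | ⟨h1, h2, h3⟩ | ⟨h1, h2, h3⟩ | ⟨h1, h2, h3⟩ <;>
  rcases n3 with ⟨g1, g2, g3⟩ | ⟨g1, g2, g3⟩ | ⟨g1, g2, g3⟩ | ⟨g1, g2, g3⟩ | ⟨g1, g2, g3⟩ | ⟨g1, g2, g3⟩ <;>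
  first
    | (exfalso; omega)
    | omega
    | (unfold Perm3 at n4; omega)
    | (unfold Perm3 at n2; omega)
    | (unfold Perm3 at n2 n4; omega))
end

section

section
variable {V W : Type} [Fintype V] [Fintype W] {d : V → V → ℕ} {e : W → W → ℕ}

/-- tripods -/
structure Legs {V : Type} (d : V → V → ℕ) (A B C : V) (i j k : ℕ) : Prop where
  lA : IsLeaf d A
  lB : IsLeaf d B
  lC : IsLeaf d C
  nAB : A ≠ B
  nAC : A ≠ C
  nBC : B ≠ C
  all : ∀ g, IsLeaf d g → g = A ∨ g = B ∨ g = C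
  dAB : d A B = i + j
  dAC : d A C = i + k
  dBC : d B C = j + k
  hi : 1 ≤ i
  hj : 1 ≤ j
  hk : 1 ≤ k

theorem gromov_pos (h : TM d) {A B C : V} (hA : IsLeaf d A) (h1 : A ≠ B) (h2 : A ≠ C) :
    d B C + 2 ≤ d A B + d A C := by
  obtain ⟨p, hp⟩ := hA
  rw [hp.2 B h1.symm, hp.2 C h2.symm]
  have := h.tri B p C
  rw [h.symm B p] at this
  omega

theorem mkLegs (h : TM d) {A B C : V} (lA : IsLeaf d A) (lB : IsLeaf d B) (lC : IsLeaf d C)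
    (nAB : A ≠ B) (nAC : A ≠ C) (nBC : B ≠ C) (all : ∀ g, IsLeaf d g → g = A ∨ g = B ∨ g = C) :
    ∃ i j k, Legs d A B C i j k := by
  have g1 := gromov_pos h lA nAB nAC
  have g2 := gromov_pos h lB nAB.symm nBC
  have g3 := gromov_pos h lC nAC.symm nBC.symm
  have pr := h.par A B C
  rw [h.symm B A] at g2
  rw [h.symm C A, h.symm C B] at g3
  exact ⟨(d A B + d A C - d B C) / 2, (d A B + d B C - d A C) / 2, (d A C + d B C - d A B) / 2,
    lA, lB, lC, nAB, nAC, nBC, all, by omega, by omega, by omega, by omega, by omega, by omega⟩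

theorem Legs.swap12 (h : TM d) {A B C : V} {i j k : ℕ} (L : Legs d A B C i j k) :
    Legs d B A C j i k :=
  ⟨L.lB, L.lA, L.lC, L.nAB.symm, L.nBC, L.nAC, fun g hg => by have := L.all g hg; tauto,
    by rw [h.symm, L.dAB]; omega, L.dBC, L.dAC, L.hj, L.hi, L.hk⟩

theorem Legs.swap23 (h : TM d) {A B C : V} {i j k : ℕ} (L : Legs d A B C i j k) :
    Legs d A C B i k j :=
  ⟨L.lA, L.lC, L.lB, L.nAC, L.nAB, L.nBC.symm, fun g hg => by have := L.all g hg; tauto,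
    L.dAC, L.dAB, by rw [h.symm, L.dBC]; omega, L.hi, L.hk, L.hj⟩

theorem Legs.ex (h : TM d) (hlam : lam d = 3) {a : V} (ha : IsLeaf d a) :
    ∃ B C i j k, Legs d a B C i j k := by
  classical
  obtain ⟨B, hB, hBa, _⟩ := lam_three hlam.ge a a
  obtain ⟨C, hC, hCa, hCB⟩ := lam_three hlam.ge a B
  obtain ⟨i, j, k, L⟩ := mkLegs h ha hB hC hBa.symm hCa.symm hCB.symm (by
    intro g hg
    by_contra hc
    push Not at hc
    have hsub : ({a, B, C, g} : Finset V) ⊆ Finset.univ.filter fun v => IsLeaf d v := by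
      intro u hu
      simp only [Finset.mem_insert, Finset.mem_singleton] at hu
      simp only [Finset.mem_filter, Finset.mem_univ, true_and]
      rcases hu with rfl | rfl | rfl | rfl <;> assumption
    have h4 := Finset.card_le_card hsub
    have e4 : ({a, B, C, g} : Finset V).card = 4 := by
      rw [Finset.card_insert_of_notMem, Finset.card_insert_of_notMem, Finset.card_pair hc.2.2.symm]
      · simp only [Finset.mem_insert, Finset.mem_singleton]; push Not
        exact ⟨hCB.symm, fun h => hc.2.1 h.symm⟩
      · simp only [Finset.mem_insert, Finset.mem_singleton]; push Not
        exact ⟨hBa.symm, hCa.symm, fun h => hc.1 h.symm⟩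
    have : lam d = (Finset.univ.filter fun v => IsLeaf d v).card := by
      unfold lam; congr
    omega)
  exact ⟨B, C, i, j, k, L⟩

set_option maxHeartbeats 1000000 in
theorem Legs.perm (h : TM d) {A B C A' B' C' : V} {i j k i' j' k' : ℕ} (L : Legs d A B C i j k)
    (L' : Legs d A' B' C' i' j' k') : Perm3 i j k i' j' k' := by
  have c1 := L'.all A L.lA
  have c2 := L'.all B L.lB
  have c3 := L'.all C L.lC
  have a1 := L.dAB
  have a2 := L.dAC
  have a3 := L.dBC
  have b1 := L'.dAB
  have b2 := L'.dAC
  have b3 := L'.dBC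
  have s1 := h.symm A' B'
  have s2 := h.symm A' C'
  have s3 := h.symm B' C'
  have n1 := L.nAB
  have n2 := L.nAC
  have n3 := L.nBC
  unfold Perm3
  rcases c1 with rfl | rfl | rfl <;> rcases c2 with rfl | rfl | rfl <;>
    rcases c3 with rfl | rfl | rfl <;> first | contradiction |
    exact Or.inl ⟨by omega, by omega, by omega⟩ |
    exact Or.inr (Or.inl ⟨by omega, by omega, by omega⟩) |
    exact Or.inr (Or.inr (Or.inl ⟨by omega, by omega, by omega⟩)) |
    exact Or.inr (Or.inr (Or.inr (Or.inl ⟨by omega, by omega, by omega⟩))) |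
    exact Or.inr (Or.inr (Or.inr (Or.inr (Or.inl ⟨by omega, by omega, by omega⟩)))) |
    exact Or.inr (Or.inr (Or.inr (Or.inr (Or.inr ⟨by omega, by omega, by omega⟩))))

theorem Legs.isom {A B C : V} {i j k : ℕ} (L : Legs d A B C i j k) (σ : V ≃ W)
    (hs : ∀ x y, e (σ x) (σ y) = d x y) : Legs e (σ A) (σ B) (σ C) i j k := by
  refine ⟨(isLeaf_isom σ hs _).2 L.lA, (isLeaf_isom σ hs _).2 L.lB, (isLeaf_isom σ hs _).2 L.lC,
    fun h => L.nAB (σ.injective h), fun h => L.nAC (σ.injective h), fun h => L.nBC (σ.injective h),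
    ?_, by rw [hs, L.dAB], by rw [hs, L.dAC], by rw [hs, L.dBC], L.hi, L.hj, L.hk⟩
  intro g hg
  obtain ⟨g, rfl⟩ := σ.surjective g
  have := L.all g ((isLeaf_isom σ hs g).1 hg)
  rcases this with rfl | rfl | rfl <;> simp

/-- distance to the third leaf for a vertex on the geodesic `AB` -/
theorem third (h : TM d) {A B C u : V} (hu : d A B = d A u + d u B) :
    (d C u + d A u = d C A ∧ d C B ≤ d C u + d u B) ∨
    (d C u + d u B = d C B ∧ d C A ≤ d C u + d A u) := by
  have h1 := h.four C u A B
  have h2 := h.tri C u A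
  have h3 := h.tri C u B
  rw [h.symm u A] at h1 h2
  omega

theorem exists_on (h : TM d) (A B : V) : ∀ t, t ≤ d A B → ∃ u, d A u = t ∧ d A B = t + d u B := by
  intro t
  induction t with
  | zero => intro _; exact ⟨A, h.self A, by omega⟩
  | succ t ih =>
    intro ht
    obtain ⟨u, hu1, hu2⟩ := ih (by omega)
    have hne : u ≠ B := by rintro rfl; rw [h.self] at hu2; omega
    obtain ⟨r, hr1, hr2⟩ := h.geo u B hne
    refine ⟨r, ?_, by omega⟩
    have := h.tri A u r
    have := h.tri A r B
    omega

theorem Legs.on (h : TM d) {A B C : V} {i j k : ℕ} (L : Legs d A B C i j k) (u : V) (hu : A ≠ u) :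
    d A B = d A u + d u B ∨ d A C = d A u + d u C := by
  obtain ⟨L', hL', hd⟩ := h.ext_leaf hu
  rcases L.all L' hL' with rfl | rfl | rfl
  · have := h.self L'
    have := h.pos hu
    omega
  · left; exact hd
  · right; exact hd

set_option maxHeartbeats 1000000 in
theorem Legs.isom_of (h : TM d) (h' : TM e) (hcard : Fintype.card V = Fintype.card W)
    {A B C : V} {A' B' C' : W} {i j k : ℕ} (L : Legs d A B C i j k) (L' : Legs e A' B' C' i j k) :
    Isom d e := by
  have hex : ∀ u, ∃ u', e A' u' = d A u ∧ e B' u' = d B u ∧ e C' u' = d C u := by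
    intro u
    have aB := L.dAB
    have aC := L.dAC
    have bC := L.dBC
    have aB' := L'.dAB
    have aC' := L'.dAC
    have bC' := L'.dBC
    by_cases hu : A = u
    · subst hu
      refine ⟨A', by rw [h.self, h'.self], ?_, ?_⟩
      · rw [h.symm, h'.symm]; omega
      · rw [h.symm, h'.symm]; omega
    rcases L.on h u hu with hon | hon
    · obtain ⟨u', h1, h2⟩ := exists_on h' A' B' (d A u) (by omega)
      have t1 := (third h (C := C) hon)
      have t2 := (third h' (C := C') (u := u') (by omega : e A' B' = e A' u' + e u' B'))
      have s1 := h.symm C A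
      have s2 := h.symm C B
      have s3 := h'.symm C' A'
      have s4 := h'.symm C' B'
      have s5 := h.symm B u
      have s6 := h'.symm B' u'
      exact ⟨u', h1, by omega, by omega⟩
    · obtain ⟨u', h1, h2⟩ := exists_on h' A' C' (d A u) (by omega)
      have t1 := (third h (C := B) hon)
      have t2 := (third h' (C := B') (u := u') (by omega : e A' C' = e A' u' + e u' C'))
      have s1 := h.symm B A
      have s3 := h'.symm B' A'
      have s5 := h.symm C u
      have s6 := h'.symm C' u'
      exact ⟨u', h1, by omega, by omega⟩
  choose f f1 f2 f3 using hex
  have lower : ∀ {X : Type} {D : X → X → ℕ}, TM D → ∀ x y z : X, D z x ≤ D z y + D x y := by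
    intro X D hD x y z
    have := hD.tri z y x
    rw [hD.symm y x] at this
    exact this
  have hf : ∀ u u', e (f u) (f u') = d u u' := by
    intro u u'
    apply le_antisymm
    · by_cases hne : f u = f u'
      · rw [hne, h'.self]; omega
      obtain ⟨M, hM, hd⟩ := h'.ext_leaf hne
      rw [h'.symm (f u) M, h'.symm (f u') M] at hd
      rcases L'.all M hM with rfl | rfl | rfl
      · rw [f1, f1] at hd; have := lower h u u' A; omega
      · rw [f2, f2] at hd; have := lower h u u' B; omega
      · rw [f3, f3] at hd; have := lower h u u' C; omega
    · by_cases hne : u = u'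
      · rw [hne, h.self]; omega
      obtain ⟨M, hM, hd⟩ := h.ext_leaf hne
      rw [h.symm u M, h.symm u' M] at hd
      rcases L.all M hM with rfl | rfl | rfl
      · rw [← f1, ← f1] at hd; have := lower h' (f u) (f u') A'; omega
      · rw [← f2, ← f2] at hd; have := lower h' (f u) (f u') B'; omega
      · rw [← f3, ← f3] at hd; have := lower h' (f u) (f u') C'; omega
  have hinj : Function.Injective f := fun u u' huu => h.eq u u' (by rw [← hf, huu, h'.self])
  have hbij := (Fintype.bijective_iff_injective_and_card f).2 ⟨hinj, hcard⟩
  exact ⟨Equiv.ofBijective f hbij, hf⟩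

theorem Legs.isom_perm (h : TM d) (h' : TM e) (hcard : Fintype.card V = Fintype.card W)
    {A B C : V} {A' B' C' : W} {i j k i' j' k' : ℕ} (L : Legs d A B C i j k)
    (L' : Legs e A' B' C' i' j' k') (hp : Perm3 i j k i' j' k') : Isom d e := by
  rcases hp with ⟨rfl, rfl, rfl⟩ | ⟨rfl, rfl, rfl⟩ | ⟨rfl, rfl, rfl⟩ | ⟨rfl, rfl, rfl⟩ |
    ⟨rfl, rfl, rfl⟩ | ⟨rfl, rfl, rfl⟩
  · exact L.isom_of h h' hcard L'
  · exact L.isom_of h h' hcard (L'.swap23 h')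
  · exact L.isom_of h h' hcard (L'.swap12 h')
  · exact L.isom_of h h' hcard ((L'.swap12 h').swap23 h')
  · exact L.isom_of h h' hcard ((L'.swap23 h').swap12 h')
  · exact L.isom_of h h' hcard (((L'.swap12 h').swap23 h').swap12 h')

theorem Legs.mv_leaf (h : TM d) (hlam : lam d = 3) {A B C : V} {i j k : ℕ} (L : Legs d A B C i j k)
    (hl : lam (mvd d A B) = 3) : 2 ≤ i ∧ ∃ p, Legs (mvd d A B) A p C (j + 1) (i - 1) k := by
  obtain ⟨p, hp⟩ := L.lA
  have h' := mvd_TM h hp L.nAB.symm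
  have hpl := (lam_mv_le h hlam.ge hp L.nAB.symm L.lB).2 (by omega)
  have hpn := nbr_not_leaf h hlam.ge hp
  have hpC : p ≠ C := by rintro rfl; exact hpn L.lC
  have hlC := leaf_mv_old h L.nAB.symm L.lC L.nAC.symm L.nBC.symm (nleaf_nbr h hlam.ge hp L.lC)
  obtain ⟨i', j', k', L'⟩ := mkLegs h' ⟨B, mvd_leaf h L.nAB.symm⟩ hpl hlC hp.1 L.nAC hpC (by
    intro g hg
    rcases leaf_mv_cases h hlam.ge hp L.nAB.symm hg with h1 | h1 | ⟨h1, h2, h3⟩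
    · exact Or.inl h1
    · exact Or.inr (Or.inl h1)
    · rcases L.all g h1 with h4 | h4 | h4
      · exact absurd h4 h3
      · exact absurd h4 h2
      · exact Or.inr (Or.inr h4))
  have q1 := L'.dAB
  have q2 := L'.dAC
  have q3 := L'.dBC
  rw [mvd_left hp.1.symm] at q1
  rw [mvd_left L.nAC.symm] at q2
  rw [mvd_ne h hp.1.symm L.nAC.symm] at q3
  have r1 := hp.2 B L.nAB.symm
  have r2 := hp.2 C L.nAC.symm
  have a1 := L.dAB
  have a2 := L.dAC
  have a3 := L.dBC
  have s1 := h.symm B p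
  have b1 := L'.hi
  have b2 := L'.hj
  have b3 := L'.hk
  obtain rfl : i' = j + 1 := by omega
  obtain rfl : j' = i - 1 := by omega
  obtain rfl : k' = k := by omega
  exact ⟨by omega, p, L'⟩

theorem Legs.mv_nonleaf (h : TM d) (hlam : lam d = 3) {A B C p w : V} {i j k : ℕ}
    (L : Legs d A B C i j k) (hp : Leaf d A p) (hw : w ≠ A) (hwp : w ≠ p) (hwl : ¬ IsLeaf d w)
    (hl : lam (mvd d A w) = 3) : i = 1 ∧ Legs (mvd d A w) A B C 1 (d w B) (d w C) ∧
      d w B + d w C = j + k := by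
  have h' := mvd_TM h hp hw
  have hpn := lam_mv_nonleaf h hlam.ge hp hw hwl (by omega)
  have a1 := L.dAB
  have a2 := L.dAC
  have a3 := L.dBC
  have r1 := hp.2 B L.nAB.symm
  have r2 := hp.2 C L.nAC.symm
  have hi1 : i = 1 := by
    by_contra hi
    have hi2 : 2 ≤ i := by have := L.hi; omega
    have dpB : p ≠ B := by rintro rfl; rw [h.self] at r1; have := L.hj; omega
    have toC : ∀ r, d p r = 1 → r ≠ A → d p C = 1 + d r C := by
      intro r hr hrA
      have hpr : p ≠ r := by rintro rfl; rw [h.self] at hr; omega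
      obtain ⟨M, hM, hd⟩ := h.ext_leaf hpr
      rcases L.all M hM with rfl | rfl | rfl
      · have := h.leaf_nbr hp
        rw [h.symm p M] at hd
        exact absurd (h.eq r M (by omega)) hrA
      · rcases h.nbr_pm hr C with g | g
        · omega
        · have f := h.four p M r C
          rw [h.symm M r] at f
          omega
      · omega
    obtain ⟨r, hr1, hr2⟩ := h.geo p B dpB
    have hrA : r ≠ A := by rintro rfl; omega
    refine hpn ⟨r, h'.leaf_of_nbr (by rw [mvd_ne h hp.1.symm hrA]; exact hr1) ?_⟩
    intro r' hr'
    have hr'A : r' ≠ A := by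
      rintro rfl
      rw [mvd_right hp.1.symm] at hr'
      exact hwp (h.eq p w (by omega)).symm
    rw [mvd_ne h hp.1.symm hr'A] at hr'
    have c1 := toC r hr1 hrA
    have c2 := toC r' hr' hr'A
    have f := h.four r' r C p
    have s1 := h.symm p r
    have s2 := h.symm p r'
    have s3 := h.symm C p
    exact h.eq _ _ (by omega)
  subst hi1
  have hlB := leaf_mv_old h hw L.lB L.nAB.symm (by rintro rfl; exact hwl L.lB) (nleaf_nbr h hlam.ge hp L.lB)
  have hlC := leaf_mv_old h hw L.lC L.nAC.symm (by rintro rfl; exact hwl L.lC) (nleaf_nbr h hlam.ge hp L.lC)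
  have hwB : w ≠ B := by rintro rfl; exact hwl L.lB
  have hwC : w ≠ C := by rintro rfl; exact hwl L.lC
  have hpos := h.pos hw
  have hsum : d w B + d w C = j + k := by
    have s1 := h.symm C A
    have s2 := h.symm C B
    have s3 := h.symm B A
    have s4 := h.symm C w
    have s5 := h.symm B w
    have s6 := h.symm A w
    rcases L.on h w hw.symm with hon | hon
    · have t := (third h (C := C) hon)
      omega
    · have t := (third h (C := B) hon)
      omega
  refine ⟨rfl, ⟨⟨w, mvd_leaf h hw⟩, hlB, hlC, L.nAB, L.nAC, L.nBC, ?_, ?_, ?_, ?_, le_refl 1,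
    h.pos hwB, h.pos hwC⟩, hsum⟩
  · intro g hg
    rcases leaf_mv_cases h hlam.ge hp hw hg with h1 | h1 | ⟨h1, h2, h3⟩
    · exact Or.inl h1
    · exact absurd (h1 ▸ hg) hpn
    · exact L.all g h1
  · rw [mvd_left L.nAB.symm]; omega
  · rw [mvd_left L.nAC.symm]; omega
  · rw [mvd_ne h L.nAB.symm L.nAC.symm, a3, hsum]

/-- the numeric content of `Half` for tripods -/
theorem Half.num (h : TM d) (he : TM e) (hlam : lam d = 3) (hle : lam e = 3) {a B C : V}
    {A' B' C' : W} {i j k i' j' k' : ℕ}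
    (H : Half d e a) (hni : ¬ Isom e d) (L : Legs d a B C i j k) (L' : Legs e A' B' C' i' j' k') :
    ((2 ≤ j ∧ Perm3 i' j' k' (i + 1) (j - 1) k) ∨ (2 ≤ k ∧ Perm3 i' j' k' (i + 1) (k - 1) j)) ∧
    ((2 ≤ i ∧ Perm3 i' j' k' (j + 1) (i - 1) k) ∨ (2 ≤ i ∧ Perm3 i' j' k' (k + 1) (i - 1) j) ∨
      (i = 1 ∧ ∃ s t, s + t = j + k ∧ Perm3 i' j' k' 1 s t)) := by
  obtain ⟨p, hp⟩ := L.lA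
  constructor
  · obtain ⟨z, hz, hza, σ, hσ⟩ := H.four
    have hl := lam_isom σ hσ
    rw [hle] at hl
    rcases L.all z hz with rfl | rfl | rfl
    · exact absurd rfl hza
    · left
      obtain ⟨g1, q, g2⟩ := (L.swap12 h).mv_leaf h hlam hl
      obtain ⟨r, hr⟩ := hz
      exact ⟨g1, (L'.isom σ hσ).perm (mvd_TM h hr hza.symm) g2⟩
    · right
      obtain ⟨g1, q, g2⟩ := ((L.swap23 h).swap12 h).mv_leaf h hlam hl
      obtain ⟨r, hr⟩ := hz
      exact ⟨g1, (L'.isom σ hσ).perm (mvd_TM h hr hza.symm) g2⟩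
  · obtain ⟨x', hx', hI⟩ := H.one
    have hx'p : x' ≠ p := by
      rintro rfl
      rw [mvd_id h hp] at hI
      exact hni hI
    obtain ⟨σ, hσ⟩ := hI
    have hl := lam_isom σ hσ
    rw [hle] at hl
    by_cases hxl : IsLeaf d x'
    · rcases L.all x' hxl with rfl | rfl | rfl
      · exact absurd rfl hx'
      · left
        obtain ⟨g1, q, g2⟩ := L.mv_leaf h hlam hl
        exact ⟨g1, (L'.isom σ hσ).perm (mvd_TM h hp hx') g2⟩
      · right; left
        obtain ⟨g1, q, g2⟩ := (L.swap23 h).mv_leaf h hlam hl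
        exact ⟨g1, (L'.isom σ hσ).perm (mvd_TM h hp hx') g2⟩
    · right; right
      obtain ⟨g1, g2, g3⟩ := L.mv_nonleaf h hlam hp hx' hx'p hxl hl
      exact ⟨g1, _, _, g3, (L'.isom σ hσ).perm (mvd_TM h hp hx') g2⟩

/-- the special tripod `1,2,2` is excluded -/
theorem Half.no122 (h : TM d) (hlam : lam d = 3) (hle : lam e = 3) {a B C : V}
    (H : Half d e a) (L : Legs d B a C 1 2 2) : False := by
  have hirr : Irr d B := by
    refine ⟨L.lA, fun w hw hI => ?_⟩
    obtain ⟨p, hp⟩ := L.lA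
    by_cases hwp : w = p
    · rw [hwp]; exact h.leaf_nbr hp
    obtain ⟨σ, hσ⟩ := hI
    have hl := lam_isom σ hσ
    rw [hlam] at hl
    by_cases hwl : IsLeaf d w
    · exfalso
      rcases L.all w hwl with rfl | rfl | rfl
      · exact hw rfl
      · have := (L.mv_leaf h hlam hl).1; omega
      · have := ((L.swap23 h).mv_leaf h hlam hl).1; omega
    · obtain ⟨g1, g2, g3⟩ := L.mv_nonleaf h hlam hp hw hwp hwl hl
      have := (L.isom σ hσ).perm (mvd_TM h hp hw) g2
      unfold Perm3 at this
      have a1 := L.dAB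
      have a2 := L.dAC
      rcases L.on h w hw.symm with hon | hon <;> omega
  obtain ⟨σ, hσ⟩ := H.five B L.nAB hirr
  have hl := lam_isom σ hσ
  rw [hle] at hl
  have := (L.mv_leaf h hlam hl).1
  omega

set_option maxHeartbeats 4000000 in
theorem concl_num {i j k i' j' k' : ℕ}
    (n1 : (2 ≤ j ∧ Perm3 i' j' k' (i + 1) (j - 1) k) ∨ (2 ≤ k ∧ Perm3 i' j' k' (i + 1) (k - 1) j))
    (n2 : (2 ≤ i ∧ Perm3 i' j' k' (j + 1) (i - 1) k) ∨ (2 ≤ i ∧ Perm3 i' j' k' (k + 1) (i - 1) j) ∨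
      (i = 1 ∧ ∃ s t, s + t = j + k ∧ Perm3 i' j' k' 1 s t))
    (n3 : (2 ≤ j' ∧ Perm3 i j k (i' + 1) (j' - 1) k') ∨
      (2 ≤ k' ∧ Perm3 i j k (i' + 1) (k' - 1) j'))
    (n4 : (2 ≤ i' ∧ Perm3 i j k (j' + 1) (i' - 1) k') ∨
      (2 ≤ i' ∧ Perm3 i j k (k' + 1) (i' - 1) j') ∨
      (i' = 1 ∧ ∃ s t, s + t = j' + k' ∧ Perm3 i j k 1 s t))
    (hnp : ¬ Perm3 i j k i' j' k') (p1 : 1 ≤ i) (p2 : 1 ≤ j) (p3 : 1 ≤ k) (p4 : 1 ≤ i')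
    (p5 : 1 ≤ j') (p6 : 1 ≤ k') : (i = 2 ∧ j = 1 ∧ k = 2) ∨ (i = 2 ∧ j = 2 ∧ k = 1) ∨
      (i' = 2 ∧ j' = 1 ∧ k' = 2) ∨ (i' = 2 ∧ j' = 2 ∧ k' = 1) := by
  have n2' : (2 ≤ i ∧ Perm3 i' j' k' (j + 1) (i - 1) k) ∨
      (2 ≤ i ∧ Perm3 i' j' k' (k + 1) (i - 1) j) ∨
      (i = 1 ∧ (i' = 1 ∨ j' = 1 ∨ k' = 1)) := by
    rcases n2 with n | n | ⟨n, s, t, q, r⟩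
    · exact Or.inl n
    · exact Or.inr (Or.inl n)
    · refine Or.inr (Or.inr ⟨n, ?_⟩)
      unfold Perm3 at r
      omega
  have n4' : (2 ≤ i' ∧ Perm3 i j k (j' + 1) (i' - 1) k') ∨
      (2 ≤ i' ∧ Perm3 i j k (k' + 1) (i' - 1) j') ∨
      (i' = 1 ∧ (i = 1 ∨ j = 1 ∨ k = 1)) := by
    rcases n4 with n | n | ⟨n, s, t, q, r⟩
    · exact Or.inl n
    · exact Or.inr (Or.inl n)
    · refine Or.inr (Or.inr ⟨n, ?_⟩)
      unfold Perm3 at r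
      omega
  clear n2 n4
  have hnp' : ¬ Perm3 i' j' k' i j k := fun g => hnp g.symm
  have hnps : ¬ Perm3 i k j i' j' k' := fun g => hnp g.swap
  have hnps' : ¬ Perm3 i' k' j' i j k := fun g => hnp' g.swap
  rcases n1 with ⟨u1, n1⟩ | ⟨u1, n1⟩ <;> rcases n3 with ⟨u3, n3⟩ | ⟨u3, n3⟩
  · exact concl_core u1 n1 (fun g => hnp (perm3_aux n1 g)) n2' u3 n3
      (fun g => hnp' (perm3_aux n3 g)) n4' p1 p3 p4 p6
  · have := concl_core (k := k) u1 n1.swap (fun g => hnp (perm3_aux n1 g))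
      (by rcases n2' with n | n | n
          · exact Or.inl ⟨n.1, n.2.swap⟩
          · exact Or.inr (Or.inl ⟨n.1, n.2.swap⟩)
          · omega) u3 n3 (fun g => hnps' (perm3_aux n3 g))
      (by rcases n4' with n | n | n
          · exact Or.inr (Or.inl n)
          · exact Or.inl n
          · omega) p1 p3 p4 p5
    omega
  · have := concl_core (k := j) u1 n1 (fun g => hnps (perm3_aux n1 g))
      (by rcases n2' with n | n | n
          · exact Or.inr (Or.inl n)
          · exact Or.inl n
          · omega) u3 n3.swap (fun g => hnp' (perm3_aux n3 g))
      (by rcases n4' with n | n | n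
          · exact Or.inl ⟨n.1, n.2.swap⟩
          · exact Or.inr (Or.inl ⟨n.1, n.2.swap⟩)
          · omega) p1 p2 p4 p6
    omega
  · have := concl_core (k := j) u1 n1.swap (fun g => hnps (perm3_aux n1 g))
      (by rcases n2' with n | n | n
          · exact Or.inr (Or.inl ⟨n.1, n.2.swap⟩)
          · exact Or.inl ⟨n.1, n.2.swap⟩
          · omega) u3 n3.swap (fun g => hnps' (perm3_aux n3 g))
      (by rcases n4' with n | n | n
          · exact Or.inr (Or.inl ⟨n.1, n.2.swap⟩)
          · exact Or.inl ⟨n.1, n.2.swap⟩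
          · omega) p1 p2 p4 p5
    omega

theorem lam3_false (h : TM d) (he : TM e) (hlam : lam d = 3) (hle : lam e = 3)
    (hcard : Fintype.card V = Fintype.card W) {a : V} {b : W}
    (H : Half d e a) (H' : Half e d b) (hni : ¬ Isom d e) : False := by
  have hni' : ¬ Isom e d := fun h => hni h.symm
  obtain ⟨B, C, i, j, k, L⟩ := Legs.ex h hlam H.leaf
  obtain ⟨B', C', i', j', k', L'⟩ := Legs.ex he hle H'.leaf
  obtain ⟨n1, n2⟩ := H.num h he hlam hle hni' L L'
  obtain ⟨n3, n4⟩ := H'.num he h hle hlam hni L' L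
  have hnp : ¬ Perm3 i j k i' j' k' := fun hp => hni (L.isom_perm h he hcard L' hp)
  have p1 := L.hi
  have p2 := L.hj
  have p3 := L.hk
  have p4 := L'.hi
  have p5 := L'.hj
  have p6 := L'.hk
  have concl : (i = 2 ∧ j = 1 ∧ k = 2) ∨ (i = 2 ∧ j = 2 ∧ k = 1) ∨
      (i' = 2 ∧ j' = 1 ∧ k' = 2) ∨ (i' = 2 ∧ j' = 2 ∧ k' = 1) := by
    exact concl_num n1 n2 n3 n4 hnp p1 p2 p3 p4 p5 p6
  rcases concl with ⟨rfl, rfl, rfl⟩ | ⟨rfl, rfl, rfl⟩ | ⟨rfl, rfl, rfl⟩ | ⟨rfl, rfl, rfl⟩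
  · exact H.no122 h hlam hle (L.swap12 h)
  · exact H.no122 h hlam hle ((L.swap23 h).swap12 h)
  · exact H'.no122 he hle hlam (L'.swap12 he)
  · exact H'.no122 he hle hlam ((L'.swap23 he).swap12 he)

/-- Theorem M -/
theorem half_half (h : TM d) (he : TM e) (hcard : Fintype.card V = Fintype.card W)
    (hlam : 3 ≤ lam d) (hle : 3 ≤ lam e) {a : V} {b : W}
    (H : Half d e a) (H' : Half e d b) : Isom d e := by
  by_contra hni
  have hd : dia d = dia e := le_antisymm (H.dia_le h) (H'.dia_le he)
  have hl : lam d = lam e := le_antisymm (H'.lam_le he hle) (H.lam_le h hlam)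
  rcases Nat.lt_or_ge (lam d) 4 with g | g
  · exact lam3_false h he (by omega) (by omega) hcard H H' hni
  · exact (half_lex h g H hd.symm hl.symm (fun t => hni t.symm)).asymm
      (half_lex he (by omega) H' hd hl hni)

end
end

section

section

/-- canonical code of a rooted tree, truncated at height `n` -/
noncomputable def code {N : Type} (ch : N → Finset N) (mk : N → ℕ) : ℕ → N → ℕ
  | 0, _ => 0
  | n + 1, x => Encodable.encode (mk x, (ch x).val.map (code ch mk n))

variable {N : Type} [DecidableEq N]

theorem code_succ_inj {ch ch' : N → Finset N} {mk mk' : N → ℕ} {n : ℕ} {x y : N} :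
    code ch mk (n + 1) x = code ch' mk' (n + 1) y ↔
      mk x = mk' y ∧ (ch x).val.map (code ch mk n) = (ch' y).val.map (code ch' mk' n) := by
  simp only [code]
  rw [Encodable.encode_inj, Prod.mk.injEq]

theorem code_transport {ch ch' : N → Finset N} {mk mk' : N → ℕ} (θ : N ≃ N)
    (h1 : ∀ x, ch' (θ x) = (ch x).map θ.toEmbedding) (h2 : ∀ x, mk' (θ x) = mk x) :
    ∀ n x, code ch' mk' n (θ x) = code ch mk n x := by
  intro n
  induction n with
  | zero => intro x; rfl
  | succ n ih =>
    intro x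
    rw [code_succ_inj]
    refine ⟨h2 x, ?_⟩
    rw [h1]
    simp only [Finset.map_val, Multiset.map_map]
    exact Multiset.map_congr rfl (fun c _ => ih c)

/-- ancestors of `p` -/
inductive Anc (ch : N → Finset N) (p : N) : N → Prop
  | refl : Anc ch p p
  | step {c x : N} : Anc ch p c → c ∈ ch x → Anc ch p x

/-- forest with a separate vertex `v` -/
structure KS (ch : N → Finset N) (v : N) (dp : N → ℕ) : Prop where
  nv : ∀ x, v ∉ ch x
  ev : ch v = ∅
  dp : ∀ x, ∀ c ∈ ch x, dp c = dp x + 1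
  un : ∀ x y c, c ∈ ch x → c ∈ ch y → x = y

/-- add the child `v` to `p` -/
def ad (ch : N → Finset N) (v p : N) (x : N) : Finset N := if x = p then insert v (ch x) else ch x

variable {ch : N → Finset N} {v : N} {dp : N → ℕ}

theorem Anc.dp_le (h : KS ch v dp) {p x : N} (hx : Anc ch p x) : dp x ≤ dp p ∧ (x = p ∨ dp x < dp p) := by
  induction hx with
  | refl => exact ⟨le_rfl, Or.inl rfl⟩
  | step hc hm ih =>
    have := h.dp _ _ hm
    exact ⟨by omega, Or.inr (by omega)⟩

theorem Anc.uniq (h : KS ch v dp) {p x y : N} (hx : Anc ch p x) (hy : Anc ch p y)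
    (he : dp x = dp y) : x = y := by
  induction hx generalizing y with
  | refl =>
    rcases (hy.dp_le h).2 with g | g
    · exact g.symm
    · omega
  | step hc hm ih =>
    have h1 := h.dp _ _ hm
    have h2 := (hc.dp_le h).1
    cases hy with
    | refl => omega
    | step hc' hm' =>
      have h3 := h.dp _ _ hm'
      have := ih hc' (by omega)
      subst this
      exact h.un _ _ _ hm hm'

theorem Anc.child (h : KS ch v dp) {p x : N} (hx : Anc ch p x) (hne : x ≠ p) :
    ∃ c ∈ ch x, Anc ch p c ∧ ∀ c' ∈ ch x, c' ≠ c → ¬ Anc ch p c' := by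
  cases hx with
  | refl => exact absurd rfl hne
  | step hc hm =>
    refine ⟨_, hm, hc, fun c' hc' hn ha => hn ?_⟩
    exact ha.uniq h hc (by rw [h.dp _ _ hm, h.dp _ _ hc'])

theorem code_off (h : KS ch v dp) {p : N} {mk : N → ℕ} (hmk : ∀ x, x ≠ v → mk x = 0) :
    ∀ n x, x ≠ v → ¬ Anc ch p x → code (ad ch v p) mk n x = code ch (fun _ => 0) n x := by
  intro n
  induction n with
  | zero => intro x _ _; rfl
  | succ n ih =>
    intro x hx ha
    rw [code_succ_inj]
    refine ⟨hmk x hx, ?_⟩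
    have hxp : x ≠ p := by rintro rfl; exact ha Anc.refl
    rw [ad, if_neg hxp]
    refine Multiset.map_congr rfl (fun c hc => ih c ?_ ?_)
    · rintro rfl; exact h.nv _ hc
    · exact fun h' => ha (Anc.step h' hc)

theorem map_split {s : Finset N} {c : N} (hc : c ∈ s) (f g : N → ℕ)
    (hfg : ∀ c' ∈ s, c' ≠ c → f c' = g c') :
    s.val.map f = f c ::ₘ (s.erase c).val.map g := by
  have : s.val = c ::ₘ (s.erase c).val := by
    rw [Finset.erase_val, Multiset.cons_erase hc]
  rw [this, Multiset.map_cons]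
  congr 1
  refine Multiset.map_congr rfl (fun c' hc' => ?_)
  have := Finset.mem_erase.1 (Finset.mem_def.2 hc')
  exact hfg c' this.2 this.1

theorem ms_lemma {a a' b b' : ℕ} {X Y : Multiset ℕ} (h1 : a ::ₘ X = a' ::ₘ Y)
    (h2 : b ::ₘ X = b' ::ₘ Y) (hab : b ≠ a) : a = a' ∧ b = b' := by
  by_cases hb : b = b'
  · subst hb
    have := Multiset.cons_inj_right b |>.1 h2
    subst this
    exact ⟨(Multiset.cons_inj_left X).1 h1, rfl⟩
  · exfalso
    have c1 := congrArg (Multiset.count b) h1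
    have c2 := congrArg (Multiset.count b) h2
    rw [Multiset.count_cons, Multiset.count_cons, if_neg hab] at c1
    rw [Multiset.count_cons, Multiset.count_cons, if_pos rfl, if_neg hb] at c2
    omega

theorem map_anc (h : KS ch v dp) {p x : N} (hx : Anc ch p x) (hne : x ≠ p)
    {mk : N → ℕ} (hmk : ∀ x, x ≠ v → mk x = 0) :
    ∃ c ∈ ch x, Anc ch p c ∧ ∀ n, 
      (ad ch v p x).val.map (code (ad ch v p) mk n) = code (ad ch v p) mk n c ::ₘ
        ((ch x).erase c).val.map (code ch (fun _ => 0) n) := by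
  obtain ⟨c, hc, hca, hcu⟩ := hx.child h hne
  refine ⟨c, hc, hca, fun n => ?_⟩
  rw [ad, if_neg hne]
  exact map_split hc _ _ (fun c' hc' hn => code_off h hmk n c' (by rintro rfl; exact h.nv _ hc')
    (hcu c' hc' hn))

theorem map_base (h : KS ch v dp) {p : N} (hpv : p ≠ v) 
    {mk : N → ℕ} (hmk : ∀ x, x ≠ v → mk x = 0) (n : ℕ) :
      (ad ch v p p).val.map (code (ad ch v p) mk n) = code (ad ch v p) mk n v ::ₘ
        (ch p).val.map (code ch (fun _ => 0) n) := by
  rw [ad, if_pos rfl, Finset.insert_val_of_notMem (h.nv p), Multiset.map_cons]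
  congr 1
  refine Multiset.map_congr rfl (fun c hc => code_off h hmk n c ?_ ?_)
  · rintro rfl; exact h.nv _ hc
  · intro ha
    have := (ha.dp_le h).1
    have := h.dp _ _ hc
    omega

theorem code_ne (h : KS ch v dp) {p : N} (hpv : p ≠ v) {M : ℕ} (hM : ∀ x, dp x < M) :
    ∀ n x, Anc ch p x → M ≤ n + dp x →
      code (ad ch v p) (fun _ => 0) n x ≠ code ch (fun _ => 0) n x := by
  intro n
  induction n with
  | zero => intro x _ hx; have := hM x; omega
  | succ n ih =>
    intro x ha hx heq
    rw [code_succ_inj] at heq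
    have heq := heq.2
    by_cases hxp : x = p
    · subst hxp
      rw [map_base h hpv (fun _ _ => rfl)] at heq
      have := congrArg Multiset.card heq
      simp at this
    · obtain ⟨c, hc, hca, hcm⟩ := map_anc h ha hxp (mk := fun _ => 0) (fun _ _ => rfl)
      rw [hcm, map_split hc (code ch (fun _ => 0) n) (code ch (fun _ => 0) n) (fun _ _ _ => rfl)]
        at heq
      have := h.dp _ _ hc
      exact ih c hca (by omega) ((Multiset.cons_inj_left _).1 heq)

theorem code_leaf (h : KS ch v dp) {p w : N} (hpv : p ≠ v) (hwv : w ≠ v) (mk : N → ℕ) (n : ℕ) :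
    code (ad ch v p) mk n v = code (ad ch v w) mk n v := by
  cases n with
  | zero => rfl
  | succ n =>
    rw [code_succ_inj, ad, ad, if_neg hpv.symm, if_neg hwv.symm, h.ev]
    simp

theorem code_main (h : KS ch v dp) {p w : N} (hpv : p ≠ v) (hwv : w ≠ v) {M : ℕ}
    (hM : ∀ x, dp x < M) {mk : N → ℕ} (hmk : ∀ x, x ≠ v → mk x = 0) :
    ∀ n x y, Anc ch p x → Anc ch w y → x ≠ v → y ≠ v → M ≤ n + dp x →
      code ch (fun _ => 0) n x = code ch (fun _ => 0) n y →
      code (ad ch v p) (fun _ => 0) n x = code (ad ch v w) (fun _ => 0) n y →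
      code (ad ch v p) mk n x = code (ad ch v w) mk n y := by
  intro n
  induction n with
  | zero => intro x _ _ _ _ _ hx; have := hM x; omega
  | succ n ih =>
    intro x y hx hy hxv hyv hn e1 e2
    rw [code_succ_inj] at e1 e2 ⊢
    refine ⟨by rw [hmk x hxv, hmk y hyv], ?_⟩
    have e1 := e1.2
    have e2 := e2.2
    by_cases hxp : x = p
    · subst hxp
      rw [map_base h hpv (fun _ _ => rfl)] at e2
      by_cases hyw : y = w
      · subst hyw
        rw [map_base h hpv hmk, map_base h hwv hmk, e1, code_leaf h hpv hwv]
      · exfalso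
        obtain ⟨c, hc, hca, hcm⟩ := map_anc h hy hyw (mk := fun _ => 0) (fun _ _ => rfl)
        rw [hcm] at e2
        rw [map_split hc (code ch (fun _ => 0) n) (code ch (fun _ => 0) n) (fun _ _ _ => rfl)] at e1
        have c1 := congrArg Multiset.card e1
        have c2 := congrArg Multiset.card e2
        rw [Multiset.card_cons] at c1
        rw [Multiset.card_cons, Multiset.card_cons] at c2
        omega
    · obtain ⟨c, hc, hca, hcm⟩ := map_anc h hx hxp (mk := fun _ => 0) (fun _ _ => rfl)
      rw [hcm] at e2
      rw [map_split hc (code ch (fun _ => 0) n) (code ch (fun _ => 0) n) (fun _ _ _ => rfl)] at e1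
      by_cases hyw : y = w
      · exfalso
        subst hyw
        rw [map_base h hwv (fun _ _ => rfl)] at e2
        have c1 := congrArg Multiset.card e1
        have c2 := congrArg Multiset.card e2
        rw [Multiset.card_cons] at c1
        rw [Multiset.card_cons, Multiset.card_cons] at c2
        omega
      · obtain ⟨c', hc', hca', hcm'⟩ := map_anc h hy hyw (mk := fun _ => 0) (fun _ _ => rfl)
        rw [hcm'] at e2
        rw [map_split hc' (code ch (fun _ => 0) n) (code ch (fun _ => 0) n) (fun _ _ _ => rfl)] at e1
        have hd := h.dp _ _ hc
        have key := ms_lemma e1 e2 (code_ne h hpv hM n c hca (by omega))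
        obtain ⟨c1, hc1, hca1, hcm1⟩ := map_anc h hx hxp hmk
        obtain ⟨c2, hc2, hca2, hcm2⟩ := map_anc h hy hyw hmk
        have g1 : c1 = c := hca1.uniq h hca (by rw [h.dp _ _ hc1, hd])
        have g2 : c2 = c' := hca2.uniq h hca' (by rw [h.dp _ _ hc2, h.dp _ _ hc'])
        subst g1 g2
        have := ih c1 c2 hca hca' (by rintro rfl; exact h.nv _ hc) (by rintro rfl; exact h.nv _ hc')
          (by omega) key.1 key.2
        rw [hcm1, hcm2, this]
        rw [key.1] at e1
        rw [(Multiset.cons_inj_right _).1 e1]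

theorem exists_match {s : Finset N} : ∀ {t : Finset N} {f g : N → ℕ}, s.val.map f = t.val.map g →
    ∃ i : N → N, (∀ c ∈ s, i c ∈ t ∧ g (i c) = f c) ∧ Set.InjOn i s := by
  induction s using Finset.induction_on with
  | empty => intro t f g _; exact ⟨id, by simp, by simp⟩
  | insert a s ha ih =>
    intro t f g hst
    rw [Finset.insert_val_of_notMem ha, Multiset.map_cons] at hst
    have : f a ∈ t.val.map g := by rw [← hst]; simp
    obtain ⟨b, hb, hgb⟩ := Multiset.mem_map.1 this
    rw [map_split hb g g (fun _ _ _ => rfl), hgb] at hst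
    obtain ⟨i, hi, hinj⟩ := ih ((Multiset.cons_inj_right _).1 hst)
    refine ⟨fun c => if c = a then b else i c, ?_, ?_⟩
    · intro c hc
      by_cases hca : c = a
      · subst hca; simp only [if_true]; exact ⟨hb, hgb⟩
      · simp only [hca, if_false]
        have := hi c ((Finset.mem_insert.1 hc).resolve_left hca)
        exact ⟨Finset.mem_of_mem_erase this.1, this.2⟩
    · intro c hc c' hc' hcc
      have hc := Finset.mem_insert.1 (Finset.mem_coe.1 hc)
      have hc' := Finset.mem_insert.1 (Finset.mem_coe.1 hc')
      have key : ∀ c ∈ s, i c ≠ b := fun c hc => Finset.ne_of_mem_erase (hi c hc).1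
      by_cases h1 : c = a <;> by_cases h2 : c' = a
      · rw [h1, h2]
      · simp only [h1, h2, if_true, if_false] at hcc
        exact absurd hcc.symm (key c' (hc'.resolve_left h2))
      · simp only [h1, h2, if_true, if_false] at hcc
        exact absurd hcc (key c (hc.resolve_left h1))
      · simp only [h1, h2, if_false] at hcc
        exact hinj (hc.resolve_left h1) (hc'.resolve_left h2) hcc

/-- rooted trees through parent maps -/
structure RT (par : N → N) (rt : N) (dp : N → ℕ) : Prop where
  d0 : dp rt = 0
  pr : par rt = rt
  dp : ∀ x, x ≠ rt → dp x = dp (par x) + 1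

variable [Fintype N]
/-- children -/
def chl (par : N → N) (rt x : N) : Finset N := Finset.univ.filter (fun y => y ≠ rt ∧ par y = x)

theorem mem_chl {par : N → N} {rt x y : N} : y ∈ chl par rt x ↔ y ≠ rt ∧ par y = x := by
  simp [chl]

theorem realize {par par' : N → N} {rt : N} {dp dp' : N → ℕ} (h : RT par rt dp)
    (h' : RT par' rt dp') {mk mk' : N → ℕ} {M : ℕ} (hM : ∀ x, dp x < M)
    (hc : code (chl par rt) mk M rt = code (chl par' rt) mk' M rt) :
    ∃ σ : N ≃ N, σ rt = rt ∧ (∀ x, σ (par x) = par' (σ x)) ∧ ∀ x, mk' (σ x) = mk x := by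
  have step : ∀ k, ∃ σ : N → N, σ rt = rt ∧ (∀ x, dp x ≤ k →
      code (chl par rt) mk (M - dp x) x = code (chl par' rt) mk' (M - dp x) (σ x) ∧
      σ (par x) = par' (σ x) ∧ (x ≠ rt → σ x ≠ rt)) ∧
      ∀ x y, dp x ≤ k → dp y ≤ k → σ x = σ y → x = y := by
    intro k
    induction k with
    | zero =>
      have z : ∀ x, dp x ≤ 0 → x = rt := by
        intro x hx
        by_contra hn
        have := h.dp x hn
        omega
      refine ⟨fun _ => rt, rfl, fun x hx => ?_, fun x y hx hy _ => by rw [z x hx, z y hy]⟩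
      rw [z x hx, h.d0]
      exact ⟨hc, h'.pr.symm, fun g => absurd rfl g⟩
    | succ k ih =>
      obtain ⟨σ, h0, h1, h2⟩ := ih
      have pk : ∀ x, dp x ≤ k → ∃ i : N → N, (∀ c ∈ chl par rt x, i c ∈ chl par' rt (σ x) ∧
          code (chl par' rt) mk' (M - dp x - 1) (i c) = code (chl par rt) mk (M - dp x - 1) c) ∧
          Set.InjOn i (chl par rt x) := by
        intro x hx
        have := (h1 x hx).1
        obtain ⟨m, hm⟩ : ∃ m, M - dp x = m + 1 := ⟨M - dp x - 1, by have := hM x; omega⟩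
        rw [hm, code_succ_inj] at this
        rw [hm]
        exact exists_match this.2
      choose! i hi using pk
      have hpar : ∀ x, x ≠ rt → dp x ≤ k + 1 → dp (par x) ≤ k ∧ x ∈ chl par rt (par x) := by
        intro x hx hk
        have := h.dp x hx
        exact ⟨by omega, mem_chl.2 ⟨hx, rfl⟩⟩
      have E : ∀ x, x ≠ rt → dp x ≤ k + 1 → ¬ dp x ≤ k →
          par' (i (par x) x) = σ (par x) ∧ i (par x) x ≠ rt := by
        intro x hx hk _
        obtain ⟨g1, g2⟩ := hpar x hx hk
        have := mem_chl.1 ((hi _ g1).1 x g2).1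
        exact ⟨this.2, this.1⟩
      have root_le : dp rt ≤ k := by rw [h.d0]; omega
      have nrt : ∀ x, ¬ dp x ≤ k → x ≠ rt := by rintro x hx rfl; exact hx root_le
      have parle : ∀ x, dp x ≤ k + 1 → dp (par x) ≤ k := by
        intro x hx
        by_cases hr : x = rt
        · rw [hr, h.pr]; exact root_le
        · exact (hpar x hr hx).1
      have dps : ∀ x, dp x ≤ k → dp' (σ x) = dp x := by
        have : ∀ n x, dp x = n → dp x ≤ k → dp' (σ x) = dp x := by
          intro n
          induction n with
          | zero =>
            intro x hx _
            have : x = rt := by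
              by_contra hn
              have := h.dp x hn
              omega
            rw [this, h0, h.d0, h'.d0]
          | succ n ihn =>
            intro x hx hk
            have hr : x ≠ rt := by rintro rfl; rw [h.d0] at hx; omega
            have a1 := h.dp x hr
            have a2 := h'.dp (σ x) ((h1 x hk).2.2 hr)
            rw [← (h1 x hk).2.1, ihn (par x) (by omega) (by omega)] at a2
            omega
        exact fun x => this _ x rfl
      refine ⟨fun x => if dp x ≤ k then σ x else i (par x) x, ?_, ?_, ?_⟩
      · simp only [root_le, if_true]; exact h0
      · intro x hx
        simp only [parle x hx, if_true]
        by_cases hk : dp x ≤ k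
        · simp only [hk, if_true]; exact h1 x hk
        · simp only [hk, if_false]
          have hr := nrt x hk
          obtain ⟨g1, g2⟩ := hpar x hr hx
          have e := E x hr hx hk
          refine ⟨?_, e.1.symm, fun _ => e.2⟩
          have := ((hi _ g1).1 x g2).2
          have e2 : M - dp (par x) - 1 = M - dp x := by have := h.dp x hr; omega
          rw [e2] at this
          exact this.symm
      · intro x y hx hy hxy
        have dpx : ∀ x, dp x ≤ k + 1 → ¬ dp x ≤ k → dp' (i (par x) x) = k + 1 := by
          intro x hx hk
          have hr := nrt x hk
          obtain ⟨g1, g2⟩ := hpar x hr hx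
          have e := E x hr hx hk
          have a1 := h.dp x hr
          have a2 := h'.dp _ e.2
          rw [e.1, dps _ g1] at a2
          omega
        by_cases hkx : dp x ≤ k <;> by_cases hky : dp y ≤ k <;>
          simp only [hkx, hky, if_true, if_false] at hxy
        · exact h2 x y hkx hky hxy
        · have := dpx y hy hky
          rw [← hxy, dps x hkx] at this
          omega
        · have := dpx x hx hkx
          rw [hxy, dps y hky] at this
          omega
        · obtain ⟨g1, g2⟩ := hpar x (nrt x hkx) hx
          obtain ⟨g1', g2'⟩ := hpar y (nrt y hky) hy
          have e1 := (E x (nrt x hkx) hx hkx).1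
          have e2 := (E y (nrt y hky) hy hky).1
          rw [hxy, e2] at e1
          have e3 := h2 _ _ g1' g1 e1
          rw [e3] at g2' hxy
          exact (hi _ g1).2 g2 g2' hxy
  obtain ⟨σ, h0, h1, h2⟩ := step M
  have hinj : Function.Injective σ := fun x y hxy => h2 x y (hM x).le (hM y).le hxy
  refine ⟨Equiv.ofBijective σ (Finite.injective_iff_bijective.1 hinj), h0,
    fun x => (h1 x (hM x).le).2.1, fun x => ?_⟩
  have := (h1 x (hM x).le).1
  obtain ⟨m, hm⟩ : ∃ m, M - dp x = m + 1 := ⟨M - dp x - 1, by have := hM x; omega⟩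
  rw [hm, code_succ_inj] at this
  exact this.1.symm

theorem Anc.root {par : N → N} {rt v : N} {dp : N → ℕ} (h : RT par rt dp) 
    (hv : ∀ x, x ≠ rt → par x ≠ v) (chK : N → Finset N)
    (hK : ∀ x y, y ∈ chK x ↔ y ≠ rt ∧ y ≠ v ∧ par y = x) (p : N) (hpv : p ≠ v) (hvr : v ≠ rt) :
    Anc chK p rt := by
  have : ∀ n x, dp x = n → x ≠ v → Anc chK p x → Anc chK p rt := by
    intro n
    induction n with
    | zero =>
      intro x hx _ ha
      have : x = rt := by
        by_contra hn
        have := h.dp x hn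
        omega
      exact this ▸ ha
    | succ n ih =>
      intro x hx hxv ha
      have hr : x ≠ rt := by rintro rfl; rw [h.d0] at hx; omega
      have := h.dp x hr
      exact ih (par x) (by omega) (hv x hr) (Anc.step ha ((hK _ _).2 ⟨hr, hxv, rfl⟩))
  exact this _ p rfl hpv Anc.refl

/-- rooted version of the absence of pseudosimilar end vertices -/
theorem rooted_fix {par : N → N} {rt v w : N} {dp : N → ℕ} (h : RT par rt dp)
    (hv : ∀ x, x ≠ rt → par x ≠ v) (hvr : v ≠ rt) (hw : w ≠ v) (θ : N ≃ N) (hθr : θ rt = rt)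
    (hθ : ∀ x, θ (par x) = Function.update par v w (θ x)) :
    ∃ σ : N ≃ N, σ rt = rt ∧ σ v = v ∧ ∀ x, σ (par x) = Function.update par v w (σ x) := by
  set par' := Function.update par v w with hpar'
  have hp'v : par' v = w := by simp [hpar']
  have hp' : ∀ x, x ≠ v → par' x = par x := fun x hx => by simp [hpar', hx]
  set p := par v with hp
  have hpv : p ≠ v := hv v hvr
  have h' : RT par' rt (Function.update dp v (dp w + 1)) := by
    refine ⟨?_, ?_, ?_⟩
    · simp [hvr.symm, h.d0]
    · rw [hp' _ hvr.symm, h.pr]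
    · intro x hx
      by_cases hxv : x = v
      · subst hxv; simp [hp'v, hw]
      · rw [hp' _ hxv]; simp [hxv, hv x hx, h.dp x hx]
  obtain ⟨M, hM⟩ : ∃ M, ∀ x, dp x < M :=
    ⟨Finset.univ.sup dp + 1, fun x => Nat.lt_succ_of_le (Finset.le_sup (Finset.mem_univ x))⟩
  set chK : N → Finset N := fun x => (chl par rt x).erase v with hchK
  have hKm : ∀ x y, y ∈ chK x ↔ y ≠ rt ∧ y ≠ v ∧ par y = x := by
    intro x y
    simp only [hchK, Finset.mem_erase, mem_chl]
    tauto
  have ks : KS chK v dp := by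
    refine ⟨fun x hx => ((hKm _ _).1 hx).2.1 rfl, ?_, ?_, ?_⟩
    · ext y
      rw [hKm]
      simp only [Finset.notMem_empty, iff_false]
      rintro ⟨h1, h2, h3⟩
      exact hv y h1 h3
    · intro x c hc
      obtain ⟨h1, h2, h3⟩ := (hKm _ _).1 hc
      rw [h.dp c h1, h3]
    · intro x y c hc hc'
      rw [← ((hKm _ _).1 hc).2.2, ← ((hKm _ _).1 hc').2.2]
  have e1 : chl par rt = ad chK v p := by
    funext x
    ext y
    unfold ad
    by_cases hx : x = p
    · rw [if_pos hx, Finset.mem_insert, hKm, mem_chl]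
      by_cases hy : y = v
      · subst hy; simp [hvr, hx, hp]
      · simp [hy]
    · rw [if_neg hx, hKm, mem_chl]
      by_cases hy : y = v
      · subst hy; simp; exact fun _ g => hx g.symm
      · simp [hy]
  have e2 : chl par' rt = ad chK v w := by
    funext x
    ext y
    unfold ad
    by_cases hx : x = w
    · rw [if_pos hx, Finset.mem_insert, hKm, mem_chl]
      by_cases hy : y = v
      · subst hy; simp [hvr, hx, hp'v]
      · simp [hy, hp' y hy]
    · rw [if_neg hx, hKm, mem_chl]
      by_cases hy : y = v
      · subst hy; simp [hp'v]; exact fun _ g => hx g.symm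
      · simp [hy, hp' y hy]
  have hθr' : ∀ x, θ x = rt ↔ x = rt := fun x => by
    constructor
    · intro g; exact θ.injective (g.trans hθr.symm)
    · rintro rfl; exact hθr
  have tr := code_transport (ch := chl par rt) (ch' := chl par' rt) (mk := fun _ => 0)
    (mk' := fun _ => 0) θ (by
      intro x
      ext y
      rw [mem_chl, Finset.mem_map_equiv, mem_chl]
      have := hθ (θ.symm y)
      rw [Equiv.apply_symm_apply] at this
      rw [← this, θ.apply_eq_iff_eq]
      have h3 : y = rt ↔ θ.symm y = rt := by rw [← hθr' (θ.symm y), Equiv.apply_symm_apply]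
      rw [ne_eq, h3]) (fun _ => rfl) M rt
  rw [hθr, e1, e2] at tr
  have main := code_main ks hpv hw hM (mk := fun x => if x = v then 1 else 0)
    (fun x hx => by simp [hx]) M rt rt (Anc.root h hv chK hKm p hpv hvr)
    (Anc.root h hv chK hKm w hw hvr) hvr.symm hvr.symm (by omega) rfl tr.symm
  rw [← e1, ← e2] at main
  obtain ⟨σ, s1, s2, s3⟩ := realize h h' hM main
  refine ⟨σ, s1, ?_, s2⟩
  have := s3 v
  simp only [if_true] at this
  by_contra hn
  rw [if_neg hn] at this
  omega

end
end

section

section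
variable {V W : Type} [Fintype V] [Fintype W] {d : V → V → ℕ} {e : W → W → ℕ}

theorem ecc_conv (h : TM d) {x y z : V} (h1 : d x z = 1) (h2 : d z y + 1 = d x y) :
    ecc d z + 1 ≤ ecc d x ∨ ecc d z + d x y ≤ ecc d y + 1 := by
  obtain ⟨f, hf⟩ := exists_ecc (d := d) z
  have f4 := h.four z f x y
  have e1 := le_ecc (d := d) x f
  have e2 := le_ecc (d := d) y f
  rw [h.symm z x, h.symm f y, h.symm f x] at f4
  omega

/-- `par` is the parent map towards the centre, `r` is the radius -/
structure CP {V : Type} [Fintype V] (d : V → V → ℕ) (r : ℕ) (par : Option V → Option V) : Prop where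
  le : ∀ x, r ≤ ecc d x
  root : ∀ x, ecc d x = r → par (some x) = none
  up : ∀ x, ecc d x ≠ r → ∃ y, par (some x) = some y ∧ d x y = 1 ∧ ecc d y + 1 = ecc d x

theorem CP.adj (h : TM d) {r : ℕ} {par : Option V → Option V} (c : CP d r par) (x y : V) :
    d x y = 1 ↔ par (some x) = some y ∨ par (some y) = some x ∨
      (par (some x) = none ∧ par (some y) = none ∧ x ≠ y) := by
  constructor
  · intro hxy
    have s := h.symm x y
    have l1 := h.ecc_lip x y
    have l2 := h.ecc_lip y x
    have upx : ∀ x y, d x y = 1 → ecc d x ≠ r → ecc d y ≤ ecc d x → par (some x) = some y := by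
      intro x y hxy hx hy
      obtain ⟨z, hz, hz1, hz2⟩ := c.up x hx
      rw [hz, h.up_unique hxy hz1 hy (by omega)]
    have ne : x ≠ y := by rintro rfl; rw [h.self] at hxy; omega
    by_cases hx : ecc d x = r
    · by_cases hy : ecc d y = r
      · exact Or.inr (Or.inr ⟨c.root x hx, c.root y hy, ne⟩)
      · right; left
        exact upx y x (by omega) hy (by have := c.le y; omega)
    · by_cases hle : ecc d y ≤ ecc d x
      · exact Or.inl (upx x y hxy hx hle)
      · right; left
        exact upx y x (by omega) (by have := c.le x; omega) (by omega)
  · have nn : ∀ x, par (some x) = none → ecc d x = r := by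
      intro x hx
      by_contra hn
      obtain ⟨z, hz, _⟩ := c.up x hn
      rw [hx] at hz
      cases hz
    have ss : ∀ x y, par (some x) = some y → d x y = 1 := by
      intro x y hx
      by_cases hr : ecc d x = r
      · rw [c.root x hr] at hx; cases hx
      · obtain ⟨z, hz, hz1, _⟩ := c.up x hr
        rw [hx] at hz
        cases hz
        exact hz1
    rintro (g | g | ⟨g1, g2, g3⟩)
    · exact ss _ _ g
    · rw [h.symm]; exact ss _ _ g
    · have e1 := nn _ g1
      have e2 := nn _ g2
      obtain ⟨z, hz1, hz2⟩ := h.geo x y g3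
      have := c.le z
      have := h.pos g3
      rcases ecc_conv h hz1 hz2 with t | t <;> omega

theorem exists_CP (h : TM d) [Nonempty V] : ∃ r par, CP d r par ∧ par none = none := by
  obtain ⟨c, hc⟩ := Finite.exists_min (ecc d)
  have up : ∀ x, ecc d x ≠ ecc d c → ∃ y, d x y = 1 ∧ ecc d y + 1 = ecc d x := by
    intro x hx
    have hxc : x ≠ c := by rintro rfl; exact hx rfl
    obtain ⟨z, hz1, hz2⟩ := h.geo x c hxc
    have := hc x
    have := h.pos hxc
    have := h.ecc_lip x z
    refine ⟨z, hz1, ?_⟩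
    rcases ecc_conv h hz1 hz2 with t | t <;> omega
  choose! u hu using up
  refine ⟨ecc d c, fun o => o.elim none (fun x => if ecc d x = ecc d c then none else some (u x)),
    ⟨hc, fun x hx => by simp [hx], fun x hx => ⟨u x, by simp [hx], hu x hx⟩⟩, rfl⟩

theorem ecc_fix (h : TM d) (hlam : 3 ≤ lam d) {v p w : V} (hl : Leaf d v p) (hw : w ≠ v)
    (hI : Isom d (mvd d v w)) (he : ∀ u, u ≠ v → ecc (mvd d v w) u = ecc d u)
    (hev : ecc (mvd d v w) v = ecc d w + 1) :
    ∃ σ : V ≃ V, σ v = v ∧ ∀ x y, mvd d v w (σ x) (σ y) = d x y := by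
  classical
  have h' := mvd_TM h hl hw
  have hl' := mvd_leaf h hw
  have ev := h.leaf_ecc hl (lam_ex hlam v p)
  haveI : Nonempty V := ⟨v⟩
  obtain ⟨r, par, c, hn⟩ := exists_CP h
  obtain ⟨θ, hθ⟩ := hI
  have eθ := fun x => ecc_isom θ hθ x
  have hvr : ecc d v ≠ r := by have := c.le p; omega
  have parv : par (some v) = some p := by
    obtain ⟨y, hy, hy1, _⟩ := c.up v hvr
    rw [hy, h.leaf_nbr_unique hl hy1]
  have c' : CP (mvd d v w) r (Function.update par (some v) (some w)) := by
    refine ⟨?_, ?_, ?_⟩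
    · intro x
      by_cases hx : x = v
      · rw [hx, hev]; have := c.le w; omega
      · rw [he x hx]; exact c.le x
    · intro x hx
      by_cases hxv : x = v
      · rw [hxv, hev] at hx; have := c.le w; omega
      · rw [he x hxv] at hx
        simp [hxv, c.root x hx]
    · intro x hx
      by_cases hxv : x = v
      · subst hxv
        refine ⟨w, by simp, h'.leaf_nbr hl', ?_⟩
        rw [he w hw, hev]
      · rw [he x hxv] at hx ⊢
        obtain ⟨y, hy, hy1, hy2⟩ := c.up x hx
        have hyv : y ≠ v := by
          rintro rfl
          have := h.leaf_nbr_unique hl (q := x) (by rw [h.symm]; exact hy1)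
          subst this
          omega
        refine ⟨y, by simp [hxv, hy], by rw [mvd_ne h hxv hyv]; exact hy1, ?_⟩
        rw [he y hyv]; exact hy2
  have rt : RT par none (fun o => o.elim 0 (fun x => ecc d x - r + 1)) := by
    refine ⟨rfl, hn, ?_⟩
    intro x hx
    cases x with
    | none => exact absurd rfl hx
    | some x =>
      by_cases hr : ecc d x = r
      · rw [c.root x hr]; simp [hr]
      · obtain ⟨y, hy, hy1, hy2⟩ := c.up x hr
        rw [hy]
        have := c.le y
        simp only [Option.elim]
        omega
  obtain ⟨σ, s0, s1, s2⟩ := rooted_fix rt (v := some v) (w := some w) (by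
      intro x hx hxv
      cases x with
      | none => exact hx rfl
      | some x =>
        by_cases hr : ecc d x = r
        · rw [c.root x hr] at hxv; cases hxv
        · obtain ⟨y, hy, hy1, hy2⟩ := c.up x hr
          rw [hy] at hxv
          cases hxv
          have := h.leaf_nbr_unique hl (q := x) (by rw [h.symm]; exact hy1)
          subst this
          omega) (by simp) (by simpa using hw) (Equiv.optionCongr θ) (by simp) (by
      intro x
      cases x with
      | none => simp [hn]
      | some x =>
        by_cases hr : ecc d x = r
        · rw [c.root x hr]
          simp only [Equiv.optionCongr_apply, Option.map_none, Option.map_some]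
          exact (c'.root (θ x) (by rw [eθ, hr])).symm
        · obtain ⟨y, hy, hy1, hy2⟩ := c.up x hr
          obtain ⟨z, hz, hz1, hz2⟩ := c'.up (θ x) (by rw [eθ]; exact hr)
          rw [hy]
          simp only [Equiv.optionCongr_apply, Option.map_some]
          rw [hz]
          have := h'.up_unique (x := θ x) (y := θ y) (z := z) (by rw [hθ]; exact hy1) hz1
            (by rw [eθ, eθ]; omega) (by omega)
          rw [this])
  have sN : ∀ x : V, ∃ y, σ (some x) = some y := by
    intro x
    cases hx : σ (some x) with
    | none => rw [← s0] at hx; cases σ.injective hx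
    | some y => exact ⟨y, rfl⟩
  have hr : ∀ x, some (Equiv.removeNone σ x) = σ (some x) := fun x => Equiv.removeNone_some σ (sN x)
  refine ⟨Equiv.removeNone σ, ?_, ?_⟩
  · have := hr v
    rw [s1] at this
    exact Option.some.inj this
  · apply TM.isom_of_adj h h'
    intro x y
    have k0 : ∀ o, σ o = none ↔ o = none := fun o => by
      constructor
      · intro g; exact σ.injective (g.trans s0.symm)
      · rintro rfl; exact s0
    rw [c'.adj h', c.adj h, hr, hr, ← s2, ← s2, k0, k0, σ.apply_eq_iff_eq, σ.apply_eq_iff_eq,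
      ne_eq, (Equiv.removeNone σ).apply_eq_iff_eq]

/-- no pseudosimilar end vertices -/
theorem leaf_fix (h : TM d) (hlam : 3 ≤ lam d) {v p w : V} (hl : Leaf d v p) (hw : w ≠ v)
    (hI : Isom d (mvd d v w)) :
    ∃ σ : V ≃ V, σ v = v ∧ ∀ x y, mvd d v w (σ x) (σ y) = d x y := by
  have h' := mvd_TM h hl hw
  obtain ⟨θ, hθ⟩ := hI
  have hd := dia_isom θ hθ
  by_cases hc : NC d v ∨ ecc d w + 1 ≤ dia d
  · obtain ⟨m1, m2, _⟩ := ecc_move h hl hw hd hc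
    exact ecc_fix h hlam hl hw ⟨θ, hθ⟩ m1 m2
  push Not at hc
  obtain ⟨hnc, hew⟩ := hc
  have hew : ecc d w = dia d := by have := ecc_le_dia (d := d) w; omega
  by_cases hf : θ v = v
  · exact ⟨θ, hf, hθ⟩
  exfalso
  -- diametral pairs of `d` contain `v`
  have cv : ∀ x y, d x y = dia d → x = v ∨ y = v := by
    intro x y hxy
    by_contra hn
    push Not at hn
    exact hnc ⟨x, y, hn.1, hn.2, hxy⟩
  have cv' : ∀ x y, mvd d v w x y = dia d → x = v ∨ y = v := by
    intro x y hxy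
    by_contra hn
    push Not at hn
    rw [mvd_ne h hn.1 hn.2] at hxy
    exact hnc ⟨x, y, hn.1, hn.2, hxy⟩
  obtain ⟨f, hf1⟩ := exists_ecc (d := d) w
  have hwv : d w v = dia d := by
    rcases cv w f (by omega) with g | g
    · exact absurd g hw
    · subst g; omega
  have hθw : θ w = v := by
    rcases cv' (θ w) (θ v) (by rw [hθ]; exact hwv) with g | g
    · exact g
    · exact absurd g hf
  have hwp : d w v = d w p + 1 := by rw [h.symm w v, hl.2 w hw, h.symm p w]
  have hpair : mvd d v w v p = dia d := by
    rw [mvd_left hl.1.symm]; omega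
  have hθv : θ v = p := by
    have e1 := hθ (θ.symm v) (θ.symm p)
    rw [θ.apply_symm_apply, θ.apply_symm_apply, hpair] at e1
    rcases cv _ _ e1.symm with g | g
    · rw [Equiv.symm_apply_eq] at g; exact absurd g.symm hf
    · rw [Equiv.symm_apply_eq] at g; exact g.symm
  have mv1 : ∀ x, x ≠ w → θ x ≠ v := fun x hx g => hx (θ.injective (g.trans hθw.symm))
  have st1 : ∀ x, x ≠ w → d (θ x) v = d x v + 1 := by
    intro x hx
    have e1 := hθ x v
    rw [hθv, mvd_ne h (mv1 x hx) hl.1.symm] at e1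
    rw [h.symm (θ x) v, hl.2 _ (mv1 x hx), h.symm p]
    omega
  have st2 : ∀ x, x ≠ w → d (θ x) w + 1 = d x w := by
    intro x hx
    have e1 := hθ x w
    rw [hθw, mvd_right (mv1 x hx)] at e1
    exact e1
  have ex : ∀ n x, dia d - d x v = n → d x v + d x w = dia d := by
    intro n
    induction n with
    | zero =>
      intro x hx
      have := le_dia (d := d) x v
      by_cases hxw : x = w
      · rw [hxw, h.self]; omega
      · have := st1 x hxw
        have := le_dia (d := d) (θ x) v
        omega
    | succ n ih =>
      intro x hx
      by_cases hxw : x = w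
      · rw [hxw, h.self]; omega
      · have a1 := st1 x hxw
        have a2 := st2 x hxw
        have := ih (θ x) (by omega)
        omega
  obtain ⟨g, hg, hgv, hgw⟩ := lam_three hlam v w
  have := gromov_pos h hg hgv hgw
  have := ex _ g rfl
  have := h.symm v w
  omega

end
end

section

section
variable {A B A' B' : Type}

/-- two graphs joined by the edge `ab` -/
def J (G : SimpleGraph A) (H : SimpleGraph B) (a : A) (b : B) : SimpleGraph (A ⊕ B) where
  Adj x y := match x, y with
    | Sum.inl x, Sum.inl y => G.Adj x y
    | Sum.inr x, Sum.inr y => H.Adj x y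
    | Sum.inl x, Sum.inr y => x = a ∧ y = b
    | Sum.inr y, Sum.inl x => x = a ∧ y = b
  symm := ⟨fun x y h => by
    cases x <;> cases y
    · exact SimpleGraph.Adj.symm (G := G) h
    · exact h
    · exact h
    · exact SimpleGraph.Adj.symm (G := H) h⟩
  loopless := ⟨fun x h => by
    cases x
    · exact G.irrefl h
    · exact H.irrefl h⟩

variable {G : SimpleGraph A} {H : SimpleGraph B} {a : A} {b : B}
  {X : SimpleGraph A'} {Y : SimpleGraph B'} {g : A'} {h : B'}

theorem J_ll {x y : A} : (J G H a b).Adj (Sum.inl x) (Sum.inl y) ↔ G.Adj x y := Iff.rfl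
theorem J_rr {x y : B} : (J G H a b).Adj (Sum.inr x) (Sum.inr y) ↔ H.Adj x y := Iff.rfl
theorem J_lr {x : A} {y : B} : (J G H a b).Adj (Sum.inl x) (Sum.inr y) ↔ x = a ∧ y = b := Iff.rfl
theorem J_rl {x : A} {y : B} : (J G H a b).Adj (Sum.inr y) (Sum.inl x) ↔ x = a ∧ y = b := Iff.rfl

/-- swapping the sides -/
def J_swap (G : SimpleGraph A) (H : SimpleGraph B) (a : A) (b : B) : J G H a b ≃g J H G b a where
  toEquiv := Equiv.sumComm A B
  map_rel_iff' := by
    intro x y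
    cases x <;> cases y <;> simp [J_ll, J_rr, J_lr, J_rl, and_comm]

theorem J_congr (κ : X ≃g G) (μ : Y ≃g H) (hg : κ g = a) (hh : μ h = b) :
    Nonempty (J X Y g h ≃g J G H a b) := by
  refine ⟨⟨Equiv.sumCongr κ.toEquiv μ.toEquiv, ?_⟩⟩
  intro x y
  have k : ∀ x, κ x = a ↔ x = g := fun x => by rw [← hg]; exact κ.injective.eq_iff
  have l : ∀ x, μ x = b ↔ x = h := fun x => by rw [← hh]; exact μ.injective.eq_iff
  cases x <;> cases y
  · exact κ.map_adj_iff
  · simp [J_lr, k, l]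
  · simp [J_rl, k, l]
  · exact μ.map_adj_iff

theorem MT.conn {G : SimpleGraph A} {d : A → A → ℕ} (h : MT G d) (S : A → Prop)
    (hS : ∀ x y, G.Adj x y → S x → S y) {x : A} (hx : S x) (y : A) : S y := by
  have : ∀ n x, d x y = n → S x → S y := by
    intro n
    induction n with
    | zero => intro x hn hx; exact h.tm.eq x y hn ▸ hx
    | succ n ih =>
      intro x hn hx
      have hne : x ≠ y := by rintro rfl; rw [h.tm.self] at hn; omega
      obtain ⟨z, hz1, hz2⟩ := h.tm.geo x y hne
      exact ih z (by omega) (hS x z ((h.adj _ _).2 hz1) hx)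
  exact this _ x rfl hx

theorem MT.conn_leaf {G : SimpleGraph A} {d : A → A → ℕ} (h : MT G d) {v p : A} (hl : Leaf d v p)
    (S : A → Prop) (hS : ∀ x y, x ≠ v → y ≠ v → G.Adj x y → S x → S y) {x : A} (hxv : x ≠ v)
    (hx : S x) (y : A) (hy : y ≠ v) : S y := by
  have : ∀ n x, x ≠ v → d x y = n → S x → S y := by
    intro n
    induction n with
    | zero => intro x _ hn hx; exact h.tm.eq x y hn ▸ hx
    | succ n ih =>
      intro x hxv hn hx
      have hne : x ≠ y := by rintro rfl; rw [h.tm.self] at hn; omega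
      obtain ⟨z, hz, hz1, hz2⟩ := h.tm.geo_ne hl x y hxv hy hne
      exact ih z hz (by omega) (hS x z hxv hz ((h.adj _ _).2 hz1) hx)
  exact this _ x hxv rfl hx

theorem MT.conn_iff {G : SimpleGraph A} {d : A → A → ℕ} (h : MT G d) (S : A → Prop)
    (hS : ∀ x y, G.Adj x y → S x → S y) : (∀ x, S x) ∨ ∀ x, ¬ S x := by
  by_cases g : ∃ x, S x
  · obtain ⟨x, hx⟩ := g; exact Or.inl (h.conn S hS hx)
  · exact Or.inr (fun x hx => g ⟨x, hx⟩)

theorem MT.conn_leaf_iff {G : SimpleGraph A} {d : A → A → ℕ} (h : MT G d) {v p : A}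
    (hl : Leaf d v p) (S : A → Prop) (hS : ∀ x y, x ≠ v → y ≠ v → G.Adj x y → S x → S y) :
    (∀ x, x ≠ v → S x) ∨ ∀ x, x ≠ v → ¬ S x := by
  by_cases g : ∃ x, x ≠ v ∧ S x
  · obtain ⟨x, hxv, hx⟩ := g; exact Or.inl (h.conn_leaf hl S hS hxv hx)
  · exact Or.inr (fun x hxv hx => g ⟨x, hxv, hx⟩)

variable [Fintype A] [Fintype B]

theorem MT.adj_leaf {G : SimpleGraph A} {d : A → A → ℕ} (h : MT G d) {v p : A} (hl : Leaf d v p)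
    (x : A) : G.Adj v x ↔ x = p := by
  rw [h.adj]
  constructor
  · exact fun g => h.tm.leaf_nbr_unique hl g
  · rintro rfl; exact h.tm.leaf_nbr hl

theorem fin_closed {m : ℕ} (hA : Fintype.card A = m) (hB : Fintype.card B = m)
    (F : Finset (A ⊕ B)) (hF : F.card = m)
    (hβ : (∀ y, Sum.inr y ∈ F) ∨ (∀ y, Sum.inr y ∉ F)) :
    ((∀ x, Sum.inl x ∈ F) ∧ ∀ y, Sum.inr y ∉ F) ∨ ((∀ x, Sum.inl x ∉ F) ∧ ∀ y, Sum.inr y ∈ F) := by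
  classical
  have hc := Finset.card_toLeft_add_card_toRight (u := F)
  have hL : F.toLeft.card ≤ m := hA ▸ Finset.card_le_univ _
  rcases hβ with hβ | hβ
  · right
    have : F.toRight = Finset.univ := by ext y; simp [hβ]
    rw [this, Finset.card_univ, hB] at hc
    have : F.toLeft = ∅ := Finset.card_eq_zero.1 (by omega)
    exact ⟨fun x hx => by
      have : x ∈ F.toLeft := by simpa using hx
      simp_all, hβ⟩
  · left
    have : F.toRight = ∅ := by ext y; simp [hβ]
    rw [this, Finset.card_empty] at hc
    have : F.toLeft = Finset.univ := (Finset.card_eq_iff_eq_univ _).1 (by omega)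
    exact ⟨fun x => by
      have : x ∈ F.toLeft := by simp [this]
      simpa using this, hβ⟩

end
end

section

section
/-- the inner property in the definition of `ern` -/
def Good {V : Type} (G : SimpleGraph V) (s : Finset (Sym2 V)) : Prop :=
    ∀ (W : Type) (_ : Fintype W) (H : SimpleGraph W) (t : Finset (Sym2 W)),
      (↑t : Set (Sym2 W)) ⊆ H.edgeSet →
      (∃ φ : {e // e ∈ s} ≃ {f // f ∈ t},
        ∀ e : {e // e ∈ s},
          Nonempty (H.deleteEdges {(φ e).1} ≃g G.deleteEdges {e.1})) →
      Nonempty (H ≃g G)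

/-- `χ` is an isomorphism of edge-cards -/
def CardIso {U U' : Type} (P : SimpleGraph U) (e : Sym2 U) (Q : SimpleGraph U') (f : Sym2 U')
    (χ : U' ≃ U) : Prop :=
  ∀ x y, (P.Adj (χ x) (χ y) ∧ s(χ x, χ y) ≠ e) ↔ (Q.Adj x y ∧ s(x, y) ≠ f)

variable {A B : Type} [Fintype A] [Fintype B]
variable {G : SimpleGraph A} {H : SimpleGraph B} {a : A} {b : B}
variable {dG : A → A → ℕ} {dH : B → B → ℕ}

theorem bad_extract (hH : MT H dH) {m : ℕ} (hA : Fintype.card A = m)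
    (hB : Fintype.card B = m) {v p : A}
    (hb : ∀ s : Finset (Sym2 (A ⊕ B)), (∀ e, e ∈ s ↔ e = s(Sum.inl a, Sum.inr b) ∨
      e = s(Sum.inl v, Sum.inl p)) → ¬ Good (J G H a b) s) :
    ∃ (g : A) (h : B) (f : Sym2 (A ⊕ B)) (χ : A ⊕ B ≃ A ⊕ B),
      f ∈ (J G H g h).edgeSet ∧ f ≠ s(Sum.inl g, Sum.inr h) ∧
      CardIso (J G H a b) s(Sum.inl v, Sum.inl p) (J G H g h) f χ ∧
      ¬ Nonempty (J G H g h ≃g J G H a b) := by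
  classical
  obtain ⟨s₀, hs₀⟩ : ∃ s : Finset (Sym2 (A ⊕ B)), ∀ e, e ∈ s ↔ e = s(Sum.inl a, Sum.inr b) ∨
      e = s(Sum.inl v, Sum.inl p) := ⟨{s(Sum.inl a, Sum.inr b), s(Sum.inl v, Sum.inl p)}, by simp⟩
  have hb := hb s₀ hs₀
  unfold Good at hb
  push Not at hb
  obtain ⟨W, iW, K, t, ht, ⟨φ, hφ⟩, hn⟩ := hb
  let e1 : {e // e ∈ s₀} := ⟨s(Sum.inl a, Sum.inr b), by simp [hs₀]⟩
  let e2 : {e // e ∈ s₀} := ⟨s(Sum.inl v, Sum.inl p), by simp [hs₀]⟩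
  have he12 : e1 ≠ e2 := by
    intro h
    have := congrArg Subtype.val h
    simp [e1, e2] at this
  obtain ⟨ψ⟩ := hφ e1
  obtain ⟨χ⟩ := hφ e2
  have hf1 := ht (φ e1).2
  have hf2 := ht (φ e2).2
  have hf12 : (φ e1).1 ≠ (φ e2).1 := fun h => he12 (φ.injective (Subtype.ext h))
  obtain ⟨f1, hf1d⟩ : ∃ f1, f1 = (φ e1).1 := ⟨_, rfl⟩
  obtain ⟨f2, hf2d⟩ : ∃ f2, f2 = (φ e2).1 := ⟨_, rfl⟩
  rw [← hf1d] at hf1 hf12 ψ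
  rw [← hf2d] at hf2 hf12 χ
  obtain ⟨ψ, hψ⟩ : ∃ ψ : W ≃ A ⊕ B, ∀ x y, ((J G H a b).Adj (ψ x) (ψ y) ∧
      s(ψ x, ψ y) ≠ s(Sum.inl a, Sum.inr b)) ↔ (K.Adj x y ∧ s(x, y) ≠ f1) := by
    refine ⟨ψ.toEquiv, fun x y => ?_⟩
    have := ψ.map_adj_iff (v := x) (w := y)
    rw [deleteEdges_adj, deleteEdges_adj] at this; exact this
  obtain ⟨χ, hχ⟩ : ∃ χ : W ≃ A ⊕ B, ∀ x y, ((J G H a b).Adj (χ x) (χ y) ∧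
      s(χ x, χ y) ≠ s(Sum.inl v, Sum.inl p)) ↔ (K.Adj x y ∧ s(x, y) ≠ f2) := by
    refine ⟨χ.toEquiv, fun x y => ?_⟩
    have := χ.map_adj_iff (v := x) (w := y)
    rw [deleteEdges_adj, deleteEdges_adj] at this; exact this
  have key : ∀ g h, s(ψ.symm (Sum.inl g), ψ.symm (Sum.inr h)) = f1 → ∃ (g : A) (h : B) (f : Sym2 (A ⊕ B)) (χ : A ⊕ B ≃ A ⊕ B),
      f ∈ (J G H g h).edgeSet ∧ f ≠ s(Sum.inl g, Sum.inr h) ∧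
      CardIso (J G H a b) s(Sum.inl v, Sum.inl p) (J G H g h) f χ ∧
      ¬ Nonempty (J G H g h ≃g J G H a b) := by
    intro g h hgh
    have hK : ∀ x y, (J G H g h).Adj x y ↔ K.Adj (ψ.symm x) (ψ.symm y) := by
      intro x y
      have h1 := hψ (ψ.symm x) (ψ.symm y)
      simp only [Equiv.apply_symm_apply] at h1
      have h2 : K.Adj (ψ.symm x) (ψ.symm y) ↔
          (K.Adj (ψ.symm x) (ψ.symm y) ∧ s(ψ.symm x, ψ.symm y) ≠ f1) ∨ s(ψ.symm x, ψ.symm y) = f1 := by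
        constructor
        · intro k
          by_cases k' : s(ψ.symm x, ψ.symm y) = f1
          · exact Or.inr k'
          · exact Or.inl ⟨k, k'⟩
        · rintro (k | k)
          · exact k.1
          · rw [← k] at hf1; exact hf1
      rw [h2, ← h1, ← hgh]
      have hinj := ψ.symm.injective
      rcases x with x | x <;> rcases y with y | y <;>
        simp [J_ll, J_rr, J_lr, J_rl, Sym2.eq_iff, hinj.eq_iff]
      all_goals tauto
    have hKiso : J G H g h ≃g K := ⟨ψ.symm, fun {x y} => (hK x y).symm⟩
    refine ⟨g, h, Sym2.map ψ f2, ψ.symm.trans χ, ?_, ?_, ?_, ?_⟩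
    · induction f2 with | _ x y =>
      simp only [Sym2.map_mk, mem_edgeSet] at *
      rw [hK]; simpa using hf2
    · intro hh
      apply hf12
      rw [← hgh]
      apply Sym2.map.injective ψ.injective
      rw [hh]; simp
    · intro x y
      have := hχ (ψ.symm x) (ψ.symm y)
      simp only [Equiv.trans_apply]
      refine this.trans ?_
      rw [hK]
      refine and_congr_right fun _ => not_congr ?_
      constructor
      · intro k; rw [← k]; simp
      · intro k
        apply Sym2.map.injective ψ.injective
        rw [← k]; simp
    · rintro ⟨k⟩
      exact hn.false (hKiso.symm.trans k)
  by_contra hcon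
  have hno : ∀ g h, s(ψ.symm (Sum.inl g), ψ.symm (Sum.inr h)) ≠ f1 := fun g h k => hcon (key g h k)
  have hclosed : ∀ x y, K.Adj x y → ((ψ x).isLeft ↔ (ψ y).isLeft) := by
    intro x y k
    by_cases k' : s(x, y) = f1
    · rcases hx : ψ x with u | u <;> rcases hy : ψ y with w | w <;> simp
      · apply hno u w; rw [← hx, ← hy]; simpa using k'
      · apply hno w u; rw [← hx, ← hy, Sym2.eq_swap]; simpa using k'
    · obtain ⟨k1, k2⟩ := (hψ x y).2 ⟨k, k'⟩
      rcases hx : ψ x with u | u <;> rcases hy : ψ y with w | w <;> rw [hx, hy] at k1 k2 <;> simp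
      · rw [J_lr] at k1; rw [k1.1, k1.2] at k2; exact k2 rfl
      · rw [J_rl] at k1; rw [k1.1, k1.2] at k2; exact k2 Sym2.eq_swap
  let F : Finset (A ⊕ B) := Finset.univ.filter (fun z => (ψ (χ.symm z)).isLeft)
  have hF : F.card = m := by
    have : F = Finset.univ.image (fun x : A => χ (ψ.symm (Sum.inl x))) := by
      ext z
      simp only [F, Finset.mem_filter, Finset.mem_univ, true_and, Finset.mem_image]
      constructor
      · intro k
        obtain ⟨x, hx⟩ := Sum.isLeft_iff.1 k
        exact ⟨x, by rw [← hx]; simp⟩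
      · rintro ⟨x, rfl⟩; simp
    rw [this, Finset.card_image_of_injective _ (fun x y k => by simpa using k), Finset.card_univ, hA]
  have hFc : ∀ z z', (J G H a b).Adj z z' → s(z, z') ≠ s(Sum.inl v, Sum.inl p) → (z ∈ F ↔ z' ∈ F) := by
    intro z z' k k'
    have := (hχ (χ.symm z) (χ.symm z')).1 (by simpa using ⟨k, by simpa using k'⟩)
    simpa [F] using hclosed _ _ this.1
  have hβ : (∀ y, Sum.inr y ∈ F) ∨ (∀ y, Sum.inr y ∉ F) :=
    hH.conn_iff (fun y => Sum.inr y ∈ F) (fun x y k hx => (hFc (Sum.inr x) (Sum.inr y) k (by simp)).1 hx)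
  have hcr := hFc (Sum.inl a) (Sum.inr b) ⟨rfl, rfl⟩ (by simp)
  rcases fin_closed hA hB F hF hβ with k | k
  · exact k.2 b (hcr.1 (k.1 a))
  · exact k.1 a (hcr.2 (k.2 b))

end
end

section

section
variable {A B A' B' : Type} [Fintype A] [Fintype B] [Fintype A'] [Fintype B']

theorem split_equiv (χ : A' ⊕ B' ≃ A ⊕ B) (hc : Fintype.card A' = Fintype.card A)
    (h : ∀ x, ∃ y, χ (Sum.inl x) = Sum.inl y) :
    ∃ (κ : A' ≃ A) (μ : B' ≃ B), (∀ x, χ (Sum.inl x) = Sum.inl (κ x)) ∧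
      ∀ y, χ (Sum.inr y) = Sum.inr (μ y) := by
  choose k hk using h
  have kinj : Function.Injective k := by
    intro x y e
    have : χ (Sum.inl x) = χ (Sum.inl y) := by rw [hk, hk, e]
    simpa using this
  have kbij : Function.Bijective k := (Fintype.bijective_iff_injective_and_card k).2 ⟨kinj, hc⟩
  have hr : ∀ y, ∃ z, χ (Sum.inr y) = Sum.inr z := by
    intro y
    rcases hz : χ (Sum.inr y) with z | z
    · obtain ⟨x, rfl⟩ := kbij.2 z
      rw [← hk] at hz
      simp at hz
    · exact ⟨z, rfl⟩
  choose l hl using hr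
  have linj : Function.Injective l := by
    intro x y e
    have : χ (Sum.inr x) = χ (Sum.inr y) := by rw [hl, hl, e]
    simpa using this
  have lsurj : Function.Surjective l := by
    intro z
    obtain ⟨w, hw⟩ := χ.surjective (Sum.inr z)
    rcases w with w | w
    · rw [hk] at hw; simp at hw
    · rw [hl] at hw; exact ⟨w, by simpa using hw⟩
  exact ⟨Equiv.ofBijective k kbij, Equiv.ofBijective l ⟨linj, lsurj⟩, hk, hl⟩

variable {G : SimpleGraph A} {H : SimpleGraph B} {a : A} {b : B}
variable {X : SimpleGraph A'} {Y : SimpleGraph B'} {g : A'} {h : B'}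
variable {dG : A → A → ℕ} {dH : B → B → ℕ} {dX : A' → A' → ℕ} {dY : B' → B' → ℕ}

theorem MT.exists_nbr (hX : MT X dX) (t u : A') (htu : u ≠ t) : ∃ q, X.Adj t q := by
  obtain ⟨z, hz, _⟩ := hX.tm.geo t u htu.symm
  exact ⟨z, (hX.adj _ _).2 hz⟩

theorem lemmaP (hG : MT G dG) (hH : MT H dH) (hX : MT X dX) {m : ℕ}
    (hA : Fintype.card A = m) (hB : Fintype.card B = m) (hA' : Fintype.card A' = m)
    (hm : 2 ≤ m) {v p : A} (hl : Leaf dG v p) (hva : v ≠ a)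
    (χ : A' ⊕ B' ≃ A ⊕ B) {f : Sym2 (A' ⊕ B')}
    (hχ : CardIso (J G H a b) s(Sum.inl v, Sum.inl p) (J X Y g h) f χ) {t : A'}
    (ht : χ (Sum.inl t) = Sum.inl v) :
    Nonempty (Y ≃g mvg G v a) ∨ ∃ w, w ≠ v ∧ Nonempty (X ≃g mvg G v w) ∧ Nonempty (Y ≃g H) ∧
      (w = p → Nonempty (J X Y g h ≃g J G H a b)) := by
  classical
  -- the neighbour of t
  have hiso : ∀ z, (J X Y g h).Adj (Sum.inl t) z → s(Sum.inl t, z) = f := by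
    intro z hz
    by_contra hcon
    obtain ⟨k1, k2⟩ := (hχ _ _).2 ⟨hz, hcon⟩
    rw [ht] at k1 k2
    rcases hcz : χ z with c | c
    · rw [hcz, J_ll, hG.adj_leaf hl] at k1
      rw [hcz, k1] at k2; exact k2 rfl
    · rw [hcz, J_lr] at k1; exact hva k1.1
  obtain ⟨u, hu⟩ : ∃ u, u ≠ t := by
    haveI : Nontrivial A' := Fintype.one_lt_card_iff_nontrivial.1 (by omega)
    exact exists_ne t
  obtain ⟨q, hq⟩ := hX.exists_nbr t u hu
  have hf : f = s(Sum.inl t, Sum.inl q) := (hiso (Sum.inl q) hq).symm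
  have hqt : q ≠ t := hq.ne.symm
  have hlt : Leaf dX t q := by
    apply hX.tm.leaf_of_nbr ((hX.adj _ _).1 hq)
    intro r hr
    have := hiso (Sum.inl r) ((hX.adj _ _).2 hr)
    rw [hf] at this
    simpa [Sym2.eq_iff, hqt.symm] using this
  have htg : t ≠ g := by
    rintro rfl
    have := hiso (Sum.inr h) ⟨rfl, rfl⟩
    rw [hf] at this
    simp at this
  have hχs : ∀ z, χ z = Sum.inl v → z = Sum.inl t := fun z hz => χ.injective (hz.trans ht.symm)
  -- adjacency away from v and t
  have hadj : ∀ z z', z ≠ Sum.inl t → z' ≠ Sum.inl t →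
      ((J G H a b).Adj (χ z) (χ z') ↔ (J X Y g h).Adj z z') := by
    intro z z' hz hz'
    have h1 : s(z, z') ≠ f := by
      rw [hf]; intro k
      rcases Sym2.eq_iff.1 k with k | k
      · exact hz k.1
      · exact hz' k.2
    have h2 : s(χ z, χ z') ≠ s(Sum.inl v, Sum.inl p) := by
      intro k
      rcases Sym2.eq_iff.1 k with k | k
      · exact hz (hχs _ k.1)
      · exact hz' (hχs _ k.2)
    have := hχ z z'
    simpa [h1, h2] using this
  have hadj' : ∀ z z', z ≠ Sum.inl v → z' ≠ Sum.inl v →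
      ((J G H a b).Adj z z' ↔ (J X Y g h).Adj (χ.symm z) (χ.symm z')) := by
    intro z z' hz hz'
    rw [← hadj]
    · simp
    · intro k; apply hz; rw [← ht, ← k]; simp
    · intro k; apply hz'; rw [← ht, ← k]; simp
  by_cases hBB : (∃ x, χ (Sum.inl g) = Sum.inr x) ∧ (∃ x, χ (Sum.inr h) = Sum.inr x)
  · left
    obtain ⟨⟨gb, hgb⟩, ⟨hb', hhb⟩⟩ := hBB
    have hsg : χ.symm (Sum.inr gb) = Sum.inl g := by rw [← hgb]; simp
    have hsh : χ.symm (Sum.inr hb') = Sum.inr h := by rw [← hhb]; simp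
    have cross : ∀ z z', z ≠ Sum.inl v → z' ≠ Sum.inl v → (J G H a b).Adj z z' →
        (∃ x, χ.symm z = Sum.inl x) → (∃ x, χ.symm z' = Sum.inl x) ∨
          (z = Sum.inr gb ∧ z' = Sum.inr hb') := by
      rintro z z' hz hz' k ⟨x, hx⟩
      rw [hadj' z z' hz hz', hx] at k
      rcases hy : χ.symm z' with y | y
      · exact Or.inl ⟨y, rfl⟩
      · rw [hy, J_lr] at k
        right
        constructor
        · rw [← hgb, ← k.1, ← hx]; simp
        · rw [← hhb, ← k.2, ← hy]; simp
    have hal : ∀ x, x ≠ v → ¬ ∃ y, χ.symm (Sum.inl x) = Sum.inl y := by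
      rcases hG.conn_leaf_iff hl (fun x => ∃ y, χ.symm (Sum.inl x) = Sum.inl y) (by
        intro x y hx hy k hx'
        rcases cross (Sum.inl x) (Sum.inl y) (by simpa using hx) (by simpa using hy) k hx' with k | k
        · exact k
        · simp at k) with k | k
      · exfalso
        obtain ⟨κ, μ, h1, h2⟩ := split_equiv χ.symm (by omega) (fun x => by
          by_cases hx : x = v
          · exact ⟨t, by rw [hx, ← ht]; simp⟩
          · exact k x hx)
        have := h1 (κ.symm g)
        rw [Equiv.apply_symm_apply, ← hsg] at this
        simpa using this
      · exact k
    have hbP : ¬ ∃ y, χ.symm (Sum.inr b) = Sum.inl y := by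
      intro k
      rcases cross (Sum.inr b) (Sum.inl a) (by simp) (by simpa using hva.symm) ⟨rfl, rfl⟩ k with k | k
      · exact hal a hva.symm k
      · simp at k
    obtain ⟨κ, μ, h1, h2⟩ := split_equiv ((χ.trans (Equiv.swap (Sum.inl v) (Sum.inr b))).trans
      (Equiv.sumComm A B)) (by omega) (fun x => by
        by_cases hx : x = t
        · exact ⟨b, by simp [hx, ht]⟩
        · rcases hz : χ (Sum.inl x) with z | z
          · exfalso
            refine hal z ?_ ⟨x, by rw [← hz]; simp⟩
            rintro rfl
            exact hx (by simpa using hχs _ hz)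
          · have hzb : z ≠ b := by
              rintro rfl
              exact hbP ⟨x, by rw [← hz]; simp⟩
            refine ⟨z, ?_⟩
            simp only [Equiv.trans_apply, hz]
            rw [Equiv.swap_apply_of_ne_of_ne (by simp) (by simpa using hzb)]
            rfl)
    have h2' : ∀ y, (Equiv.swap (Sum.inl v) (Sum.inr b)) (χ (Sum.inr y)) = Sum.inl (μ y) := by
      intro y
      have := h2 y
      simp only [Equiv.trans_apply] at this
      rw [← Equiv.eq_symm_apply] at this
      simpa using this
    have h3 : ∀ y, χ (Sum.inr y) = (Equiv.swap (Sum.inl v) (Sum.inr b)) (Sum.inl (μ y)) := by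
      intro y; rw [← h2']; simp
    have hμh : μ h = v := by
      have := h2' h
      rw [hhb] at this
      by_contra hne
      by_cases k : hb' = b
      · subst k
        rw [Equiv.swap_apply_right] at this
        exact hne (by simpa using this.symm)
      · rw [Equiv.swap_apply_of_ne_of_ne (by simp) (by simpa using k)] at this
        simp at this
    have hχh : χ (Sum.inr h) = Sum.inr b := by rw [h3, hμh]; simp
    have hχy : ∀ y, y ≠ h → χ (Sum.inr y) = Sum.inl (μ y) := by
      intro y hy
      rw [h3, Equiv.swap_apply_of_ne_of_ne]
      · intro k; apply hy; apply μ.injective; rw [hμh]; simpa using k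
      · simp
    have hμv : ∀ y, μ y = v ↔ y = h := by
      intro y; rw [← hμh]; exact μ.injective.eq_iff
    refine ⟨⟨μ, ?_⟩⟩
    intro y y'
    have key := hadj (Sum.inr y) (Sum.inr y') (by simp) (by simp)
    rw [J_rr] at key
    rw [← key]
    simp only [mvg, hμv]
    by_cases e1 : y = h <;> by_cases e2 : y' = h
    · subst e1; subst e2; simp only [hχh]; simp
      intro k; exact absurd (k.symm.trans hμh) hva.symm
    · subst e1; rw [hχh, hχy _ e2, J_rl]; simp [e2, hva, hμh]
    · subst e2; rw [hχh, hχy _ e1, J_lr]; simp [e1, hva, hμh]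
    · rw [hχy _ e1, hχy _ e2, J_ll]; simp [e1, e2, hμv]
  · right
    have hbl : ∀ y, ¬ ∃ x, χ.symm (Sum.inr y) = Sum.inl x := by
      rcases hH.conn_iff (fun y => ∃ x, χ.symm (Sum.inr y) = Sum.inl x) (by
        rintro x y k ⟨z, hz⟩
        rcases hy : χ.symm (Sum.inr y) with w | w
        · exact ⟨w, rfl⟩
        · exfalso
          have k := (hadj' (Sum.inr x) (Sum.inr y) (by simp) (by simp)).1 k
          rw [hz, hy, J_lr] at k
          apply hBB
          constructor
          · exact ⟨x, by rw [← k.1, ← hz]; simp⟩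
          · exact ⟨y, by rw [← k.2, ← hy]; simp⟩) with k | k
      · exfalso
        choose k hk using k
        have kinj : Function.Injective k := by
          intro x y e
          have : χ.symm (Sum.inr x) = χ.symm (Sum.inr y) := by rw [hk, hk, e]
          simpa using this
        obtain ⟨y, hy⟩ := ((Fintype.bijective_iff_injective_and_card k).2 ⟨kinj, by omega⟩).2 t
        have := hk y
        rw [hy, Equiv.symm_apply_eq, ht] at this
        simp at this
      · exact k
    obtain ⟨κ, μ, h1, h2⟩ := split_equiv χ (by omega) (fun x => by
      rcases hz : χ (Sum.inl x) with z | z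
      · exact ⟨z, rfl⟩
      · exact absurd ⟨x, by rw [← hz]; simp⟩ (hbl z))
    have hκt : κ t = v := by have := h1 t; rw [ht] at this; simpa using this.symm
    have hκv : ∀ y, κ y = v ↔ y = t := by
      intro y; rw [← hκt]; exact κ.injective.eq_iff
    have hw : κ q ≠ v := by rw [Ne, hκv]; exact hqt
    refine ⟨κ q, hw, ⟨⟨κ, ?_⟩⟩, ⟨⟨μ, ?_⟩⟩, ?_⟩
    · intro y y'
      simp only [mvg, hκv, κ.injective.eq_iff]
      have hs : ∀ r, X.Adj r t ↔ r = q := fun r => by rw [X.adj_comm, hX.adj_leaf hlt]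
      by_cases e1 : y = t <;> by_cases e2 : y' = t
      · subst e1; subst e2; simp [hqt.symm]
      · subst e1; rw [hX.adj_leaf hlt]; simp [e2, hw.symm, hκv, hκt]
      · subst e2; rw [hs]; simp [e1, hw.symm, hκv, hκt]
      · have key := hadj (Sum.inl y) (Sum.inl y') (by simpa using e1) (by simpa using e2)
        rw [h1, h1, J_ll, J_ll] at key
        simp [e1, e2, key, hκv]
    · intro y y'
      have key := hadj (Sum.inr y) (Sum.inr y') (by simp) (by simp)
      rw [h2, h2, J_rr, J_rr] at key
      exact key
    · intro hwp
      refine ⟨⟨χ, ?_⟩⟩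
      intro z z'
      have hef : s(χ z, χ z') = s(Sum.inl v, Sum.inl p) ↔ s(z, z') = f := by
        rw [hf, ← hwp, ← h1, ← ht]
        simp [Sym2.eq_iff]
      have := hχ z z'
      by_cases k : s(z, z') = f
      · have k' := hef.2 k
        have h3 : (J X Y g h).Adj z z' := by
          rw [← mem_edgeSet, k, hf]; exact hq
        have h4 : (J G H a b).Adj (χ z) (χ z') := by
          rw [← mem_edgeSet, k']; exact (hG.adj_leaf hl p).2 rfl
        simp [h3, h4]
      · have k2 : s(χ z, χ z') ≠ s(Sum.inl v, Sum.inl p) := fun e => k (hef.1 e)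
        rw [and_iff_left k2, and_iff_left k] at this
        exact this

end
end

section

section
theorem CardIso.pre {U U' U'' : Type} {P : SimpleGraph U} {e : Sym2 U} {Q : SimpleGraph U'}
    {f : Sym2 U'} {χ : U' ≃ U} (h : CardIso P e Q f χ) {R : SimpleGraph U''} (σ : R ≃g Q) :
    CardIso P e R (f.map σ.symm) (σ.toEquiv.trans χ) := by
  intro x y
  refine (h (σ x) (σ y)).trans ?_
  rw [σ.map_adj_iff]
  refine and_congr_right fun _ => not_congr ?_
  constructor
  · intro k; rw [← k]; simp
  · intro k
    apply Sym2.map.injective σ.symm.injective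
    rw [← k]; simp

variable {A B : Type} [Fintype A] [Fintype B]
variable {G : SimpleGraph A} {H : SimpleGraph B} {a : A} {b : B}
variable {dG : A → A → ℕ} {dH : B → B → ℕ}

theorem five_of_bad (hG : MT G dG) (hH : MT H dH) {m : ℕ} (hA : Fintype.card A = m)
    (hB : Fintype.card B = m) (hm : 2 ≤ m) (hlam : 3 ≤ lam dG) (ha : IsLeaf dG a) {v p : A}
    (hl : Leaf dG v p) (hva : v ≠ a) (hirr : Irr dG v)
    (hb : ∀ s : Finset (Sym2 (A ⊕ B)), (∀ e, e ∈ s ↔ e = s(Sum.inl a, Sum.inr b) ∨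
      e = s(Sum.inl v, Sum.inl p)) → ¬ Good (J G H a b) s) :
    Isom dH (mvd dG v a) := by
  obtain ⟨g, h, f, χ, hf, hfgh, hχ, hn⟩ := bad_extract hH hA hB hb
  have hirr' : ∀ w, w ≠ v → Nonempty (G ≃g mvg G v w) → w = p := by
    intro w hw k
    exact hG.tm.leaf_nbr_unique hl (hirr.2 w hw ((hG.isom_iff (hG.mv hl hw)).2 k))
  rcases ht : χ.symm (Sum.inl v) with t | t
  · have ht' : χ (Sum.inl t) = Sum.inl v := by rw [← ht]; simp
    rcases lemmaP hG hH hG hA hB hA hm hl hva χ hχ ht' with k | ⟨w, hw, k1, k2, k3⟩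
    · exact (hH.isom_iff (hG.mv hl hva.symm)).2 k
    · exact absurd (k3 (hirr' w hw k1)) hn
  · exfalso
    have hχ' := hχ.pre (J_swap H G h g)
    have ht' : ((J_swap H G h g).toEquiv.trans χ) (Sum.inl t) = Sum.inl v := by
      change χ (Sum.inr t) = _
      rw [← ht]; simp
    rcases lemmaP hG hH hH hA hB hB hm hl hva _ hχ' ht' with k | ⟨w, hw, k1, ⟨k2⟩, k3⟩
    · have := hirr' a hva.symm k
      exact nbr_not_leaf hG.tm hlam hl (this ▸ ha)
    · have := hirr' w hw (k1.map (fun k1 => k2.trans k1))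
      exact hn ((k3 this).map (fun k => (J_swap G H g h).trans k))

end
end

section

section
variable {A B : Type}

/-- `H` with a pendant vertex attached at `b` -/
def pn (H : SimpleGraph B) (b : B) : SimpleGraph (Option B) where
  Adj x y := match x, y with
    | none, none => False
    | some x, some y => H.Adj x y
    | none, some y => y = b
    | some x, none => x = b
  symm := ⟨fun x y h => by
    cases x <;> cases y
    · exact h
    · exact h
    · exact h
    · exact SimpleGraph.Adj.symm (G := H) h⟩
  loopless := ⟨fun x h => by
    cases x
    · exact h
    · exact H.irrefl h⟩

/-- the distance on `pn` -/
def pnd (d : B → B → ℕ) (b : B) : Option B → Option B → ℕ := fun x y => match x, y with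
    | none, none => 0
    | some x, some y => d x y
    | none, some y => d b y + 1
    | some x, none => d x b + 1

variable {H : SimpleGraph B} {b : B} {d : B → B → ℕ}

theorem pnd_leaf (b : B) : Leaf (pnd d b) none (some b) := by
  refine ⟨by simp, fun x hx => ?_⟩
  cases x
  · exact absurd rfl hx
  · rfl

theorem pnd_TM (h : TM d) (b : B) : TM (pnd d b) := by
  refine TM.addleaf none (some b) (by simp) ?_ ?_ ?_ ?_ ?_ ?_ (pnd_leaf b).2
  · intro x; cases x
    · rfl
    · exact h.self _
  · intro x y hx hy k
    cases x <;> cases y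
    · exact absurd rfl hx
    · exact absurd rfl hx
    · exact absurd rfl hy
    · exact congrArg some (h.eq _ _ k)
  · intro x y
    cases x <;> cases y
    · rfl
    · simp only [pnd]; rw [h.symm]
    · simp only [pnd]; rw [h.symm]
    · exact h.symm _ _
  · intro x y z q hx hy hz hq
    cases x <;> cases y <;> cases z <;> cases q <;> first | exact absurd rfl ‹_› | exact h.four _ _ _ _
  · intro x y z hx hy hz
    cases x <;> cases y <;> cases z <;> first | exact absurd rfl ‹_› | exact h.par _ _ _
  · intro x y hx hy hxy
    cases x with
    | none => exact absurd rfl hx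
    | some x =>
      cases y with
      | none => exact absurd rfl hy
      | some y =>
        obtain ⟨z, h1, h2⟩ := h.geo x y (fun k => hxy (by rw [k]))
        exact ⟨some z, by simp, h1, h2⟩

theorem pn_MT (h : MT H d) (b : B) : MT (pn H b) (pnd d b) := by
  refine ⟨pnd_TM h.tm b, ?_⟩
  intro x y
  cases x <;> cases y
  · simp [pn, pnd]
  · simp only [pn, pnd]
    constructor
    · rintro rfl; rw [h.tm.self]
    · intro k; exact (h.tm.eq _ _ (by omega)).symm
  · simp only [pn, pnd]
    constructor
    · rintro rfl; rw [h.tm.self]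
    · intro k; exact (h.tm.eq _ _ (by omega))
  · exact h.adj _ _

theorem pn_mvg (H : SimpleGraph B) (b c : B) : pn H c = mvg (pn H b) none (some c) := by
  ext x y
  cases x <;> cases y <;> simp [pn, mvg]

variable [Fintype B] [Fintype A]

theorem pnd_isLeaf (h : TM d) {v : B} (hv : IsLeaf d v) (hvb : v ≠ b) : IsLeaf (pnd d b) (some v) := by
  obtain ⟨p, hp⟩ := hv
  refine ⟨some p, by simpa using hp.1, fun x hx => ?_⟩
  cases x with
  | none => 
    have := hp.2 b hvb.symm
    simp only [pnd]; omega
  | some x => exact hp.2 x (fun k => hx (by rw [k]))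

theorem lam_pnd (h : TM d) (hlam : 3 ≤ lam d) (b : B) : 3 ≤ lam (pnd d b) := by
  classical
  unfold lam at *
  let S := (Finset.univ.filter (fun v => IsLeaf d v)).erase b
  have h1 : 2 ≤ S.card := by
    have := Finset.pred_card_le_card_erase (s := Finset.univ.filter (fun v => IsLeaf d v)) (a := b)
    simp only [S]
    convert le_trans (Nat.sub_le_sub_right hlam 1) this
  have h2 : (insert none (S.image some)).card = S.card + 1 := by
    rw [Finset.card_insert_of_notMem (by simp), Finset.card_image_of_injective _ (Option.some_injective _)]
  have h3 : insert none (S.image some) ⊆ Finset.univ.filter (fun v => IsLeaf (pnd d b) v) := by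
    intro x hx
    simp only [Finset.mem_insert, Finset.mem_image] at hx
    simp only [Finset.mem_filter, Finset.mem_univ, true_and]
    rcases hx with rfl | ⟨v, hv, rfl⟩
    · exact ⟨_, pnd_leaf b⟩
    · simp only [S, Finset.mem_erase, Finset.mem_filter, Finset.mem_univ, true_and] at hv
      exact pnd_isLeaf h hv.2 hv.1
  have h4 := Finset.card_le_card h3
  have h5 : 3 ≤ (insert none (S.image some)).card := by omega
  refine le_trans h5 ?_
  convert h4

/-- an automorphism-type consequence of `leaf_fix` -/
theorem pn_fix (h : MT H d) (hlam : 3 ≤ lam d) {b c : B} (hI : Nonempty (pn H c ≃g pn H b)) :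
    ∃ τ : H ≃g H, τ c = b := by
  have hM := pn_MT h b
  rw [pn_mvg H b c] at hI
  have hM' := hM.mv (pnd_leaf b) (w := some c) (by simp)
  obtain ⟨σ, s1, s2⟩ := leaf_fix hM.tm (lam_pnd h.tm hlam b) (pnd_leaf b) (w := some c) (by simp)
    ((hM.isom_iff hM').2 (hI.map (fun k => k.symm)))
  have hsome : ∀ x, ∃ y, σ (some x) = some y := by
    intro x
    rcases hy : σ (some x) with _ | y
    · rw [← s1] at hy; simp at hy
    · exact ⟨y, rfl⟩
  choose τ hτ using hsome
  have tinj : Function.Injective τ := by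
    intro x y k
    have : σ (some x) = σ (some y) := by rw [hτ, hτ, k]
    simpa using this
  have tbij := Finite.injective_iff_bijective.1 tinj
  have hadj : ∀ x y, H.Adj (τ x) (τ y) ↔ H.Adj x y := by
    intro x y
    have := s2 (some x) (some y)
    rw [hτ, hτ, mvd_ne hM.tm (by simp) (by simp)] at this
    rw [h.adj, h.adj]
    simp only [pnd] at this
    rw [this]
  have hc : τ b = c := by
    have := s2 none (some b)
    rw [s1, hτ, mvd_left (by simp)] at this
    simp only [pnd] at this
    rw [h.tm.self] at this
    exact (h.tm.eq _ _ (by omega)).symm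
  let T : H ≃g H := ⟨Equiv.ofBijective τ tbij, fun {x y} => hadj x y⟩
  refine ⟨T.symm, ?_⟩
  rw [← hc]
  exact T.symm_apply_apply b

theorem mv_fix {G : SimpleGraph A} {d : A → A → ℕ} (h : MT G d) (hlam : 3 ≤ lam d) {a x w : A}
    (hl : Leaf d a x) (hw : w ≠ a) (hI : Nonempty (G ≃g mvg G a w)) :
    ∃ τ : G ≃g mvg G a w, τ a = a := by
  have hM := h.mv hl hw
  obtain ⟨σ, s1, s2⟩ := leaf_fix h.tm hlam hl hw ((h.isom_iff hM).2 hI)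
  refine ⟨⟨σ, ?_⟩, s1⟩
  intro x y
  have := s2 x y
  rw [hM.adj, h.adj]
  exact this ▸ Iff.rfl

theorem pn_congr {B' : Type} {Y : SimpleGraph B'} (β : Y ≃g H) (h : B') : Nonempty (pn Y h ≃g pn H (β h)) := by
  refine ⟨⟨Equiv.optionCongr β.toEquiv, ?_⟩⟩
  intro x y
  have := β.injective
  cases x <;> cases y
  · simp [pn]
  · exact this.eq_iff
  · exact this.eq_iff
  · exact β.map_adj_iff

/-- the exchange case -/
theorem pn_four {G : SimpleGraph A} {dG : A → A → ℕ} {g : A} (hG : MT G dG) (h : MT H d) {y : B} (hby : Leaf d b y)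
    (ρ : pn G g ≃g pn H b) (hne : ρ none ≠ none) :
    ∃ z q, Leaf d z q ∧ z ≠ b ∧ Nonempty (G ≃g mvg H z b) := by
  classical
  obtain ⟨z, hz⟩ := Option.ne_none_iff_exists.1 hne
  have hM := pn_MT h b
  have hP := pn_MT hG g
  have hiso : ∀ u w, pnd d b (ρ u) (ρ w) = pnd dG g u w := by
    intro u w
    exact hP.tm.isom_of_adj hM.tm ρ.toEquiv (fun x y => by
      rw [← hM.adj, ← hP.adj]; exact ρ.map_adj_iff) u w
  have hzl : IsLeaf (pnd d b) (some z) := by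
    rw [hz]
    exact (isLeaf_isom ρ.toEquiv hiso none).2 ⟨_, pnd_leaf g⟩
  obtain ⟨q', hq'⟩ := hzl
  have hzb : z ≠ b := by
    rintro rfl
    have h1 := hM.tm.leaf_nbr_unique hq' (q := none) (by simp [pnd, h.tm.self])
    have h2 := hM.tm.leaf_nbr_unique hq' (q := some y) (by simp only [pnd]; exact h.tm.leaf_nbr hby)
    rw [← h1] at h2; simp at h2
  rcases q' with _ | q
  · have := hM.tm.leaf_nbr hq'
    simp only [pnd] at this
    exact absurd (h.tm.eq _ _ (by omega)) hzb
  have hlq : Leaf d z q := ⟨fun k => hq'.1 (by rw [k]), fun x hx => hq'.2 (some x) (by simpa using hx)⟩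
  refine ⟨z, q, hlq, hzb, ?_⟩
  -- the map: `some x ↦ ρ (some x)`, with `none` renamed `z`
  have hρz : ∀ x, ρ (some x) ≠ some z := by
    intro x k; rw [hz] at k; simp at k
  let r : A → B := fun x => (ρ (some x)).getD z
  have rs : ∀ x, (r x = z ∧ ρ (some x) = none) ∨ (r x ≠ z ∧ ρ (some x) = some (r x)) := by
    intro x
    rcases hx : ρ (some x) with _ | u
    · left; simp [r, hx]
    · right
      have : r x = u := by simp [r, hx]
      rw [this]
      refine ⟨?_, rfl⟩
      rintro rfl; exact hρz x hx
  have rinj : Function.Injective r := by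
    intro x x' k
    have : ρ (some x) = ρ (some x') := by
      rcases rs x with ⟨h1, h2⟩ | ⟨h1, h2⟩ <;> rcases rs x' with ⟨h3, h4⟩ | ⟨h3, h4⟩
      · rw [h2, h4]
      · exact absurd (k ▸ h1) h3
      · exact absurd (k ▸ h3) h1
      · rw [h2, h4, k]
    simpa using this
  have hcard : Fintype.card A = Fintype.card B := by
    have := Fintype.card_congr ρ.toEquiv
    simpa using this
  let r' : A ≃ B := Equiv.ofBijective r ((Fintype.bijective_iff_injective_and_card r).2 ⟨rinj, hcard⟩)
  refine ⟨⟨r', ?_⟩⟩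
  intro x x'
  have key := ρ.map_adj_iff (v := some x) (w := some x')
  change _ ↔ G.Adj x x' at key
  rw [← key]
  change (mvg H z b).Adj (r x) (r x') ↔ _
  rcases rs x with ⟨h1, h2⟩ | ⟨h1, h2⟩ <;> rcases rs x' with ⟨h3, h4⟩ | ⟨h3, h4⟩ <;> rw [h2, h4]
  · simp [mvg, pn, h1, h3, hzb]
  · simp [mvg, pn, h1, h3, hzb]
  · simp [mvg, pn, h1, h3, hzb]
  · simp [mvg, pn, h1, h3]

end
end

section

section
variable {A B A' B' : Type} [Fintype A] [Fintype B] [Fintype A'] [Fintype B']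
variable {G : SimpleGraph A} {H : SimpleGraph B} {a : A} {b : B}
variable {X : SimpleGraph A'} {Y : SimpleGraph B'} {g : A'} {h : B'}
variable {dG : A → A → ℕ} {dH : B → B → ℕ} {dX : A' → A' → ℕ} {dY : B' → B' → ℕ}

theorem lemmaQ (hG : MT G dG) (hX : MT X dX) (hY : MT Y dY) {m : ℕ}
    (hA : Fintype.card A = m) (hB : Fintype.card B = m) (hA' : Fintype.card A' = m)
    (hB' : Fintype.card B' = m) (hm : 2 ≤ m) {x : A} (hl : Leaf dG a x)
    (χ : A' ⊕ B' ≃ A ⊕ B) {f : Sym2 (A' ⊕ B')} {f₁ f₂ : A'} (hf0 : f = s(Sum.inl f₁, Sum.inl f₂))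
    (hχ : CardIso (J G H a b) s(Sum.inl a, Sum.inl x) (J X Y g h) f χ) :
    ∃ w, w ≠ a ∧ (∃ κ : X ≃g mvg G a w, κ g = a) ∧ Nonempty (pn Y h ≃g pn H b) := by
  classical
  have closed : ∀ z z', (J X Y g h).Adj z z' → s(z, z') ≠ f → (∃ c, c ≠ a ∧ χ z = Sum.inl c) →
      ∃ c, c ≠ a ∧ χ z' = Sum.inl c := by
    rintro z z' k k' ⟨c, hc, hz⟩
    obtain ⟨k1, k2⟩ := (hχ z z').2 ⟨k, k'⟩
    rw [hz] at k1 k2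
    rcases hz' : χ z' with c' | c'
    · refine ⟨c', ?_, rfl⟩
      rintro rfl
      rw [hz', J_ll, G.adj_comm, hG.adj_leaf hl] at k1
      rw [hz', k1] at k2
      exact k2 Sym2.eq_swap
    · rw [hz', J_lr] at k1; exact absurd k1.1 hc
  have hYn : ∀ y, ¬ ∃ c, c ≠ a ∧ χ (Sum.inr y) = Sum.inl c := by
    rcases hY.conn_iff (fun y => ∃ c, c ≠ a ∧ χ (Sum.inr y) = Sum.inl c) (by
      intro y y' k hy
      exact closed (Sum.inr y) (Sum.inr y') k (by rw [hf0]; simp) hy) with k | k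
    · exfalso
      choose k hka hk using k
      have kinj : Function.Injective k := by
        intro x y e
        have : χ (Sum.inr x) = χ (Sum.inr y) := by rw [hk, hk, e]
        simpa using this
      obtain ⟨y, hy⟩ := ((Fintype.bijective_iff_injective_and_card k).2 ⟨kinj, by omega⟩).2 a
      exact hka y hy
    · exact k
  have hgn : ¬ ∃ c, c ≠ a ∧ χ (Sum.inl g) = Sum.inl c := by
    intro k
    exact hYn h (closed (Sum.inl g) (Sum.inr h) ⟨rfl, rfl⟩ (by rw [hf0]; simp) k)
  have hcl : ∀ c, c ≠ a → ∃ t, t ≠ g ∧ χ.symm (Sum.inl c) = Sum.inl t := by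
    intro c hc
    rcases ht : χ.symm (Sum.inl c) with t | t
    · refine ⟨t, ?_, rfl⟩
      rintro rfl
      exact hgn ⟨c, hc, by rw [← ht]; simp⟩
    · exact absurd ⟨c, hc, by rw [← ht]; simp⟩ (hYn t)
  obtain ⟨κ, μ, h1, h2⟩ := split_equiv (χ.trans (Equiv.swap (χ (Sum.inl g)) (Sum.inl a))).symm
    (by omega) (fun c => by
      by_cases hc : c = a
      · exact ⟨g, by rw [Equiv.symm_apply_eq]; simp [hc]⟩
      · obtain ⟨t, ht, hct⟩ := hcl c hc
        refine ⟨t, ?_⟩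
        rw [Equiv.symm_apply_eq]
        have : χ (Sum.inl t) = Sum.inl c := by rw [← hct]; simp
        rw [Equiv.trans_apply, this, Equiv.swap_apply_of_ne_of_ne]
        · intro k; exact hgn ⟨c, hc, k.symm⟩
        · simpa using hc)
  have h1' : ∀ c, Sum.inl c = (Equiv.swap (χ (Sum.inl g)) (Sum.inl a)) (χ (Sum.inl (κ c))) := by
    intro c
    have := h1 c
    rw [Equiv.symm_apply_eq] at this
    exact this
  have hκa : κ a = g := by
    have := h1' a
    rw [Equiv.swap_comm, eq_comm, ← Equiv.eq_symm_apply] at this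
    simpa using this
  have hκ : ∀ c, c ≠ a → χ (Sum.inl (κ c)) = Sum.inl c := by
    intro c hc
    have := h1' c
    rw [eq_comm, ← Equiv.eq_symm_apply, Equiv.symm_swap, Equiv.swap_apply_of_ne_of_ne] at this
    · exact this
    · intro k; exact hgn ⟨c, hc, k.symm⟩
    · simpa using hc
  have hR : ∀ t, t ≠ g → χ (Sum.inl t) = Sum.inl (κ.symm t) := by
    intro t ht
    have := hκ (κ.symm t) (by rw [Ne, Equiv.symm_apply_eq, hκa]; exact ht)
    simpa using this
  have hκs : ∀ t, κ.symm t = a ↔ t = g := by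
    intro t; rw [Equiv.symm_apply_eq, hκa]
  have hiso : ∀ r, X.Adj g r → f = s(Sum.inl g, Sum.inl r) := by
    intro r hr
    by_contra k
    apply hgn
    refine closed (Sum.inl r) (Sum.inl g) hr.symm (fun e => k (by rw [← e]; exact Sym2.eq_swap)) ?_
    exact ⟨κ.symm r, by rw [Ne, hκs]; exact hr.ne.symm, hR r hr.ne.symm⟩
  obtain ⟨u, hu⟩ : ∃ u, u ≠ g := by
    haveI : Nontrivial A' := Fintype.one_lt_card_iff_nontrivial.1 (by omega)
    exact exists_ne g
  obtain ⟨q, hq⟩ := hX.exists_nbr g u hu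
  have hf := hiso q hq
  have hqg : q ≠ g := hq.ne.symm
  have hlg : Leaf dX g q := by
    apply hX.tm.leaf_of_nbr ((hX.adj _ _).1 hq)
    intro r hr
    have := hiso r ((hX.adj _ _).2 hr)
    rw [hf] at this
    simpa [Sym2.eq_iff, hqg, hqg.symm, eq_comm] using this
  have hw : κ.symm q ≠ a := by rw [Ne, hκs]; exact hqg
  refine ⟨κ.symm q, hw, ⟨⟨κ.symm, ?_⟩, (hκs g).2 rfl⟩, ?_⟩
  · intro y y'
    change (mvg G a (κ.symm q)).Adj (κ.symm y) (κ.symm y') ↔ _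
    have hs : ∀ r, X.Adj r g ↔ r = q := fun r => by rw [X.adj_comm, hX.adj_leaf hlg]
    simp only [mvg, hκs, κ.symm.injective.eq_iff, ne_eq, hw.symm]
    by_cases e1 : y = g <;> by_cases e2 : y' = g
    · subst e1; subst e2; simp [hqg.symm]
    · subst e1; rw [hX.adj_leaf hlg]; simp [e2]
    · subst e2; rw [hs]; simp [e1]
    · have key := hχ (Sum.inl y) (Sum.inl y')
      rw [hR y e1, hR y' e2, J_ll, J_ll, hf] at key
      have n1 : s((Sum.inl (κ.symm y) : A ⊕ B), Sum.inl (κ.symm y')) ≠ s(Sum.inl a, Sum.inl x) := by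
        intro k
        rcases Sym2.eq_iff.1 k with k | k
        · exact e1 ((hκs y).1 (by simpa using k.1))
        · exact e2 ((hκs y').1 (by simpa using k.2))
      have n2 : s((Sum.inl y : A' ⊕ B'), Sum.inl y') ≠ s(Sum.inl g, Sum.inl q) := by
        intro k
        rcases Sym2.eq_iff.1 k with k | k
        · exact e1 (by simpa using k.1)
        · exact e2 (by simpa using k.2)
      rw [and_iff_left n1, and_iff_left n2] at key
      simp [e1, e2, key]
  · let i : Option B' → A' ⊕ B' := fun z => z.elim (Sum.inl g) Sum.inr
    let o : A ⊕ B → Option B := Sum.elim (fun _ => none) some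
    have hi : ∀ z, χ (i z) = Sum.inl a ∨ ∃ y, χ (i z) = Sum.inr y := by
      intro z
      have hn : ¬ ∃ c, c ≠ a ∧ χ (i z) = Sum.inl c := by
        cases z
        · exact hgn
        · exact hYn _
      rcases hz : χ (i z) with c | c
      · left
        by_contra k
        exact hn ⟨c, fun e => k (by rw [e]), hz⟩
      · exact Or.inr ⟨c, rfl⟩
    have iinj : Function.Injective i := by
      intro z z' k
      cases z <;> cases z' <;> simp [i] at k ⊢
      exact k
    have rinj : Function.Injective (fun z => o (χ (i z))) := by
      intro z z' k
      apply iinj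
      apply χ.injective
      simp only at k
      rcases hi z with e | ⟨y, e⟩ <;> rcases hi z' with e' | ⟨y', e'⟩ <;> rw [e, e'] at k ⊢
      · simp [o] at k
      · simp [o] at k
      · simp [o] at k; rw [k]
    let ρ : Option B' ≃ Option B := Equiv.ofBijective _
      ((Fintype.bijective_iff_injective_and_card _).2 ⟨rinj, by simp [hB, hB']⟩)
    refine ⟨⟨ρ, ?_⟩⟩
    intro z z'
    change (pn H b).Adj (o (χ (i z))) (o (χ (i z'))) ↔ _
    have e1 : (pn Y h).Adj z z' ↔ (J X Y g h).Adj (i z) (i z') ∧ s(i z, i z') ≠ f := by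
      rw [hf]
      cases z <;> cases z' <;> simp [pn, i, J_ll, J_rr, J_lr, J_rl]
    rw [e1, ← hχ]
    rcases hi z with e | ⟨y, e⟩ <;> rcases hi z' with e' | ⟨y', e'⟩ <;> rw [e, e'] <;>
      simp [pn, o, J_ll, J_rr, J_lr, J_rl]

end
end

section

section
theorem good_map {U U' : Type} {P : SimpleGraph U} {Q : SimpleGraph U'} (σ : P ≃g Q)
    {s : Finset (Sym2 U)} (hs : Good P s) (hsub : (↑s : Set (Sym2 U)) ⊆ P.edgeSet) :
    ∃ s' : Finset (Sym2 U'), s'.card = s.card ∧ (↑s' : Set (Sym2 U')) ⊆ Q.edgeSet ∧ Good Q s' := by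
  classical
  have hinj : Function.Injective (Sym2.map σ) := Sym2.map.injective σ.injective
  refine ⟨s.map ⟨Sym2.map σ, hinj⟩, by simp, ?_, ?_⟩
  · intro e he
    simp only [Finset.coe_map, Function.Embedding.coeFn_mk, Set.mem_image] at he
    obtain ⟨e', he', rfl⟩ := he
    have := hsub he'
    induction e' with | _ x y =>
    simpa [σ.map_adj_iff] using this
  · rintro W iW K t ht ⟨φ, hφ⟩
    have hmem : ∀ e, e ∈ s ↔ Sym2.map σ e ∈ s.map ⟨Sym2.map σ, hinj⟩ := by
      intro e
      constructor
      · intro h; exact Finset.mem_map.2 ⟨e, h, rfl⟩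
      · intro h
        obtain ⟨e', he', k⟩ := Finset.mem_map.1 h
        exact hinj k ▸ he'
    let ε : {e // e ∈ s} ≃ {e // e ∈ s.map ⟨Sym2.map σ, hinj⟩} :=
      Equiv.subtypeEquiv (Equiv.ofBijective (Sym2.map σ) ⟨hinj, fun e => ⟨Sym2.map σ.symm e, by
        rw [Sym2.map_map]; simp⟩⟩) hmem
    obtain ⟨k⟩ := hs W iW K t ht ⟨ε.trans φ, fun e => by
      obtain ⟨k⟩ := hφ (ε e)
      have k2 : P.deleteEdges {e.1} ≃g Q.deleteEdges {(ε e).1} := by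
        refine ⟨σ.toEquiv, ?_⟩
        intro x y
        rw [deleteEdges_adj, deleteEdges_adj]
        change Q.Adj (σ x) (σ y) ∧ s(σ x, σ y) ≠ Sym2.map σ e.1 ↔ P.Adj x y ∧ s(x, y) ≠ e.1
        rw [σ.map_adj_iff]
        refine and_congr_right fun _ => not_congr ?_
        rw [← Sym2.map_mk]
        exact hinj.eq_iff
      exact ⟨k.trans k2.symm⟩⟩
    exact ⟨k.trans σ⟩

/-- no pair of edges determines the graph -/
def NoGood {U : Type} (P : SimpleGraph U) : Prop :=
  ∀ s : Finset (Sym2 U), s.card = 2 → (↑s : Set (Sym2 U)) ⊆ P.edgeSet → ¬ Good P s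

theorem NoGood.congr {U U' : Type} {P : SimpleGraph U} {Q : SimpleGraph U'} (h : NoGood P)
    (σ : P ≃g Q) : NoGood Q := by
  intro s hs hsub hg
  obtain ⟨s', h1, h2, h3⟩ := good_map σ.symm hg hsub
  exact h s' (h1.trans hs) h2 h3

theorem NoGood.pair {U : Type} {P : SimpleGraph U} (h : NoGood P) {e e' : Sym2 U} (hne : e ≠ e')
    (he : e ∈ P.edgeSet) (he' : e' ∈ P.edgeSet) (s : Finset (Sym2 U))
    (hs : ∀ x, x ∈ s ↔ x = e ∨ x = e') : ¬ Good P s := by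
  classical
  apply h
  · have : s = {e, e'} := by ext x; simp [hs]
    rw [this, Finset.card_pair hne]
  · intro x hx
    rcases (hs x).1 hx with rfl | rfl <;> assumption

variable {A B : Type} [Fintype A] [Fintype B]
variable {G : SimpleGraph A} {H : SimpleGraph B} {a : A} {b : B}
variable {dG : A → A → ℕ} {dH : B → B → ℕ}

theorem same_side {A' B' : Type} {X : SimpleGraph A'} {Y : SimpleGraph B'} {g : A'} {h : B'}
    (hG : MT G dG) (hH : MT H dH) (hlG : 3 ≤ lam dG) (hlH : 3 ≤ lam dH) {x w : A}
    (hl : Leaf dG a x) (hw : w ≠ a) (α : X ≃g G) (β : Y ≃g H) (κ : X ≃g mvg G a w) (hκ : κ g = a)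
    (hp : Nonempty (pn Y h ≃g pn H b)) : Nonempty (J X Y g h ≃g J G H a b) := by
  obtain ⟨τ, hτ⟩ := mv_fix hG hlG hl hw ⟨α.symm.trans κ⟩
  obtain ⟨ρ⟩ := hp
  obtain ⟨ρ'⟩ := pn_congr β h
  obtain ⟨τ', hτ'⟩ := pn_fix hH hlH ⟨ρ'.symm.trans ρ⟩
  refine J_congr (κ.trans τ.symm) (β.trans τ') ?_ hτ'
  change τ.symm (κ g) = a
  have := τ.symm_apply_apply a
  rw [hτ] at this
  rw [hκ]; exact this

theorem q_of_bad (hG : MT G dG) (hH : MT H dH) {m : ℕ} (hA : Fintype.card A = m)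
    (hB : Fintype.card B = m) (hm : 2 ≤ m) (hlG : 3 ≤ lam dG) (hlH : 3 ≤ lam dH) {x : A} {y : B}
    (hl : Leaf dG a x) (hly : Leaf dH b y)
    (hb : ∀ s : Finset (Sym2 (A ⊕ B)), (∀ e, e ∈ s ↔ e = s(Sum.inl a, Sum.inr b) ∨
      e = s(Sum.inl a, Sum.inl x)) → ¬ Good (J G H a b) s) :
    ¬ Isom dG dH ∧ (∃ w, w ≠ a ∧ Isom dH (mvd dG a w)) ∧
      ∃ z, IsLeaf dH z ∧ z ≠ b ∧ Isom dG (mvd dH z b) := by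
  obtain ⟨g, h, f, χ, hf, hfgh, hχ, hn⟩ := bad_extract hH hA hB hb
  have hside : (∃ u w, f = s(Sum.inl u, Sum.inl w)) ∨ ∃ u w, f = s(Sum.inr u, Sum.inr w) := by
    induction f with | _ u w =>
    rcases u with u | u <;> rcases w with w | w
    · exact Or.inl ⟨u, w, rfl⟩
    · rw [mem_edgeSet, J_lr] at hf; rw [hf.1, hf.2] at hfgh; exact absurd rfl hfgh
    · rw [mem_edgeSet, J_rl] at hf; rw [hf.1, hf.2] at hfgh; exact absurd Sym2.eq_swap hfgh
    · exact Or.inr ⟨u, w, rfl⟩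
  rcases hside with ⟨u, w, hfe⟩ | ⟨u, w, hfe⟩
  · exfalso
    obtain ⟨w, hw, ⟨κ, hκ⟩, hp⟩ := lemmaQ hG hG hH hA hB hA hB hm hl χ hfe hχ
    exact hn (same_side hG hH hlG hlH hl hw Iso.refl Iso.refl κ hκ hp)
  · have hχ' := hχ.pre (J_swap H G h g)
    have hfe' : Sym2.map (J_swap H G h g).symm f = s(Sum.inl u, Sum.inl w) := by
      rw [hfe]; rfl
    obtain ⟨w, hw, ⟨κ, hκ⟩, hp⟩ := lemmaQ hG hH hG hA hB hB hA hm hl _ hfe' hχ'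
    have hni : ¬ Nonempty (G ≃g H) := by
      rintro ⟨i⟩
      obtain ⟨k⟩ := same_side hG hH hlG hlH hl hw i.symm i κ hκ hp
      exact hn ⟨(J_swap G H g h).trans k⟩
    refine ⟨fun k => hni ((hG.isom_iff hH).1 k), ⟨w, hw, (hH.isom_iff (hG.mv hl hw)).2 ⟨κ⟩⟩, ?_⟩
    obtain ⟨ρ⟩ := hp
    have hne : ρ none ≠ none := by
      intro e
      apply hni
      have hs : ∀ z, ∃ c, ρ (some z) = some c := by
        intro z
        rcases hc : ρ (some z) with _ | c
        · rw [← e] at hc; simp at hc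
        · exact ⟨c, rfl⟩
      choose r hr using hs
      have rinj : Function.Injective r := by
        intro z z' k
        have : ρ (some z) = ρ (some z') := by rw [hr, hr, k]
        simpa using this
      refine ⟨⟨Equiv.ofBijective r ((Fintype.bijective_iff_injective_and_card r).2
        ⟨rinj, by omega⟩), ?_⟩⟩
      intro z z'
      have := ρ.map_adj_iff (v := some z) (w := some z')
      rw [hr, hr] at this
      exact this
    obtain ⟨z, q, hz, hzb, hi⟩ := pn_four hG hH hly ρ hne
    exact ⟨z, ⟨q, hz⟩, hzb, (hG.isom_iff (hH.mv hz hzb.symm)).2 hi⟩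

/-- some pair determines the graph -/
theorem exists_good (hG : MT G dG) (hH : MT H dH) {m : ℕ} (hA : Fintype.card A = m)
    (hB : Fintype.card B = m) (hm : 2 ≤ m) (hlG : 3 ≤ lam dG) (hlH : 3 ≤ lam dH) {x : A} {y : B}
    (hl : Leaf dG a x) (hly : Leaf dH b y) : ¬ NoGood (J G H a b) := by
  intro hno
  have hno' : NoGood (J H G b a) := hno.congr (J_swap G H a b)
  have q1 := q_of_bad hG hH hA hB hm hlG hlH hl hly
    (hno.pair (by simp) ⟨rfl, rfl⟩ ((hG.adj_leaf hl x).2 rfl))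
  have q2 := q_of_bad hH hG hB hA hm hlH hlG hly hl
    (hno'.pair (by simp) ⟨rfl, rfl⟩ ((hH.adj_leaf hly y).2 rfl))
  have H1 : Half dG dH a := by
    refine ⟨⟨x, hl⟩, q1.2.1, q2.2.2, ?_⟩
    intro v hva hirr
    obtain ⟨p, hp⟩ := hirr.1
    exact five_of_bad hG hH hA hB hm hlG ⟨x, hl⟩ hp hva hirr
      (hno.pair (by simp) ⟨rfl, rfl⟩ ((hG.adj_leaf hp p).2 rfl))
  have H2 : Half dH dG b := by
    refine ⟨⟨y, hly⟩, q2.2.1, q1.2.2, ?_⟩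
    intro v hva hirr
    obtain ⟨p, hp⟩ := hirr.1
    exact five_of_bad hH hG hB hA hm hlH ⟨y, hly⟩ hp hva hirr
      (hno'.pair (by simp) ⟨rfl, rfl⟩ ((hH.adj_leaf hp p).2 rfl))
  exact q1.1 (half_half hG.tm hH.tm (by omega) hlG hlH H1 H2)

end
end

section

section
theorem ern_eq {V : Type} [Fintype V] (P : SimpleGraph V) :
    ern P = sInf {k | ∃ s : Finset (Sym2 V), s.card = k ∧ (↑s : Set (Sym2 V)) ⊆ P.edgeSet ∧ Good P s} :=
  rfl

theorem ern_congr {U U' : Type} [Fintype U] [Fintype U'] {P : SimpleGraph U} {Q : SimpleGraph U'}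
    (σ : P ≃g Q) : ern P = ern Q := by
  rw [ern_eq, ern_eq]
  congr 1
  ext k
  constructor
  · rintro ⟨s, h1, h2, h3⟩
    obtain ⟨s', k1, k2, k3⟩ := good_map σ h3 h2
    exact ⟨s', k1.trans h1, k2, k3⟩
  · rintro ⟨s, h1, h2, h3⟩
    obtain ⟨s', k1, k2, k3⟩ := good_map σ.symm h3 h2
    exact ⟨s', k1.trans h1, k2, k3⟩

theorem not_good_zero {U : Type} (P : SimpleGraph U) (u : U) : ¬ Good P ∅ := by
  intro h
  obtain ⟨k⟩ := h Empty inferInstance ⊥ ∅ (by simp) ⟨⟨fun e => absurd e.2 (Finset.notMem_empty _),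
    fun e => absurd e.2 (Finset.notMem_empty _), fun e => absurd e.2 (Finset.notMem_empty _), fun e => absurd e.2 (Finset.notMem_empty _)⟩,
    fun e => absurd e.2 (Finset.notMem_empty _)⟩
  exact (k.symm u).elim

theorem not_good_one {U : Type} [Fintype U] (P : SimpleGraph U)
    (htri : ∀ x y z, P.Adj x y → P.Adj y z → P.Adj x z → False) {e : Sym2 U} {x y z : U}
    (hxy : P.Adj x y) (hyz : P.Adj y z) (hxz : x ≠ z) (h1 : s(x, y) ≠ e) (h2 : s(y, z) ≠ e) :
    ¬ Good P {e} := by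
  intro h
  let K : SimpleGraph U := P.deleteEdges {e} ⊔ edge x z
  have hK : ∀ u w, K.Adj u w ↔ (P.Adj u w ∧ s(u, w) ≠ e) ∨ s(u, w) = s(x, z) := by
    intro u w
    simp only [K, sup_adj, deleteEdges_adj, Set.mem_singleton_iff, edge_adj]
    constructor
    · rintro (k | k)
      · exact Or.inl k
      · right; rw [Sym2.eq_iff]; exact k.1
    · rintro (k | k)
      · exact Or.inl k
      · right
        rw [Sym2.eq_iff] at k
        refine ⟨k, ?_⟩
        rcases k with ⟨rfl, rfl⟩ | ⟨rfl, rfl⟩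
        · exact hxz
        · exact hxz.symm
  have hne : ¬ P.Adj x z := fun k => htri x y z hxy hyz k
  obtain ⟨k⟩ := h U inferInstance K {s(x, z)} (by
      intro f hf
      simp only [Finset.coe_singleton, Set.mem_singleton_iff] at hf
      rw [hf, mem_edgeSet, hK]; exact Or.inr rfl)
    ⟨⟨fun _ => ⟨s(x, z), by simp⟩, fun _ => ⟨e, by simp⟩,
      fun f => Subtype.ext (Finset.mem_singleton.1 f.2).symm,
      fun f => Subtype.ext (Finset.mem_singleton.1 f.2).symm⟩, by
      intro f
      have hf : f.1 = e := Finset.mem_singleton.1 f.2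
      refine ⟨⟨Equiv.refl U, ?_⟩⟩
      intro u w
      rw [deleteEdges_adj, deleteEdges_adj, hf, hK]
      simp only [Equiv.refl_apply, Set.mem_singleton_iff, Equiv.coe_fn_mk]
      constructor
      · rintro ⟨k1, k2⟩
        refine ⟨Or.inl ⟨k1, k2⟩, fun k => ?_⟩
        rw [← mem_edgeSet, k] at k1
        exact hne k1
      · rintro ⟨k | k, k'⟩
        · exact k
        · exact absurd k k'⟩
  refine htri (k x) (k y) (k z) (k.map_adj_iff.2 ?_) (k.map_adj_iff.2 ?_) (k.map_adj_iff.2 ?_)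
  · rw [hK]; exact Or.inl ⟨hxy, h1⟩
  · rw [hK]; exact Or.inl ⟨hyz, h2⟩
  · rw [hK]; exact Or.inr rfl

theorem MT.tri_free {V : Type} {G : SimpleGraph V} {d : V → V → ℕ} (h : MT G d) (x y z : V)
    (h1 : G.Adj x y) (h2 : G.Adj y z) (h3 : G.Adj x z) : False := by
  have := h.tm.par x y z
  rw [(h.adj _ _).1 h1, (h.adj _ _).1 h2, (h.adj _ _).1 h3] at this
  omega

variable {A B : Type} [Fintype A] [Fintype B]
variable {G : SimpleGraph A} {H : SimpleGraph B} {a : A} {b : B}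
variable {dG : A → A → ℕ} {dH : B → B → ℕ}

theorem ern_J (hG : MT G dG) (hH : MT H dH) {m : ℕ} (hA : Fintype.card A = m)
    (hB : Fintype.card B = m) (hm : 2 ≤ m) (hlG : 3 ≤ lam dG) (hlH : 3 ≤ lam dH) {x : A} {y : B}
    (hl : Leaf dG a x) (hly : Leaf dH b y) : ern (J G H a b) = 2 := by
  classical
  have htri : ∀ x y z, (J G H a b).Adj x y → (J G H a b).Adj y z → (J G H a b).Adj x z → False := by
    intro x y z h1 h2 h3
    rcases x with x | x <;> rcases y with y | y <;> rcases z with z | z <;>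
      simp only [J_ll, J_rr, J_lr, J_rl] at h1 h2 h3
    · exact hG.tri_free x y z h1 h2 h3
    · exact h1.ne (h3.1.trans h2.1.symm)
    · exact h3.ne (h1.1.trans h2.1.symm)
    · exact h2.ne (h1.2.trans h3.2.symm)
    · exact h2.ne (h1.1.trans h3.1.symm)
    · exact h3.ne (h1.2.trans h2.2.symm)
    · exact h1.ne (h3.2.trans h2.2.symm)
    · exact hH.tri_free x y z h1 h2 h3
  have hax : G.Adj a x := (hG.adj_leaf hl x).2 rfl
  have hby : H.Adj b y := (hH.adj_leaf hly y).2 rfl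
  obtain ⟨x2, hx2, hx2a⟩ : ∃ x2, G.Adj x x2 ∧ x2 ≠ a := by
    by_contra hcon
    push Not at hcon
    refine nbr_not_leaf hG.tm hlG hl ⟨a, hG.tm.leaf_of_nbr ((hG.adj _ _).1 hax.symm) ?_⟩
    intro q hq
    exact hcon q ((hG.adj _ _).2 hq)
  have hone : ∀ e, ¬ Good (J G H a b) {e} := by
    intro e
    by_cases he : s(Sum.inl a, Sum.inl x) ≠ e ∧ s(Sum.inl x, Sum.inl x2) ≠ e
    · exact not_good_one (J G H a b) htri (x := Sum.inl a) (y := Sum.inl x) (z := Sum.inl x2) hax hx2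
        (by simpa using hx2a.symm) he.1 he.2
    · refine not_good_one (J G H a b) htri (x := Sum.inl a) (y := Sum.inr b) (z := Sum.inr y) ⟨rfl, rfl⟩ hby
        (by simp) ?_ ?_
      · rintro rfl; apply he; simp
      · rintro rfl; apply he; simp
  have hgood := exists_good hG hH hA hB hm hlG hlH hl hly
  unfold NoGood at hgood
  push Not at hgood
  obtain ⟨s, h1, h2, h3⟩ := hgood
  rw [ern_eq]
  apply le_antisymm
  · exact Nat.sInf_le ⟨s, h1, h2, h3⟩
  · refine le_csInf (Set.nonempty_of_mem (x := 2) ⟨s, h1, h2, h3⟩) ?_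
    rintro k ⟨s', k1, k2, k3⟩
    by_contra hk
    have hk : k = 0 ∨ k = 1 := by omega
    rcases hk with rfl | rfl
    · rw [Finset.card_eq_zero] at k1; subst k1
      exact not_good_zero _ (Sum.inl a) k3
    · rw [Finset.card_eq_one] at k1
      obtain ⟨e, rfl⟩ := k1
      exact hone e k3

end
end

section

section
variable {A : Type} [Fintype A] {G : SimpleGraph A} {d : A → A → ℕ}

theorem geo_point_unique (h : TM d) {a L u w : A} (hu : d a L = d a u + d u L)
    (hw : d a L = d a w + d w L) (he : d a u = d a w) : u = w := by
  apply h.eq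
  have h1 := h.four a L u w
  have h2 := h.symm L w
  have h3 := h.symm L u
  have h4 := h.symm u w
  have h5 : max (d a u + d L w) (d a w + d L u) ≤ d a L := by
    apply max_le <;> omega
  omega

theorem path_of_lam (h : MT G d) {a : A} (ha : IsLeaf d a) (hlam : ¬ 3 ≤ lam d) :
    ∃ k, Nonempty (G ≃g pathGraph k) := by
  classical
  have hinj : Function.Injective (d a) := by
    intro u w e
    by_contra huw
    have hau : a ≠ u := by
      rintro rfl
      rw [h.tm.self] at e
      exact huw (h.tm.eq _ _ e.symm)
    have haw : a ≠ w := by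
      rintro rfl
      rw [h.tm.self] at e
      exact huw (h.tm.eq _ _ e).symm
    obtain ⟨L, hL, hL'⟩ := h.tm.ext_leaf hau
    obtain ⟨M, hM, hM'⟩ := h.tm.ext_leaf haw
    have p1 := h.tm.pos hau
    have p2 := h.tm.pos haw
    have n1 : a ≠ L := by rintro rfl; rw [h.tm.self] at hL'; omega
    have n2 : a ≠ M := by rintro rfl; rw [h.tm.self] at hM'; omega
    have n3 : L ≠ M := by
      rintro rfl
      exact huw (geo_point_unique h.tm hL' hM' e)
    apply hlam
    unfold lam
    have hc : ({a, L, M} : Finset A).card = 3 := Finset.card_eq_three.2 ⟨a, L, M, n1, n2, n3, rfl⟩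
    rw [← hc]
    apply Finset.card_le_card
    intro x hx
    simp only [Finset.mem_insert, Finset.mem_singleton] at hx
    simp only [Finset.mem_filter, Finset.mem_univ, true_and]
    rcases hx with rfl | rfl | rfl <;> assumption
  have hdown : ∀ n u, d a u = n → ∀ k ≤ n, ∃ z, d a z = k := by
    intro n
    induction n with
    | zero => intro u hu k hk; exact ⟨u, by omega⟩
    | succ n ih =>
      intro u hu k hk
      by_cases e : k = n + 1
      · exact ⟨u, by omega⟩
      · have hne : u ≠ a := by rintro rfl; rw [h.tm.self] at hu; omega
        obtain ⟨z, h1, h2⟩ := h.tm.geo u a hne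
        refine ih z ?_ k (by omega)
        have s1 := h.tm.symm z a
        have s2 := h.tm.symm u a
        omega
  have hlt : ∀ u, d a u < Fintype.card A := by
    intro u
    have hsub : Finset.range (d a u + 1) ⊆ Finset.univ.image (d a) := by
      intro k hk
      rw [Finset.mem_range] at hk
      obtain ⟨z, hz⟩ := hdown _ u rfl k (by omega)
      exact Finset.mem_image.2 ⟨z, Finset.mem_univ _, hz⟩
    have h1 := Finset.card_le_card hsub
    rw [Finset.card_range] at h1
    have h2 : (Finset.univ.image (d a)).card ≤ Fintype.card A := Finset.card_image_le
    omega
  refine ⟨Fintype.card A, ⟨Equiv.ofBijective (fun u => (⟨d a u, hlt u⟩ : Fin (Fintype.card A)))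
    ((Fintype.bijective_iff_injective_and_card _).2 ⟨?_, by simp⟩), ?_⟩⟩
  · intro u w e
    exact hinj (by simpa using e)
  · intro u w
    rw [pathGraph_adj, h.adj]
    simp only [Equiv.ofBijective_apply]
    have key : ∀ u w, d a u + 1 = d a w → d u w = 1 := by
      intro u w e
      have hne : w ≠ a := by rintro rfl; rw [h.tm.self] at e; omega
      obtain ⟨z, h1, h2⟩ := h.tm.geo w a hne
      have s1 := h.tm.symm z a
      have s2 := h.tm.symm w a
      have : z = u := hinj (by omega)
      rw [← this, h.tm.symm]; exact h1
    constructor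
    · rintro (e | e)
      · exact key u w e
      · rw [h.tm.symm]; exact key w u e
    · intro e
      have := h.tm.nbr_pm e a
      have s1 := h.tm.symm u a
      have s2 := h.tm.symm w a
      omega

end

section
variable {V : Type} [Fintype V] {T : SimpleGraph V} {a b : V}

theorem del_cases (hc : T.Connected) (v : V) :
    (T.deleteEdges {s(a, b)}).Reachable v a ∨ (T.deleteEdges {s(a, b)}).Reachable v b := by
  obtain ⟨p⟩ := hc.preconnected v a
  have : ∀ u w (p : T.Walk u w), w = a → (T.deleteEdges {s(a, b)}).Reachable u a ∨
      (T.deleteEdges {s(a, b)}).Reachable u b := by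
    intro u w p
    induction p with
    | nil => rintro rfl; exact Or.inl (Reachable.refl _)
    | @cons x y z hxy p ih =>
      intro hw
      by_cases e : s(x, y) = s(a, b)
      · rcases Sym2.eq_iff.1 e with ⟨rfl, _⟩ | ⟨rfl, _⟩
        · exact Or.inl (Reachable.refl _)
        · exact Or.inr (Reachable.refl _)
      · have hadj : (T.deleteEdges {s(a, b)}).Adj x y := by
          rw [deleteEdges_adj]; exact ⟨hxy, e⟩
        rcases ih hw with k | k
        · exact Or.inl (hadj.reachable.trans k)
        · exact Or.inr (hadj.reachable.trans k)
  exact this v a p rfl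

theorem wt_bdd (T : SimpleGraph V) (v : V) :
    BddAbove {n | ∃ c : (T.induce ({v}ᶜ : Set V)).ConnectedComponent, n = Nat.card c.supp} := by
  classical
  refine ⟨Nat.card V, ?_⟩
  rintro n ⟨c, rfl⟩
  exact Nat.card_le_card_of_injective (fun x : c.supp => (x.1.1 : V))
    (fun x y h => Subtype.ext (Subtype.ext h))

/-- `wt b ≥ |A|` -/
theorem wt_lower (hbr : ¬ (T.deleteEdges {s(a, b)}).Reachable a b) :
    Nat.card ((T.deleteEdges {s(a, b)}).connectedComponentMk a).supp ≤ wt T b := by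
  classical
  set D := T.deleteEdges {s(a, b)} with hD
  have hne : ∀ x, D.Reachable x a → x ≠ b := by
    rintro x h rfl; exact hbr h.symm
  have hab : a ≠ b := by rintro rfl; exact hbr (Reachable.refl _)
  have hreach : ∀ u w (p : D.Walk u w), w = a → ∀ hu : u ≠ b,
      (T.induce ({b}ᶜ : Set V)).Reachable ⟨u, hu⟩ ⟨a, hab⟩ := by
    intro u w p
    induction p with
    | nil => rintro rfl hu; exact Reachable.refl _
    | @cons x y z hxy p ih =>
      intro hw hu
      have hy : y ≠ b := hne y (hw ▸ p.reachable)
      refine Reachable.trans (v := ⟨y, hy⟩) (Adj.reachable ?_) (ih hw hy)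
      exact (deleteEdges_le _ hxy : T.Adj x y)
  refine le_trans ?_ (le_csSup (wt_bdd T b)
    ⟨(T.induce ({b}ᶜ : Set V)).connectedComponentMk ⟨a, hab⟩, rfl⟩)
  have hr : ∀ x : (D.connectedComponentMk a).supp, D.Reachable x.1 a := fun x =>
    ConnectedComponent.exact x.2
  refine Nat.card_le_card_of_injective (fun x : (D.connectedComponentMk a).supp =>
    (⟨⟨x.1, hne x.1 (hr x)⟩, ?_⟩ : ((T.induce ({b}ᶜ : Set V)).connectedComponentMk ⟨a, hab⟩).supp)) ?_
  · obtain ⟨p⟩ := hr x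
    exact ConnectedComponent.sound (hreach _ _ p rfl _)
  · intro x y h
    have := congrArg (fun z => (z.1.1 : V)) h
    exact Subtype.ext this

/-- `wt a ≤ max (|A| - 1) |B|` -/
theorem wt_upper (hc : T.Connected) :
    wt T a ≤ max (Nat.card ((T.deleteEdges {s(a, b)}).connectedComponentMk a).supp - 1)
      (Nat.card ((T.deleteEdges {s(a, b)}).connectedComponentMk b).supp) := by
  classical
  set D := T.deleteEdges {s(a, b)} with hD
  apply csSup_le'
  rintro n ⟨c, rfl⟩
  have hstep : ∀ x y : ({a}ᶜ : Set V), (T.induce ({a}ᶜ : Set V)).Reachable x y → D.Reachable x.1 y.1 := by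
    rintro x y ⟨p⟩
    induction p with
    | nil => exact Reachable.refl _
    | @cons x y z hxy p ih =>
      refine Reachable.trans (Adj.reachable ?_) ih
      rw [hD, deleteEdges_adj]
      refine ⟨hxy, fun k => ?_⟩
      rcases Sym2.eq_iff.1 (show s(x.1, y.1) = s(a, b) from k) with k | k
      · exact x.2 k.1
      · exact y.2 k.2
  obtain ⟨x0, hx0⟩ := c.nonempty_supp
  have hcx : ∀ y ∈ c.supp, D.Reachable y.1 x0.1 := by
    intro y hy
    exact hstep _ _ (ConnectedComponent.exact ((show _ = c from hy).trans (show _ = c from hx0).symm))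
  rcases del_cases (a := a) (b := b) hc x0.1 with k | k
  · refine le_trans ?_ (le_max_left _ _)
    have h1 : Nat.card c.supp < Nat.card (D.connectedComponentMk a).supp := by
      have := Nat.card_le_card_of_injective (fun o : Option c.supp =>
        (o.elim ⟨a, rfl⟩ (fun y => ⟨y.1.1, ConnectedComponent.sound ((hcx y.1 y.2).trans k)⟩) :
          (D.connectedComponentMk a).supp)) (by
          intro o o' h
          cases o with
          | none => cases o' with
            | none => rfl
            | some y => exact absurd (congrArg Subtype.val h).symm y.1.2
          | some x => cases o' with
            | none => exact absurd (congrArg Subtype.val h) x.1.2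
            | some y =>
              have h' : x.1.1 = y.1.1 :=
                congrArg (fun z : (D.connectedComponentMk a).supp => z.1) h
              exact congrArg some (Subtype.ext (Subtype.ext h')))
      rw [Finite.card_option] at this
      omega
    omega
  · refine le_trans ?_ (le_max_right _ _)
    refine Nat.card_le_card_of_injective (fun y : c.supp =>
      (⟨y.1.1, ConnectedComponent.sound ((hcx y.1 y.2).trans k)⟩ : (D.connectedComponentMk b).supp)) ?_
    intro x y h
    have h' : x.1.1 = y.1.1 :=
      congrArg (fun z : (D.connectedComponentMk b).supp => z.1) h
    exact Subtype.ext (Subtype.ext h')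

theorem card_le_of_cent (hT : T.IsTree) (hbr : ¬ (T.deleteEdges {s(a, b)}).Reachable a b)
    (hw : wt T b ≤ wt T a) :
    Nat.card ((T.deleteEdges {s(a, b)}).connectedComponentMk a).supp ≤
      Nat.card ((T.deleteEdges {s(a, b)}).connectedComponentMk b).supp := by
  have h1 := wt_lower hbr
  have h2 := wt_upper (a := a) (b := b) hT.connected
  have h3 : 0 < Nat.card ((T.deleteEdges {s(a, b)}).connectedComponentMk a).supp :=
    Nat.card_pos_iff.2 ⟨⟨⟨a, rfl⟩⟩, inferInstance⟩
  rcases le_max_iff.1 h2 with h | h <;> omega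

end
end


/-- data for one centroidal component -/
theorem comp_data {V : Type} [Fintype V] {T D : SimpleGraph V} {a b : V} (hT : T.IsTree)
    (hD : D = T.deleteEdges {s(a, b)}) (hab : T.Adj a b)
    (hdeg : (T.neighborSet a).ncard = 2)
    [Fintype (D.connectedComponentMk a).supp]
    (hG : ¬ IsPseudopath (D.induce (D.connectedComponentMk a).supp)) :
    ∃ d x, MT (D.induce (D.connectedComponentMk a).supp) d ∧ 3 ≤ lam d ∧
      Leaf d (⟨a, rfl⟩ : (D.connectedComponentMk a).supp) x := by
  have hle : D ≤ T := by rw [hD]; exact deleteEdges_le _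
  have hac : D.IsAcyclic := hT.isAcyclic.anti hle
  obtain ⟨d, hd⟩ := exists_MT _ _ (D.induce (D.connectedComponentMk a).supp)
    (hac.isTree_connectedComponent (D.connectedComponentMk a)) rfl
  have hx : ∃ x, x ≠ b ∧ T.neighborSet a = {b, x} := by
    obtain ⟨u, w, huw, hs⟩ := Set.ncard_eq_two.1 hdeg
    have hb : b ∈ T.neighborSet a := hab
    rw [hs] at hb
    rcases hb with rfl | rfl
    · exact ⟨w, huw.symm, hs⟩
    · exact ⟨u, huw, by rw [hs, Set.pair_comm]⟩
  obtain ⟨x, hxb, hs⟩ := hx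
  have hDa : ∀ y, D.Adj a y ↔ y = x := by
    intro y
    have h1 : T.Adj a y ↔ y = b ∨ y = x := by
      rw [← mem_neighborSet, hs]; rfl
    rw [hD, deleteEdges_adj, h1]
    constructor
    · rintro ⟨rfl | h, h2⟩
      · exact absurd rfl h2
      · exact h
    · rintro rfl
      refine ⟨Or.inr rfl, fun k => ?_⟩
      rcases Sym2.eq_iff.1 (show s(a, y) = s(a, b) from k) with k | k
      · exact hxb k.2
      · exact hab.ne k.1
  have hxa : D.Adj a x := (hDa x).2 rfl
  have hleaf : Leaf d (⟨a, rfl⟩ : (D.connectedComponentMk a).supp)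
      ⟨x, ConnectedComponent.sound hxa.symm.reachable⟩ := by
    apply hd.tm.leaf_of_nbr
    · exact (hd.adj _ _).1 hxa
    · intro q hq
      exact Subtype.ext ((hDa q.1).1 ((hd.adj _ _).2 hq))
  refine ⟨d, _, hd, ?_, hleaf⟩
  by_contra hl
  exact hG (Or.inl (path_of_lam hd ⟨_, hleaf⟩ hl))

theorem split_iso {V : Type} [Fintype V] {T D : SimpleGraph V} {a b : V} (hc : T.Connected)
    (hD : D = T.deleteEdges {s(a, b)}) (hab : T.Adj a b) (hbr : ¬ D.Reachable a b) :
    Nonempty (J (D.induce (D.connectedComponentMk a).supp)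
      (D.induce (D.connectedComponentMk b).supp) ⟨a, rfl⟩ ⟨b, rfl⟩ ≃g T) := by
  have hA : ∀ x : (D.connectedComponentMk a).supp, D.Reachable x.1 a := fun x =>
    ConnectedComponent.exact x.2
  have hB : ∀ x : (D.connectedComponentMk b).supp, D.Reachable x.1 b := fun x =>
    ConnectedComponent.exact x.2
  have hle : D ≤ T := by rw [hD]; exact deleteEdges_le _
  have hTD : ∀ x y, T.Adj x y → D.Adj x y ∨ (x = a ∧ y = b) ∨ (x = b ∧ y = a) := by
    intro x y h
    by_cases k : s(x, y) = s(a, b)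
    · exact Or.inr (Sym2.eq_iff.1 k)
    · left
      rw [hD, deleteEdges_adj]
      exact ⟨h, k⟩
  have hne : ∀ (x : (D.connectedComponentMk a).supp) (y : (D.connectedComponentMk b).supp),
      ¬ D.Reachable x.1 y.1 := fun x y h => hbr ((hA x).symm.trans (h.trans (hB y)))
  let f : (D.connectedComponentMk a).supp ⊕ (D.connectedComponentMk b).supp → V :=
    Sum.elim Subtype.val Subtype.val
  have hf : Function.Bijective f := by
    constructor
    · rintro (x | x) (y | y) h
      · exact congrArg Sum.inl (Subtype.ext h)
      · exact absurd (show D.Reachable x.1 y.1 from (show x.1 = y.1 from h) ▸ Reachable.refl _) (hne x y)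
      · exact absurd (show D.Reachable y.1 x.1 from (show x.1 = y.1 from h) ▸ Reachable.refl _) (hne y x)
      · exact congrArg Sum.inr (Subtype.ext h)
    · intro v
      have := del_cases (a := a) (b := b) hc v
      rw [← hD] at this
      rcases this with h | h
      · exact ⟨Sum.inl ⟨v, ConnectedComponent.sound h⟩, rfl⟩
      · exact ⟨Sum.inr ⟨v, ConnectedComponent.sound h⟩, rfl⟩
  refine ⟨⟨Equiv.ofBijective f hf, ?_⟩⟩
  rintro (x | x) (y | y)
  · rw [J_ll]
    change T.Adj x.1 y.1 ↔ D.Adj x.1 y.1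
    refine ⟨fun h => ?_, fun h => hle h⟩
    rcases hTD _ _ h with k | k | k
    · exact k
    · exact absurd ((hA y).symm.trans (k.2 ▸ Reachable.refl _)) hbr
    · exact absurd ((hA x).symm.trans (k.1 ▸ Reachable.refl _)) hbr
  · rw [J_lr]
    change T.Adj x.1 y.1 ↔ _
    constructor
    · intro h
      rcases hTD _ _ h with k | k | k
      · exact absurd k.reachable (hne x y)
      · exact ⟨Subtype.ext k.1, Subtype.ext k.2⟩
      · exact absurd ((hA x).symm.trans (k.1 ▸ Reachable.refl _)) hbr
    · rintro ⟨rfl, rfl⟩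
      exact hab
  · rw [J_rl]
    change T.Adj x.1 y.1 ↔ _
    constructor
    · intro h
      rcases hTD _ _ h with k | k | k
      · exact absurd k.reachable.symm (hne y x)
      · exact absurd ((hA y).symm.trans (k.2 ▸ Reachable.refl _)) hbr
      · exact ⟨Subtype.ext k.2, Subtype.ext k.1⟩
    · rintro ⟨rfl, rfl⟩
      exact hab.symm
  · rw [J_rr]
    change T.Adj x.1 y.1 ↔ D.Adj x.1 y.1
    refine ⟨fun h => ?_, fun h => hle h⟩
    rcases hTD _ _ h with k | k | k
    · exact k
    · exact absurd ((show D.Reachable a x.1 from k.1 ▸ Reachable.refl _).trans (hB x)) hbr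
    · exact absurd ((show D.Reachable a y.1 from k.2 ▸ Reachable.refl _).trans (hB y)) hbr

/-- If `T` is a bicentroidal tree with centroidal edge `ab`, both centroidal vertices have
degree 2, and neither centroidal component is a pseudopath, then `ern(T) = 2`. -/
theorem stmt7 {V : Type} [Fintype V] (T : SimpleGraph V) (hT : T.IsTree)
    (a b : V) (hab : T.Adj a b) (hcent : centroid T = {a, b})
    (hdega : (T.neighborSet a).ncard = 2) (hdegb : (T.neighborSet b).ncard = 2)
    (hG : ¬ IsPseudopath
      ((T.deleteEdges {s(a, b)}).induce
        ((T.deleteEdges {s(a, b)}).connectedComponentMk a).supp))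
    (hH : ¬ IsPseudopath
      ((T.deleteEdges {s(a, b)}).induce
        ((T.deleteEdges {s(a, b)}).connectedComponentMk b).supp)) :
    ern T = 2 := by
  classical
  have hbr : ¬ (T.deleteEdges {s(a, b)}).Reachable a b :=
    isBridge_iff.1 (isAcyclic_iff_forall_adj_isBridge.1 hT.isAcyclic hab)
  have hca : a ∈ centroid T := by rw [hcent]; exact Or.inl rfl
  have hcb : b ∈ centroid T := by rw [hcent]; exact Or.inr rfl
  have h1 := card_le_of_cent hT hbr (hcb a)
  have hbr' : ¬ (T.deleteEdges {s(b, a)}).Reachable b a := by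
    rw [Sym2.eq_swap]; exact fun h => hbr h.symm
  have h2 := card_le_of_cent hT hbr' (hca b)
  rw [Sym2.eq_swap] at h2
  generalize hD : T.deleteEdges {s(a, b)} = D at *
  have hD' : D = T.deleteEdges {s(b, a)} := by rw [← hD, Sym2.eq_swap]
  obtain ⟨σ⟩ := split_iso hT.connected hD.symm hab hbr
  obtain ⟨d, x, hd, hl, hx⟩ := comp_data hT hD.symm hab hdega hG
  obtain ⟨d', y, hd', hl', hy⟩ := comp_data hT hD' hab.symm hdegb hH
  rw [← ern_congr σ]
  have hcard := le_antisymm h1 h2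
  rw [Nat.card_eq_fintype_card, Nat.card_eq_fintype_card] at hcard
  exact ern_J hd hd' hcard rfl (hcard ▸ Fintype.one_lt_card_iff.2 ⟨_, _, hx.1⟩) hl hl' hx hy


end ErnPaper
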